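/- arXiv:math/0408214 — 5 statements merged into one kernel-verified Lean document; each statement's English description precedes it below -/
import Mathlib

section
/- Let η ∈ ℚ₃ be such that for some sequence (k_j) of positive integers with k_j → ∞ (in ℝ) and ‖k_j + 1‖₃ → 0, the rationals −(1 − 3^{2k_j − 1})·B_{2k_j}/(2k_j) converge to η in ℚ₃ (i.e. η = ζ₃(3)). Set θ = (6·log 3)/(3·log 3 + 3) = 6/(3 + 3/log 3) = 1.0469892839… . Then for every ε > 0 there exist sequences of integers (p_n), (q_n) with q_n ≠ 0 for all n and |q_n| → ∞, such that for all sufficiently large n: 0 < ‖η − p_n/q_n‖₃ ≤ (max(|p_n|, |q_n|))^{−(θ − ε)}. -/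
namespace Z3
open Finset

/-- `C(n,k) C(n+k,k)` -/
def bet (n k : ℕ) : ℚ := (n.choose k : ℚ) * ((n+k).choose k : ℚ)

def w : ℕ → ℚ
  | 0 => 1
  | (k+1) => w k * (-2/9 - k*(k+1)) / (k+1)^2

def E (k : ℕ) : ℚ := ∑ m ∈ range k, (-1)^m / (((m:ℚ)+1)^3 * w (m+1))
def Qs (n : ℕ) : ℚ := ∑ k ∈ range (n+1), bet n k * w k
def Ps (n : ℕ) : ℚ := ∑ k ∈ range (n+1), bet n k * w k * E k

lemma w_succ (k : ℕ) : w (k+1) = w k * (-2/9 - k*(k+1)) / (k+1)^2 := rfl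

lemma w_ne (k : ℕ) : w k ≠ 0 := by
  induction k with
  | zero => simp [w]
  | succ k ih =>
    rw [w_succ]
    have h : (-2/9 - (k:ℚ)*(k+1)) ≠ 0 := by
      have : (0:ℚ) ≤ (k:ℚ)*(k+1) := by positivity
      linarith
    positivity

lemma bet_zero_of_lt {n k : ℕ} (h : n < k) : bet n k = 0 := by
  simp [bet, Nat.choose_eq_zero_of_lt h]

lemma bet_n (n k : ℕ) : ((n:ℚ)+1+k) * bet n k = ((n:ℚ)+1-k) * bet (n+1) k := by
  have h1 : ((n:ℚ)+1-k) * ((n+1).choose k : ℚ) = (n+1) * (n.choose k : ℚ) := by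
    rcases le_or_gt k (n+1) with h | h
    · have h2 := Nat.choose_mul_succ_eq n k
      have h3 : ((n.choose k * (n+1) : ℕ):ℚ) = (((n+1).choose k * (n+1-k) : ℕ) : ℚ) := by rw [h2]
      push_cast [Nat.cast_sub h] at h3
      linarith
    · rw [Nat.choose_eq_zero_of_lt h, Nat.choose_eq_zero_of_lt (by omega)]; simp
  have h2 : ((n:ℚ)+1) * ((n+1+k).choose k : ℚ) = (n+1+k) * ((n+k).choose k : ℚ) := by
    have h2 := Nat.choose_mul_succ_eq (n+k) k
    have h3 : ((n+k+1-k)) = n+1 := by omega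
    rw [h3] at h2
    have h4 : (((n+k).choose k * (n+k+1) : ℕ):ℚ) = (((n+k+1).choose k * (n+1) : ℕ) : ℚ) := by rw [h2]
    push_cast at h4
    rw [show n+1+k = n+k+1 by ring]
    linarith
  have hn : (n:ℚ)+1 ≠ 0 := by positivity
  unfold bet
  apply mul_left_cancel₀ hn
  linear_combination (-(n+1:ℚ) * ((n+1+k).choose k : ℚ)) * h1 - (n+1) * (n.choose k : ℚ) * h2

lemma bet_k (n k : ℕ) : ((k:ℚ)+1)^2 * bet n (k+1) = ((n:ℚ)-k)*(n+k+1) * bet n k := by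
  have h1 : ((k:ℚ)+1) * (n.choose (k+1) : ℚ) = (n-k) * (n.choose k : ℚ) := by
    rcases le_or_gt k n with h | h
    · have h2 := Nat.choose_succ_right_eq n k
      have h3 : ((n.choose (k+1) * (k+1) : ℕ):ℚ) = ((n.choose k * (n-k) : ℕ) : ℚ) := by rw [h2]
      push_cast [Nat.cast_sub h] at h3
      linarith
    · rw [Nat.choose_eq_zero_of_lt h, Nat.choose_eq_zero_of_lt (by omega)]; simp
  have h2 : ((k:ℚ)+1) * ((n+(k+1)).choose (k+1) : ℚ) = (n+k+1) * ((n+k).choose k : ℚ) := by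
    have h2 := Nat.add_one_mul_choose_eq (n+k) k
    have h4 : (((n+k+1)* (n+k).choose k : ℕ):ℚ) = (((n+k+1).choose (k+1) * (k+1) : ℕ) : ℚ) := by rw [h2]
    push_cast at h4
    rw [show n+(k+1) = n+k+1 by ring]
    linarith
  unfold bet
  linear_combination ((k+1:ℚ) * ((n+(k+1)).choose (k+1) : ℚ)) * h1 + (n-k) * (n.choose k : ℚ) * h2

lemma bet_nk (n k : ℕ) : ((n:ℚ)+k+1)*(n+k+2) * bet n k = ((k:ℚ)+1)^2 * bet (n+1) (k+1) := by
  have h := bet_n n k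
  have h2 := bet_k (n+1) k
  push_cast at h2
  linear_combination (n+k+2:ℚ) * h - h2

/-- The basic identity for the telescoping. -/
lemma bet_id (n k : ℕ) :
    ((n:ℚ)+2)^3 * bet (n+2) k - (((n:ℚ)+2)^3 + (n+1)^3 + 2*(2*n+3)*(k*(k+1))) * bet (n+1) k
      + ((n:ℚ)+1)^3 * bet n k = 2*(2*n+3)*k^2 * bet (n+1) (k-1) := by
  have h1 := bet_n n k
  have h2 := bet_n (n+1) k
  push_cast at h2
  have e1 : bet n k = ((n:ℚ)+1-k) * bet (n+1) k / (n+1+k) := by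
    field_simp; linarith
  have e2 : bet (n+1) k = ((n:ℚ)+1+1-k) * bet (n+2) k / (n+1+1+k) := by
    field_simp; linarith
  rcases k with _ | k
  · simp only [Nat.cast_zero] at *
    rw [e1, e2]; field_simp; ring
  · have h3 := bet_nk (n+1) k
    push_cast at *
    have e3 : bet (n+1) k = ((k:ℚ)+1)^2 * bet (n+2) (k+1) / ((n+1+k+1)*(n+1+k+2)) := by
      field_simp; linarith
    rw [e3, e1, e2]; field_simp; ring

def Bp (n k : ℕ) : ℚ := -2*(2*n+3) * k^2 * bet (n+1) (k-1) * w k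

lemma lam_tel (n k : ℕ) :
    ((n:ℚ)+2)^3 * (bet (n+2) k * w k) - (2*n+3)*((n+1)^2+(n+1)+5/9) * (bet (n+1) k * w k)
      + ((n:ℚ)+1)^3 * (bet n k * w k) = Bp n (k+1) - Bp n k := by
  have h := bet_id n k
  have h1 : ((k:ℚ)+1)^2 * w (k+1) = w k * (-2/9 - k*(k+1)) := by
    rw [w_succ]; field_simp
  unfold Bp
  rw [Nat.add_sub_cancel]
  push_cast
  linear_combination w k * h + 2*(2*n+3)*bet (n+1) k * h1

lemma Q_ext (f : ℕ → ℚ) (n K : ℕ) (h : n + 1 ≤ K) :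
    ∑ k ∈ range (n+1), bet n k * w k * f k = ∑ k ∈ range K, bet n k * w k * f k := by
  apply Finset.sum_subset
  · intro a; simp; omega
  · intro a _ h2
    rw [bet_zero_of_lt (by simpa using h2)]; simp

lemma rec_gen (f : ℕ → ℚ) (n : ℕ) :
    ((n:ℚ)+2)^3 * (∑ k ∈ range (n+2+1), bet (n+2) k * w k * f k)
     - (2*n+3)*((n+1)^2+(n+1)+5/9) * (∑ k ∈ range (n+1+1), bet (n+1) k * w k * f k)
      + ((n:ℚ)+1)^3 * (∑ k ∈ range (n+1), bet n k * w k * f k) 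
    = ∑ k ∈ range (n+3), (Bp n (k+1) - Bp n k) * f k := by
  rw [Q_ext f (n+2) (n+3) (by omega), Q_ext f (n+1) (n+3) (by omega), Q_ext f n (n+3) (by omega),
    mul_sum, mul_sum, mul_sum, ← sum_sub_distrib, ← sum_add_distrib]
  apply sum_congr rfl
  intro k _
  linear_combination f k * lam_tel n k

lemma Q_rec (n : ℕ) :
    ((n:ℚ)+2)^3 * Qs (n+2) - (2*n+3)*((n+1)^2+(n+1)+5/9) * Qs (n+1) + ((n:ℚ)+1)^3 * Qs n = 0 := by
  have := rec_gen (fun _ => 1) n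
  simp only [mul_one] at this
  unfold Qs
  rw [this, Finset.sum_range_sub]
  simp [Bp, bet_zero_of_lt]

lemma P_tel (n K : ℕ) : ∑ k ∈ range K, (Bp n (k+1) - Bp n k) * E k
    = Bp n K * E K + 2*(2*n+3) * ∑ k ∈ range K, (-1)^k * bet (n+1) k / (k+1) := by
  induction K with
  | zero => simp [E]
  | succ K ih =>
    have hE : E (K+1) = E K + (-1)^K / (((K:ℚ)+1)^3 * w (K+1)) := by
      simp [E, sum_range_succ]
    rw [sum_range_succ, ih, sum_range_succ, hE]
    have : Bp n (K+1) * ((-1)^K / (((K:ℚ)+1)^3 * w (K+1))) 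
        = - (2*(2*n+3) * ((-1)^K * bet (n+1) K / (K+1))) := by
      have := w_ne (K+1)
      unfold Bp; rw [Nat.add_sub_cancel]; push_cast; field_simp
    linear_combination -this

lemma t_sum (n K : ℕ) : ((n:ℚ)+1)*(n+2) * ∑ k ∈ range K, (-1)^k * bet (n+1) k / ((k:ℚ)+1)
    = - (K * ((-1)^K * bet (n+1) K)) := by
  induction K with
  | zero => simp
  | succ K ih =>
    rw [sum_range_succ, mul_add, ih]
    have h := bet_k (n+1) K
    push_cast at *
    have e : bet (n+1) (K+1) = ((n:ℚ)+1-K)*(n+1+K+1) * bet (n+1) K / (K+1)^2 := by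
      field_simp; linarith
    rw [e, pow_succ]; field_simp; ring

lemma P_rec (n : ℕ) :
    ((n:ℚ)+2)^3 * Ps (n+2) - (2*n+3)*((n+1)^2+(n+1)+5/9) * Ps (n+1) + ((n:ℚ)+1)^3 * Ps n = 0 := by
  have := rec_gen E n
  unfold Ps
  rw [this, P_tel]
  have h := t_sum n (n+3)
  rw [bet_zero_of_lt (by omega)] at h
  have hn : ((n:ℚ)+1)*(n+2) ≠ 0 := by positivity
  have h0 : ∑ k ∈ range (n+3), (-1)^k * bet (n+1) k / ((k:ℚ)+1) = 0 := by
    simpa [hn] using h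
  rw [h0]; simp [Bp, bet_zero_of_lt]

lemma Q0 : Qs 0 = 1 := by simp [Qs, bet, w]
lemma Q1 : Qs 1 = 5/9 := by norm_num [Qs, bet, w, sum_range_succ]
lemma P0 : Ps 0 = 0 := by simp [Ps, bet, w, E]
lemma P1 : Ps 1 = 2 := by norm_num [Ps, bet, w, E, sum_range_succ]

lemma casor (n : ℕ) : Qs n * Ps (n+1) - Qs (n+1) * Ps n = 2 / ((n:ℚ)+1)^3 := by
  induction n with
  | zero => simp [Q0, Q1, P0, P1]
  | succ n ih =>
    have h1 := Q_rec n
    have h2 := P_rec n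
    rw [eq_div_iff (by positivity)] at ih ⊢
    push_cast
    linear_combination Qs (n+1) * h2 - Ps (n+1) * h1 + ih

/-- polynomial growth from the recurrence -/
lemma growth (f : ℕ → ℚ) (M : ℚ) (h0 : |f 0| ≤ M) (h1 : |f 1 - f 0| ≤ M/2)
    (hr : ∀ n : ℕ, ((n:ℚ)+2)^3 * f (n+2) - (2*n+3)*((n+1)^2+(n+1)+5/9) * f (n+1) 
      + ((n:ℚ)+1)^3 * f n = 0) (n : ℕ) :
    |f n| ≤ M * (n+1) ∧ ((n:ℚ)+1)^3 * |f (n+1) - f n| ≤ M * ((n:ℚ)+1)^3 := by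
  have hM : 0 ≤ M := (abs_nonneg _).trans h0
  induction n with
  | zero => simp; exact ⟨h0, by linarith⟩
  | succ n ih =>
    obtain ⟨ih1, ih2⟩ := ih
    have hn : (0:ℚ) < ((n:ℚ)+1)^3 := by positivity
    have ih3 : |f (n+1) - f n| ≤ M := by
      apply le_of_mul_le_mul_left _ hn; linarith
    have hb : |f (n+1)| ≤ M * (n+2) := by
      calc |f (n+1)| = |f n + (f (n+1) - f n)| := by ring_nf
        _ ≤ |f n| + |f (n+1) - f n| := abs_add_le _ _
        _ ≤ _ := by linarith
    push_cast
    refine ⟨by linarith, ?_⟩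
    have key : ((n:ℚ)+2)^3 * (f (n+2) - f (n+1)) =
      (n+1)^3 * (f (n+1) - f n) + -(4/9*(2*n+3) * f (n+1)) := by
      linear_combination hr n
    have : ((n:ℚ)+2)^3 * |f (n+2) - f (n+1)| ≤ (n+1)^3 * |f (n+1) - f n| + 4/9*(2*n+3)*|f (n+1)| := by
      have hn2 : (0:ℚ) < ((n:ℚ)+2)^3 := by positivity
      have h49 : (0:ℚ) < 4/9*(2*n+3) := by positivity
      rw [← abs_of_pos hn2, ← abs_mul, key]
      refine (abs_add_le _ _).trans ?_
      rw [abs_neg, abs_mul, abs_mul, abs_of_pos hn, abs_of_pos h49]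
    have h3 : 4/9*(2*(n:ℚ)+3)*|f (n+1)| ≤ 4/9*(2*n+3)*(M*(n+2)) := by gcongr
    have h4 : ((n:ℚ)+1+1)^3 = (n+2)^3 := by ring
    rw [h4]
    have : 4/9*(2*(n:ℚ)+3)*(M*(n+2)) + M * (n+1)^3 ≤ M*(n+2)^3 := by
      have : 4/9*(2*(n:ℚ)+3)*(n+2) + (n+1)^3 ≤ (n+2)^3 := by nlinarith
      nlinarith
    linarith

lemma Q_growth (n : ℕ) : |Qs n| ≤ 4 * (n+1) :=
  (growth Qs 4 (by rw [Q0]; norm_num) (by rw [Q0, Q1]; norm_num [abs_le]) Q_rec n).1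
lemma P_growth (n : ℕ) : |Ps n| ≤ 4 * (n+1) :=
  (growth Ps 4 (by rw [P0]; norm_num) (by rw [P0, P1]; norm_num [abs_le]) P_rec n).1

end Z3

namespace Z3
open Finset

def ZZ : Subring ℚ := (Int.castRingHom ℚ).range

lemma mem_ZZ {q : ℚ} : q ∈ ZZ ↔ ∃ a : ℤ, q = a := by
  unfold ZZ; rw [RingHom.mem_range]
  exact ⟨fun ⟨a, h⟩ => ⟨a, by rw [← h]; simp⟩, fun ⟨a, h⟩ => ⟨a, by rw [h]; simp⟩⟩

lemma div_mem_ZZ {a b : ℕ} (h : b ∣ a) : (a:ℚ)/b ∈ ZZ := by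
  obtain ⟨c, rfl⟩ := h
  rcases Nat.eq_zero_or_pos b with rfl | hb
  · simp [ZZ.zero_mem]
  · have : (b:ℚ) ≠ 0 := by positivity
    rw [Nat.cast_mul, mul_div_cancel_left₀ _ this]; exact natCast_mem _ _

/-- `1/(m C(k,m))` times a common multiple is an integer. -/
lemma leib (d n : ℕ) (hd : ∀ i, 1 ≤ i → i ≤ n → i ∣ d) (m : ℕ) :
    ∀ k, m + 1 ≤ k → k ≤ n → (d:ℚ) / ((m+1) * (k.choose (m+1) : ℚ)) ∈ ZZ := by
  induction m with
  | zero =>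
    intro k h1 h2
    simpa using div_mem_ZZ (hd k h1 h2)
  | succ m ih =>
    intro k h1 h2
    obtain ⟨k, rfl⟩ : ∃ k', k = k' + 1 := ⟨k-1, by omega⟩
    have a1 := ih k (by omega) (by omega)
    have a2 := ih (k+1) (by omega) (by omega)
    convert ZZ.sub_mem a1 a2 using 1
    have c1 : (0:ℚ) < (k.choose (m+1) : ℚ) := by exact_mod_cast Nat.choose_pos (by omega)
    have c2 : (0:ℚ) < ((k+1).choose (m+1) : ℚ) := by exact_mod_cast Nat.choose_pos (by omega)
    have c3 : (0:ℚ) < ((k+1).choose (m+2) : ℚ) := by exact_mod_cast Nat.choose_pos (by omega)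
    have e1 : ((k+1).choose (m+2) : ℚ) * (m+2) = (k+1) * (k.choose (m+1) : ℚ) := by
      have := Nat.add_one_mul_choose_eq k (m+1)
      have h : (((k+1) * k.choose (m+1) : ℕ):ℚ) = (((k+1).choose (m+2) * (m+2) : ℕ):ℚ) := by rw [this]
      push_cast at h; linarith
    have e2 : (k.choose (m+1) : ℚ) * (k+1) = ((k+1).choose (m+1) : ℚ) * (k - m) := by
      have := Nat.choose_mul_succ_eq k (m+1)
      have h : ((k.choose (m+1) * (k+1) : ℕ):ℚ) = (((k+1).choose (m+1) * (k + 1 - (m+1)) : ℕ):ℚ) := by rw [this]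
      rw [show k + 1 - (m+1) = k - m by omega] at h
      push_cast [Nat.cast_sub (show m ≤ k by omega)] at h; linarith
    have hk : (0:ℚ) < (k:ℚ) - m := by
      have : (m:ℚ) + 1 ≤ k := by exact_mod_cast (by omega : m + 1 ≤ k)
      linarith
    have f2 : ((k+1).choose (m+1) : ℚ) = (k.choose (m+1) : ℚ) * (k+1) / (k-m) := by
      field_simp; linarith
    have f3 : ((k+1).choose (m+1+1) : ℚ) = (k+1) * (k.choose (m+1) : ℚ) / (m+2) := by
      field_simp; linarith
    rw [f2, f3]; push_cast; field_simp; ring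

def A (m j : ℕ) : ℕ := ∏ i ∈ range j, (3*(m+i)+1)*(3*(m+i)+2)

lemma arith_dvd (s j a : ℕ) (hs : s ∣ j.factorial) (h3 : Nat.Coprime 3 s) :
    s ∣ ∏ i ∈ range j, (3*i + a) := by
  obtain ⟨c, hc⟩ : ∃ c : ℕ, 3 * c ≡ 1 [MOD s] := by
    rcases lt_or_ge 1 s with h | h
    · obtain ⟨c, -, hc⟩ := Nat.exists_mul_mod_eq_one_of_coprime h3 h
      exact ⟨c, by rw [Nat.ModEq, hc, Nat.mod_eq_of_lt h]⟩
    · have : s ≠ 0 := by rintro rfl; exact Nat.factorial_ne_zero j (zero_dvd_iff.1 hs)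
      have : s = 1 := by omega
      subst this
      exact ⟨0, Nat.modEq_one⟩
  have h1 : ∏ i ∈ range j, (3*i + a) ≡ ∏ i ∈ range j, (3 * (c*a + i)) [MOD s] := by
    have : ∀ J, ∏ i ∈ range J, (3*i + a) ≡ ∏ i ∈ range J, (3 * (c*a + i)) [MOD s] := by
      intro J
      induction J with
      | zero => rfl
      | succ J ih =>
        rw [prod_range_succ, prod_range_succ]
        apply ih.mul
        have : a * (3 * c) ≡ a * 1 [MOD s] := hc.mul_left a
        have h2 := (this.add_left (3*J)).symm
        rw [mul_one] at h2
        convert h2 using 1; ring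
    exact this j
  have h2 : s ∣ ∏ i ∈ range j, (3 * (c*a + i)) := by
    rw [prod_mul_distrib]
    apply Dvd.dvd.mul_left
    rw [← Nat.ascFactorial_eq_prod_range]
    exact hs.trans (Nat.factorial_dvd_ascFactorial _ _)
  exact (h1.dvd_iff (dvd_refl s)).2 h2

lemma fact_dvd (m j : ℕ) : (j.factorial)^2 ∣ 3^j * A m j := by
  obtain ⟨v, s, hs, he⟩ := Nat.exists_eq_pow_mul_and_not_dvd (Nat.factorial_ne_zero j) 3 (by norm_num)
  have hc : Nat.Coprime 3 s := (Nat.Prime.coprime_iff_not_dvd Nat.prime_three).2 hs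
  have hsd : s ∣ j.factorial := ⟨3^v, by rw [he]; ring⟩
  have hv : 2 * v ≤ j := by
    have : Fact (Nat.Prime 3) := ⟨Nat.prime_three⟩
    have := sub_one_mul_padicValNat_factorial (p := 3) j
    have hv : v ≤ padicValNat 3 j.factorial := by
      rw [← padicValNat_dvd_iff_le (Nat.factorial_ne_zero j)]
      exact ⟨s, he⟩
    omega
  have e1 : A m j = (∏ i ∈ range j, (3*i + (3*m+1))) * (∏ i ∈ range j, (3*i + (3*m+2))) := by
    unfold A; rw [← prod_mul_distrib]; apply prod_congr rfl; intro i _; ring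
  have a1 := arith_dvd s j (3*m+1) hsd hc
  have a2 := arith_dvd s j (3*m+2) hsd hc
  rw [he, e1, mul_pow]
  apply mul_dvd_mul
  · rw [← pow_mul]; exact pow_dvd_pow _ (by omega)
  · rw [pow_two]; exact mul_dvd_mul a1 a2

lemma w_ratio (m j : ℕ) : w (m+j) * (-27)^j * ((m+j).factorial:ℚ)^2
    = w m * 3^j * (A m j : ℚ) * (m.factorial:ℚ)^2 := by
  induction j with
  | zero => simp [A]
  | succ j ih =>
    have hA : A m (j+1) = A m j * ((3*(m+j)+1)*(3*(m+j)+2)) := by simp [A, prod_range_succ]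
    rw [← add_assoc, w_succ, Nat.factorial_succ, hA]
    push_cast
    have : ((m:ℚ)+j+1) ≠ 0 := by positivity
    field_simp
    push_cast at ih
    rw [pow_succ, pow_succ]
    linear_combination (27*((3*((m:ℚ)+j)+1)*(3*(m+j)+2))) * ih

lemma w_ratio' (m j : ℕ) : ∃ I : ℕ, w (m+j) * (-27)^j * ((m+j).choose m:ℚ)^2 = w m * I := by
  obtain ⟨I, hI⟩ := fact_dvd m j
  refine ⟨I, ?_⟩
  have h := w_ratio m j
  have h2 : ((m+j).factorial : ℚ) = (m+j).choose m * m.factorial * j.factorial := by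
    have := Nat.add_choose_mul_factorial_mul_factorial m j
    rw [← this, Nat.choose_symm_add]; push_cast; ring
  have h3 : (3:ℚ)^j * A m j = (j.factorial:ℚ)^2 * I := by exact_mod_cast hI
  have hm : (m.factorial:ℚ) ≠ 0 := by positivity
  have hj : (j.factorial:ℚ) ≠ 0 := by positivity
  rw [h2] at h
  have : ((m.factorial:ℚ)^2 * (j.factorial:ℚ)^2) ≠ 0 := by positivity
  apply mul_left_cancel₀ this
  linear_combination h + w m * (m.factorial:ℚ)^2 * h3

lemma bet_mem (n k : ℕ) : bet n k ∈ ZZ := ZZ.mul_mem (natCast_mem _ _) (natCast_mem _ _)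

lemma Q_int (n : ℕ) : (27:ℚ)^n * Qs n ∈ ZZ := by
  unfold Qs
  rw [mul_sum]
  apply ZZ.sum_mem
  intro k hk
  rw [mem_range] at hk
  obtain ⟨I, hI⟩ := w_ratio' 0 k
  simp only [zero_add, Nat.choose_zero_right, Nat.cast_one, one_pow, mul_one, w, one_mul] at hI
  obtain ⟨r, rfl⟩ : ∃ r, n = k + r := ⟨n-k, by omega⟩
  have : (27:ℚ)^(k+r) * (bet (k+r) k * w k) = 27^r * (-1)^k * bet (k+r) k * I := by
    rw [← hI, show (-27:ℚ) = (-1)*27 by norm_num, mul_pow, pow_add]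
    have : ((-1:ℚ)^k)*(-1)^k = 1 := by rw [← mul_pow]; simp
    linear_combination (-27^k*27^r*bet (k+r) k*w k) * this
  rw [this]
  refine ZZ.mul_mem (ZZ.mul_mem (ZZ.mul_mem ?_ ?_) (bet_mem _ _)) (natCast_mem _ _)
  · exact ZZ.pow_mem (by exact_mod_cast natCast_mem ZZ 27) _
  · exact ZZ.pow_mem (ZZ.neg_mem ZZ.one_mem) _

lemma P_int (d n : ℕ) (hd : ∀ i, 1 ≤ i → i ≤ n → i ∣ d) : (27:ℚ)^n * d^3 * Ps n ∈ ZZ := by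
  unfold Ps
  rw [mul_sum]
  apply ZZ.sum_mem
  intro k hk
  rw [mem_range] at hk
  unfold E
  rw [mul_sum, mul_sum]
  apply ZZ.sum_mem
  intro m hm
  rw [mem_range] at hm
  obtain ⟨j, rfl⟩ : ∃ j, k = m + 1 + j := ⟨k-(m+1), by omega⟩
  obtain ⟨I, hI⟩ := w_ratio' (m+1) j
  obtain ⟨r, rfl⟩ : ∃ r, n = j + r := ⟨n-j, by omega⟩
  have h1 := leib d (j+r) hd m (m+1+j) (by omega) (by omega)
  have h2 := div_mem_ZZ (hd (m+1) (by omega) (by omega))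
  set c : ℚ := ((m+1+j).choose (m+1) : ℚ) with hc
  have hc0 : c ≠ 0 := by
    have : 0 < (m+1+j).choose (m+1) := Nat.choose_pos (by omega)
    rw [hc]; positivity
  have hw := w_ne (m+1)
  have hj : ((-1:ℚ)^j)*(-1)^j = 1 := by rw [← mul_pow]; simp
  have : (27:ℚ)^(j+r) * d^3 * (bet (j+r) (m+1+j) * w (m+1+j) * ((-1)^m / (((m:ℚ)+1)^3 * w (m+1))))
     = 27^r * (-1)^j * (-1)^m * bet (j+r) (m+1+j) * I * (d / ((m+1)*c))^2 * (d/((m+1:ℕ):ℚ)) := by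
    push_cast
    have hI' : (I:ℚ) = w (m+1+j) * (-27)^j * c^2 / w (m+1) := by field_simp; linarith
    rw [hI', show (-27:ℚ) = (-1)*27 by norm_num, mul_pow, pow_add]
    field_simp
    linear_combination (-(d:ℚ)^3*w (m+1+j)*(bet (j+r) (m+1+j))) * hj
  rw [this]
  have hm1 : ∀ i : ℕ, ((-1:ℚ))^i ∈ ZZ := fun i => ZZ.pow_mem (ZZ.neg_mem ZZ.one_mem) _
  refine ZZ.mul_mem (ZZ.mul_mem (ZZ.mul_mem (ZZ.mul_mem (ZZ.mul_mem (ZZ.mul_mem ?_ (hm1 _)) (hm1 _)) (bet_mem _ _)) (natCast_mem _ _)) (ZZ.pow_mem h1 _)) h2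
  exact ZZ.pow_mem (by exact_mod_cast natCast_mem ZZ 27) _
end Z3

namespace Z3
open Finset Filter Topology

noncomputable def S (N : ℕ) (f : ℕ → ℚ_[3]) : ℚ_[3] := (∑ t ∈ range (3^N), f t) / 3^N

lemma norm3 : ‖(3:ℚ_[3])‖ = 3⁻¹ := by
  have := Padic.norm_p (p := 3); exact_mod_cast this

lemma norm_nat_le (m : ℕ) : ‖(m:ℚ_[3])‖ ≤ 1 := by
  have := Padic.norm_int_le_one (p := 3) (m:ℤ); exact_mod_cast this

lemma norm_nat_one {m : ℕ} (h : ¬ 3 ∣ m) : ‖(m:ℚ_[3])‖ = 1 := by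
  refine le_antisymm (norm_nat_le m) ?_
  by_contra hc
  push Not at hc
  exact h (Padic.norm_natCast_lt_one_iff.1 hc)

lemma one_le_nat_mul_norm {m : ℕ} (h : m ≠ 0) : 1 ≤ (m:ℝ) * ‖(m:ℚ_[3])‖ := by
  obtain ⟨v, s, hs, he⟩ := Nat.exists_eq_pow_mul_and_not_dvd h 3 (by norm_num)
  have hs1 : (1:ℝ) ≤ s := by
    have : s ≠ 0 := by rintro rfl; simp at hs
    exact_mod_cast Nat.one_le_iff_ne_zero.2 this
  rw [he]; push_cast
  rw [norm_mul, norm_pow, norm3, norm_nat_one hs, inv_pow]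
  have : (0:ℝ) < 3^v := by positivity
  field_simp; exact hs1

lemma S_shift (N : ℕ) (f : ℕ → ℚ_[3]) :
    S N (fun t => f (t+1) - f t) = (f (3^N) - f 0) / 3^N := by
  unfold S; rw [Finset.sum_range_sub]

lemma S_add (N : ℕ) (f g : ℕ → ℚ_[3]) : S N (fun t => f t + g t) = S N f + S N g := by
  unfold S; rw [sum_add_distrib, add_div]
lemma S_sub (N : ℕ) (f g : ℕ → ℚ_[3]) : S N (fun t => f t - g t) = S N f - S N g := by
  unfold S; rw [sum_sub_distrib, sub_div]
lemma S_mul (N : ℕ) (c : ℚ_[3]) (f : ℕ → ℚ_[3]) : S N (fun t => c * f t) = c * S N f := by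
  unfold S; rw [← mul_sum, mul_div_assoc]

lemma norm_sum_le' {ι : Type*} (s : Finset ι) (f : ι → ℚ_[3]) (C : ℝ) (hC : 0 ≤ C)
    (h : ∀ i ∈ s, ‖f i‖ ≤ C) : ‖∑ i ∈ s, f i‖ ≤ C :=
  IsUltrametricDist.norm_sum_le_of_forall_le_of_nonneg hC h

lemma norm_add_le' (a b : ℚ_[3]) (C : ℝ) (ha : ‖a‖ ≤ C) (hb : ‖b‖ ≤ C) : ‖a + b‖ ≤ C :=
  (Padic.nonarchimedean a b).trans (max_le ha hb)

lemma norm_sub_le' (a b : ℚ_[3]) (C : ℝ) (ha : ‖a‖ ≤ C) (hb : ‖b‖ ≤ C) : ‖a - b‖ ≤ C := by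
  rw [sub_eq_add_neg]; exact norm_add_le' _ _ _ ha (by rwa [norm_neg])

lemma S_bound (f : ℕ → ℚ_[3]) (L : ℝ) (h0 : ‖f 0‖ ≤ 3 * L) (hL0 : 0 ≤ L)
    (hL : ∀ s m : ℕ, ‖f (s+m) - f s‖ ≤ L * ‖(m:ℚ_[3])‖) (N : ℕ) : ‖S N f‖ ≤ 3 * L := by
  induction N with
  | zero => simpa [S] using h0
  | succ N ih =>
    have e : S (N+1) f = S N f + (∑ t ∈ range (3^N), ((f (t + 3^N) - f t) + (f (t + 2*3^N) - f t))) / 3^(N+1) := by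
      unfold S
      have : ∑ t ∈ range (3^(N+1)), f t = ∑ t ∈ range (3^N), f t + ∑ t ∈ range (3^N), f (t+3^N)
          + ∑ t ∈ range (3^N), f (t+2*3^N) := by
        rw [show 3^(N+1) = 3^N + 3^N + 3^N by ring, sum_range_add, sum_range_add]
        congr 1
        · congr 1; apply sum_congr rfl; intro t _; rw [add_comm]
        · apply sum_congr rfl; intro t _; congr 1; ring
      rw [this, sum_add_distrib, sum_sub_distrib, sum_sub_distrib]
      field_simp
      rw [pow_succ]; ring
    rw [e]
    apply norm_add_le' _ _ _ ih
    rw [norm_div, norm_pow, norm3]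
    have h3 : (0:ℝ) < (3⁻¹:ℝ)^(N+1) := by positivity
    rw [div_le_iff₀ h3]
    have e3 : 3 * L * (3⁻¹:ℝ)^(N+1) = L * (3⁻¹)^N := by rw [pow_succ]; ring
    rw [e3]
    apply norm_sum_le' _ _ _ (by positivity)
    intro t _
    have n1 : ‖((3^N : ℕ):ℚ_[3])‖ = (3⁻¹:ℝ)^N := by push_cast; rw [norm_pow, norm3]
    apply norm_add_le'
    · have := hL t (3^N); rwa [n1] at this
    · have := hL t (2*3^N)
      refine this.trans ?_
      rw [Nat.cast_mul, norm_mul, n1]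
      have := norm_nat_le 2
      have h4 : (0:ℝ) < (3⁻¹:ℝ)^N := by positivity
      gcongr
      exact mul_le_of_le_one_left h4.le this

def Lip (L : ℝ) (f : ℕ → ℚ_[3]) : Prop :=
  (∀ s, ‖f s‖ ≤ 1) ∧ ∀ s m : ℕ, ‖f (s+m) - f s‖ ≤ L * ‖(m:ℚ_[3])‖

lemma Lip.mul {L : ℝ} {f g : ℕ → ℚ_[3]} (hf : Lip L f) (hg : Lip L g) : Lip L (fun t => f t * g t) := by
  refine ⟨fun s => ?_, fun s m => ?_⟩
  · rw [norm_mul]; exact mul_le_one₀ (hf.1 s) (norm_nonneg _) (hg.1 s)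
  · have e : f (s+m) * g (s+m) - f s * g s = (f (s+m) - f s) * g (s+m) + f s * (g (s+m) - g s) := by ring
    rw [e]
    have h1 := hf.2 s m
    have h2 := hg.2 s m
    apply norm_add_le'
    · rw [norm_mul]
      exact (mul_le_of_le_one_right (norm_nonneg _) (hg.1 _)).trans h1
    · rw [norm_mul]
      exact (mul_le_of_le_one_left (norm_nonneg _) (hf.1 _)).trans h2

lemma Lip.prod {L : ℝ} (hL : 0 ≤ L) {f : ℕ → ℕ → ℚ_[3]} (hf : ∀ i, Lip L (f i)) (n : ℕ) :
    Lip L (fun t => ∏ i ∈ range n, f i t) := by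
  induction n with
  | zero => exact ⟨fun s => by simp, fun s m => by simp; positivity⟩
  | succ n ih =>
    simp_rw [prod_range_succ]
    exact ih.mul (hf n)

lemma norm_u (m : ℕ) : ‖(3*(m:ℚ_[3])+1)‖ = 1 := by
  have := norm_nat_one (m := 3*m+1) (by omega)
  exact_mod_cast this

lemma u_ne (m : ℕ) : (3*(m:ℚ_[3])+1) ≠ 0 := by
  rw [← norm_ne_zero_iff, norm_u]; norm_num

lemma Lip_inv {L : ℝ} (hL : 1 ≤ L) (i : ℕ) : Lip L (fun t => (3*((t:ℚ_[3])+i)+1)⁻¹) := by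
  have hu : ∀ s : ℕ, ‖3*((s:ℚ_[3])+i)+1‖ = 1 := fun s => by
    have := norm_u (s+i); push_cast at this; exact this
  have hu0 : ∀ s : ℕ, (3*((s:ℚ_[3])+i)+1) ≠ 0 := fun s => by
    have := u_ne (s+i); push_cast at this; exact this
  refine ⟨fun s => ?_, fun s m => ?_⟩
  · rw [norm_inv, hu]; norm_num
  · rw [inv_sub_inv (hu0 _) (hu0 _), norm_div, norm_mul, hu, hu]
    have : (3*((s:ℚ_[3])+i)+1) - (3*(((s+m:ℕ):ℚ_[3])+i)+1) = -(3 * m) := by push_cast; ring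
    rw [this, norm_neg, norm_mul, norm3]
    have := norm_nonneg (m:ℚ_[3])
    nlinarith

lemma norm_choose (m j : ℕ) : ‖((m.choose (j+1) : ℕ):ℚ_[3])‖ ≤ (j+1) * ‖(m:ℚ_[3])‖ := by
  rcases m with _ | m
  · simp
  have h := Nat.add_one_mul_choose_eq m j
  have h' : ((m+1:ℕ):ℚ_[3]) * (m.choose j : ℕ) = ((m+1).choose (j+1) : ℕ) * ((j+1 : ℕ):ℚ_[3]) := by
    exact_mod_cast congrArg (Nat.cast : ℕ → ℚ_[3]) h
  have hn := congrArg norm h'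
  rw [norm_mul, norm_mul] at hn
  have h1 := one_le_nat_mul_norm (m := j+1) (by omega)
  have h2 := norm_nat_le (m.choose j)
  have h3 := norm_nonneg ((m+1:ℕ):ℚ_[3])
  have h4 := norm_nonneg (((m+1).choose (j+1) : ℕ):ℚ_[3])
  calc ‖(((m+1).choose (j+1) : ℕ):ℚ_[3])‖ ≤ ‖(((m+1).choose (j+1) : ℕ):ℚ_[3])‖ * (((j+1:ℕ):ℝ) * ‖((j+1:ℕ):ℚ_[3])‖) := le_mul_of_one_le_right h4 h1
    _ = ((j+1:ℕ):ℝ) * (‖((m+1:ℕ):ℚ_[3])‖ * ‖((m.choose j : ℕ):ℚ_[3])‖) := by rw [hn]; ring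
    _ ≤ ((j+1:ℕ):ℝ) * (‖((m+1:ℕ):ℚ_[3])‖ * 1) := by gcongr
    _ = _ := by push_cast; ring

lemma Lip_choose (n : ℕ) : Lip (n+1) (fun t => (((t+n).choose n : ℕ) : ℚ_[3])) := by
  refine ⟨fun s => norm_nat_le _, fun s m => ?_⟩
  have h := Nat.add_choose_eq m (s+n) n
  rw [Finset.Nat.sum_antidiagonal_eq_sum_range_succ_mk, sum_range_succ'] at h
  simp only [Nat.choose_zero_right, one_mul, Nat.sub_zero] at h
  have e : (((s+m+n).choose n : ℕ) : ℚ_[3]) - ((s+n).choose n : ℕ) = 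
      ∑ j ∈ range n, ((m.choose (j+1) : ℕ):ℚ_[3]) * ((s+n).choose (n-(j+1)) : ℕ) := by
    rw [show s+m+n = m+(s+n) by ring, h]; push_cast; ring
  show ‖(((s+m+n).choose n : ℕ) : ℚ_[3]) - ((s+n).choose n : ℕ)‖ ≤ _
  rw [e]
  apply norm_sum_le' _ _ _ (by positivity)
  intro j hj
  rw [mem_range] at hj
  rw [norm_mul]
  have h1 := norm_choose m j
  have h2 := norm_nat_le ((s+n).choose (n-(j+1)))
  have h3 : (j:ℝ) + 1 ≤ n + 1 := by exact_mod_cast (by omega : j + 1 ≤ n + 1)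
  calc _ ≤ ‖((m.choose (j+1) : ℕ):ℚ_[3])‖ := mul_le_of_le_one_right (norm_nonneg _) h2
    _ ≤ _ := h1
    _ ≤ _ := by gcongr

noncomputable def R (n : ℕ) (t : ℕ) : ℚ_[3] :=
  ((∏ i ∈ range n, ((t:ℚ_[3])+1+i)) / (∏ i ∈ range (n+1), ((t:ℚ_[3])+1/3+i)))^2

lemma x_ne (t i : ℕ) : ((t:ℚ_[3])+1/3+i) ≠ 0 := by
  have := u_ne (t+i)
  intro h
  apply this
  push_cast
  linear_combination 3 * h

lemma R_eq (n t : ℕ) : R n t = (n.factorial:ℚ_[3])^2 * 9^(n+1) *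
    ((((t+n).choose n : ℕ) : ℚ_[3]) * ∏ i ∈ range (n+1), (3*((t:ℚ_[3])+i)+1)⁻¹)^2 := by
  have h1 : ∏ i ∈ range n, ((t:ℚ_[3])+1+i) = n.factorial * ((t+n).choose n : ℕ) := by
    have := Nat.ascFactorial_eq_factorial_mul_choose (t) n
    rw [Nat.ascFactorial_eq_prod_range] at this
    exact_mod_cast congrArg (Nat.cast : ℕ → ℚ_[3]) this
  have h2 : (∏ i ∈ range (n+1), ((t:ℚ_[3])+1/3+i))⁻¹ = 3^(n+1) * ∏ i ∈ range (n+1), (3*((t:ℚ_[3])+i)+1)⁻¹ := by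
    rw [← prod_inv_distrib, ← card_range (n+1), ← prod_const, card_range, ← prod_mul_distrib]
    apply prod_congr rfl
    intro i _
    rw [show (t:ℚ_[3])+1/3+i = (3*((t:ℚ_[3])+i)+1)/3 by ring, inv_div, div_eq_mul_inv]
  unfold R
  rw [div_eq_mul_inv, h1, h2, show (9:ℚ_[3]) = 3^2 by norm_num, ← pow_mul, mul_comm 2, pow_mul]
  ring

lemma R_bound (n N : ℕ) : ‖S N (R n)‖ ≤ ‖(n.factorial:ℚ_[3])‖^2 * (9⁻¹)^(n+1) * (3*(n+1)) := by
  have hL : (1:ℝ) ≤ n + 1 := by have : (0:ℝ) ≤ n := by positivity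
                                linarith
  have h1 := (Lip_choose n).mul (Lip.prod (by positivity) (fun i => Lip_inv hL i) (n+1))
  have h2 := h1.mul h1
  have h3 := S_bound _ _ ((h2.1 0).trans (by linarith)) (by positivity) h2.2 N
  have e : R n = fun t => ((n.factorial:ℚ_[3])^2 * 9^(n+1)) * 
    (((((t+n).choose n : ℕ) : ℚ_[3]) * ∏ i ∈ range (n+1), (3*((t:ℚ_[3])+i)+1)⁻¹) * 
    ((((t+n).choose n : ℕ) : ℚ_[3]) * ∏ i ∈ range (n+1), (3*((t:ℚ_[3])+i)+1)⁻¹)) := by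
    funext t; rw [R_eq]; ring
  rw [e, S_mul, norm_mul, norm_mul, norm_pow, norm_pow]
  have h9 : ‖(9:ℚ_[3])‖ = 9⁻¹ := by
    rw [show (9:ℚ_[3]) = 3^2 by norm_num, norm_pow, norm3]; norm_num
  rw [h9]
  gcongr

lemma R_succ (n t : ℕ) : R (n+1) t = R n t * ((t:ℚ_[3])+1+n)^2 / ((t:ℚ_[3])+1/3+(n+1))^2 := by
  unfold R
  rw [prod_range_succ _ n, prod_range_succ _ (n+1)]
  push_cast
  rw [div_pow, div_pow, mul_pow, mul_pow, div_mul_eq_mul_div, div_div]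

lemma R_shift (n t : ℕ) : R n (t+1) = R n t * ((t:ℚ_[3])+1+n)^2 * ((t:ℚ_[3])+1/3)^2 
     / (((t:ℚ_[3])+1)^2 * ((t:ℚ_[3])+1/3+(n+1))^2) := by
  have ht : ((t:ℚ_[3])+1) ≠ 0 := by exact_mod_cast Nat.succ_ne_zero t
  induction n with
  | zero =>
    have a := x_ne t 0
    have b := x_ne t 1
    have c := x_ne (t+1) 0
    simp only [Nat.cast_zero, Nat.cast_one, add_zero] at a b c
    simp only [R, range_zero, prod_empty, zero_add, prod_range_one, Nat.cast_zero, add_zero]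
    push_cast at *
    rw [show (t:ℚ_[3])+1+1/3 = t+1/3+1 by ring]
    generalize hx : (t:ℚ_[3])+1/3 = x at *
    field_simp
  | succ n ih =>
    rw [R_succ, ih, R_succ]
    have b := x_ne t (n+1)
    have c := x_ne t (n+2)
    push_cast at *
    rw [show (t:ℚ_[3])+1+1/3+(n+1) = t+1/3+(n+1+1) by ring]
    rw [show (t:ℚ_[3])+1/3+(n+2) = t+1/3+(n+1+1) by ring] at c
    rw [show (t:ℚ_[3])+1+1+n = t+1+(n+1) by ring]
    generalize (t:ℚ_[3])+1/3 = x at *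
    field_simp

noncomputable def G (n t : ℕ) : ℚ_[3] :=
  (t:ℚ_[3])^2 * ((t:ℚ_[3])^2/3 - 2*t/9 - (n+1)*(n+2)/3) * R n t / ((t:ℚ_[3])+1/3+(n+1))^2

lemma R_rec (n t : ℕ) :
    ((n:ℚ_[3])+2)^3 * R (n+2) t - (2*n+3)*((n+1)^2+(n+1)+5/9) * R (n+1) t + ((n:ℚ_[3])+1)^3 * R n t
     = G n (t+1) - G n t := by
  unfold G
  rw [R_shift, R_succ (n+1), R_succ]
  have ht : ((t:ℚ_[3])+1) ≠ 0 := by exact_mod_cast Nat.succ_ne_zero t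
  have b := x_ne t (n+1)
  have c := x_ne t (n+2)
  push_cast at *
  rw [show (t:ℚ_[3])+1+1/3+(n+1) = t+1/3+(n+1+1) by ring]
  rw [show (t:ℚ_[3])+1/3+(n+2) = t+1/3+(n+1+1) by ring] at c
  generalize hx : (t:ℚ_[3])+1/3 = x at *
  have hx' : x = (t:ℚ_[3]) + 1/3 := hx.symm
  generalize (t:ℚ_[3]) = s at *
  have key : ∀ A : ℚ_[3], (s+1)^2 * A * (R n t * (s+1+n)^2 * x^2 / ((s+1)^2 * (x+(n+1))^2)) / (x+(n+1+1))^2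
      = A * R n t * (s+1+n)^2 * x^2 / ((x+(n+1))^2 * (x+(n+1+1))^2) := by
    intro A; field_simp
  rw [key]
  clear key ht hx
  have hs : s = x - 1/3 := by rw [hx']; ring
  clear hx'
  subst hs
  field_simp
  ring
end Z3

namespace Z3
open Finset Filter Topology

lemma R_norm (n t : ℕ) : ‖R n t‖ ≤ 1 := by
  have hL : (1:ℝ) ≤ n + 1 := by
    have : (0:ℝ) ≤ n := by positivity
    linarith
  have h1 := (Lip_choose n).mul (Lip.prod (by positivity) (fun i => Lip_inv hL i) (n+1))
  have h2 := h1.1 t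
  rw [R_eq, norm_mul, norm_mul, norm_pow, norm_pow, norm_pow]
  have h9 : ‖(9:ℚ_[3])‖ ≤ 1 := by exact_mod_cast norm_nat_le 9
  have h3 := norm_nat_le n.factorial
  refine mul_le_one₀ (mul_le_one₀ (pow_le_one₀ (norm_nonneg _) h3) (by positivity) (pow_le_one₀ (norm_nonneg _) h9)) (by positivity) (pow_le_one₀ (norm_nonneg _) h2)

lemma x_norm (t i : ℕ) : ‖((t:ℚ_[3])+1/3+i)‖ = 3 := by
  rw [show (t:ℚ_[3])+1/3+i = (3*((t+i:ℕ):ℚ_[3])+1)/3 by push_cast; ring, norm_div, norm_u, norm3]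
  norm_num

lemma G_norm (n t : ℕ) : ‖G n t‖ ≤ ‖(t:ℚ_[3])‖^2 := by
  unfold G
  have hx := x_norm t (n+1)
  push_cast at hx
  rw [norm_div, norm_mul, norm_mul, norm_pow, norm_pow, hx]
  have hN : ‖(t:ℚ_[3])^2/3 - 2*t/9 - (n+1)*(n+2)/3‖ ≤ 9 := by
    have e : (t:ℚ_[3])^2/3 - 2*t/9 - (n+1)*(n+2)/3 = (((3*t^2:ℕ):ℚ_[3]) - ((2*t:ℕ):ℚ_[3]) - ((3*(n+1)*(n+2):ℕ):ℚ_[3]))/9 := by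
      push_cast; ring
    have h9 : ‖(9:ℚ_[3])‖ = 9⁻¹ := by
      rw [show (9:ℚ_[3]) = 3^2 by norm_num, norm_pow, norm3]; norm_num
    rw [e, norm_div, h9]
    have := norm_sub_le' _ _ 1 (norm_sub_le' _ _ 1 (norm_nat_le (3*t^2)) (norm_nat_le (2*t))) (norm_nat_le (3*(n+1)*(n+2)))
    rw [div_inv_eq_mul]
    linarith
  have hR := R_norm n t
  rw [div_le_iff₀ (by norm_num)]
  have : ‖(t:ℚ_[3])^2/3 - 2*t/9 - (n+1)*(n+2)/3‖ * ‖R n t‖ ≤ 9 * 1 := by gcongr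
  calc _ = ‖(t:ℚ_[3])‖^2 * (‖(t:ℚ_[3])^2/3 - 2*t/9 - (n+1)*(n+2)/3‖ * ‖R n t‖) := by ring
    _ ≤ ‖(t:ℚ_[3])‖^2 * (9*1) := by gcongr
    _ = _ := by ring

lemma tendsto3 : Tendsto (fun N : ℕ => (3:ℚ_[3])^N) atTop (𝓝 0) := by
  apply tendsto_pow_atTop_nhds_zero_of_norm_lt_one
  rw [norm3]; norm_num

lemma G_lim (n : ℕ) : Tendsto (fun N => S N (fun t => G n (t+1) - G n t)) atTop (𝓝 0) := by
  have h0 : G n 0 = 0 := by simp [G]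
  apply squeeze_zero_norm (a := fun N => ‖(3:ℚ_[3])^N‖)
  · intro N
    rw [S_shift, h0, sub_zero, norm_div]
    have := G_norm n (3^N)
    push_cast at this
    have h3 : 0 < ‖(3:ℚ_[3])^N‖ := by rw [norm_pos_iff]; exact pow_ne_zero _ (by norm_num)
    rw [div_le_iff₀ h3, ← pow_two]; exact this
  · simpa using tendsto3.norm

noncomputable def Hh (t : ℕ) : ℚ_[3] := 1/(3*(t:ℚ_[3])+1)^2 - (4/3)/(3*(t:ℚ_[3])+1)

lemma R1_eq (t : ℕ) : R 1 t = (5/9) * R 0 t + (Hh (t+1) - Hh t) := by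
  have a := u_ne t
  have b := u_ne (t+1)
  simp only [R, Hh, range_zero, prod_empty, zero_add, prod_range_succ]
  push_cast at *
  rw [show (t:ℚ_[3])+1/3+0 = (3*(t:ℚ_[3])+1)/3 by ring, show (t:ℚ_[3])+1/3+1 = (3*((t:ℚ_[3])+1)+1)/3 by ring]
  rw [add_zero, one_mul]
  generalize hx : 3*(t:ℚ_[3])+1 = x at *
  generalize hy : 3*((t:ℚ_[3])+1)+1 = y at *
  have h1 : (t:ℚ_[3])+1 = (x+2)/3 := by rw [← hx]; ring
  have h2 : y = x+3 := by rw [← hx, ← hy]; ring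
  rw [h1]
  clear h1 hx hy
  subst h2
  field_simp
  ring

lemma H_lim : Tendsto (fun N => S N (fun t => Hh (t+1) - Hh t)) atTop (𝓝 (-2)) := by
  have e : ∀ N, S N (fun t => Hh (t+1) - Hh t) = 
     (-9*(3:ℚ_[3])^N-6)/(3*(3:ℚ_[3])^N+1)^2 + 4/(3*(3:ℚ_[3])^N+1) := by
    intro N
    have a := u_ne (3^N)
    rw [S_shift]
    unfold Hh
    have h3 : (3:ℚ_[3])^N ≠ 0 := pow_ne_zero _ (by norm_num)
    push_cast at *
    generalize (3:ℚ_[3])^N = s at *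
    rw [mul_zero, zero_add]
    field_simp
    ring
  simp_rw [e]
  have hd : Tendsto (fun N : ℕ => 3*(3:ℚ_[3])^N+1) atTop (𝓝 1) := by
    simpa using (tendsto3.const_mul 3).add_const 1
  have := (((tendsto3.const_mul (-9)).sub_const 6).div (hd.pow 2) (by norm_num)).add
    ((tendsto_const_nhds (x := (4:ℚ_[3]))).div hd (by norm_num))
  have e2 : (-9*0-6)/1^2+4/1 = (-2:ℚ_[3]) := by norm_num
  rw [e2] at this
  exact this

noncomputable def rr (Θ : ℚ_[3]) (n : ℕ) : ℚ_[3] := (Qs n : ℚ_[3]) * Θ - (Ps n : ℚ_[3])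

lemma rr_rec (Θ : ℚ_[3]) (n : ℕ) : ((n:ℚ_[3])+2)^3 * rr Θ (n+2) - (2*n+3)*((n+1)^2+(n+1)+5/9) * rr Θ (n+1) 
    + ((n:ℚ_[3])+1)^3 * rr Θ n = 0 := by
  have h1 := congrArg (Rat.cast : ℚ → ℚ_[3]) (Q_rec n)
  have h2 := congrArg (Rat.cast : ℚ → ℚ_[3]) (P_rec n)
  push_cast at h1 h2
  unfold rr
  linear_combination Θ * h1 - h2

lemma S_lim (Θ : ℚ_[3]) (h : Tendsto (fun N => S N (R 0)) atTop (𝓝 Θ)) (n : ℕ) :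
    Tendsto (fun N => S N (R n)) atTop (𝓝 (rr Θ n)) ∧ Tendsto (fun N => S N (R (n+1))) atTop (𝓝 (rr Θ (n+1))) := by
  induction n with
  | zero =>
    constructor
    · simpa [rr, Q0, P0] using h
    · have e : ∀ N, S N (R (0+1)) = (5/9) * S N (R 0) + S N (fun t => Hh (t+1) - Hh t) := by
        intro N
        rw [← S_mul, ← S_add]
        congr 1; funext t; rw [zero_add, R1_eq]
      simp_rw [e]
      have := (h.const_mul (5/9)).add H_lim
      convert this using 2
      simp only [rr, zero_add, Q1, P1]; push_cast; ring
  | succ n ih =>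
    refine ⟨ih.2, ?_⟩
    have hn : ((n:ℚ_[3])+2)^3 ≠ 0 := by
      apply pow_ne_zero; exact_mod_cast (by omega : n + 2 ≠ 0)
    have e : ∀ N, S N (R (n+1+1)) = ((2*n+3)*((n+1)^2+(n+1)+5/9) * S N (R (n+1)) - ((n:ℚ_[3])+1)^3 * S N (R n)
        + S N (fun t => G n (t+1) - G n t)) / ((n:ℚ_[3])+2)^3 := by
      intro N
      rw [eq_div_iff hn, ← S_mul, ← S_mul, ← S_sub, ← S_add, mul_comm, ← S_mul]
      congr 1; funext t
      have := R_rec n t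
      linear_combination this
    simp_rw [e]
    have := (((ih.2.const_mul ((2*(n:ℚ_[3])+3)*(((n:ℚ_[3])+1)^2+((n:ℚ_[3])+1)+5/9))).sub (ih.1.const_mul (((n:ℚ_[3])+1)^3))).add (G_lim n)).div_const (((n:ℚ_[3])+2)^3)
    convert this using 2
    rw [eq_div_iff hn]
    linear_combination rr_rec Θ n

lemma rr_norm (Θ : ℚ_[3]) (h : Tendsto (fun N => S N (R 0)) atTop (𝓝 Θ)) (n : ℕ) :
    ‖rr Θ n‖ ≤ ‖(n.factorial:ℚ_[3])‖^2 * (9⁻¹)^(n+1) * (3*(n+1)) :=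
  le_of_tendsto (S_lim Θ h n).1.norm (Eventually.of_forall fun N => R_bound n N)

lemma digit_bound (n : ℕ) : (3:ℝ)^(Nat.digits 3 n).sum ≤ 9*(n+1)^2 := by
  have h1 : (Nat.digits 3 n).sum ≤ 2 * (Nat.digits 3 n).length := by
    rw [mul_comm, ← smul_eq_mul]
    apply List.sum_le_card_nsmul
    intro d hd
    have := Nat.digits_lt_base (by norm_num) hd
    omega
  have h2 : 3^(Nat.digits 3 n).length ≤ 3 * (n+1) := by
    rcases Nat.eq_zero_or_pos n with rfl | hn
    · simp
    · have := Nat.base_pow_length_digits_le 3 n (by norm_num) hn.ne'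
      omega
  have h3 : 3^(Nat.digits 3 n).sum ≤ (3*(n+1))^2 := by
    calc 3^(Nat.digits 3 n).sum ≤ 3^(2 * (Nat.digits 3 n).length) := Nat.pow_le_pow_right (by norm_num) h1
      _ = (3^(Nat.digits 3 n).length)^2 := by rw [mul_comm, pow_mul]
      _ ≤ _ := Nat.pow_le_pow_left h2 2
  calc (3:ℝ)^(Nat.digits 3 n).sum ≤ ((3*(n+1):ℕ):ℝ)^2 := by exact_mod_cast h3
    _ = _ := by push_cast; ring

lemma fact_norm (n : ℕ) : ‖(n.factorial:ℚ_[3])‖^2 ≤ 9*(n+1)^2 * (3⁻¹)^n := by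
  have hL := sub_one_mul_padicValNat_factorial (p := 3) n
  have hle := Nat.digit_sum_le 3 n
  have hv : ‖(n.factorial:ℚ_[3])‖ = (3⁻¹:ℝ)^(padicValNat 3 n.factorial) := by
    rw [← Rat.cast_natCast, Padic.eq_padicNorm, padicNorm.eq_zpow_of_nonzero (by exact_mod_cast n.factorial_ne_zero)]
    have e0 : padicValRat 3 (n.factorial:ℚ) = (padicValNat 3 n.factorial : ℤ) := padicValRat.of_nat
    rw [e0, zpow_neg, zpow_natCast]; push_cast; rw [inv_pow]
  rw [hv, ← pow_mul]
  have hs : (3⁻¹:ℝ)^(padicValNat 3 n.factorial * 2) = (3⁻¹)^n * 3^(Nat.digits 3 n).sum := by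
    have e : n = padicValNat 3 n.factorial * 2 + (Nat.digits 3 n).sum := by omega
    have : (3⁻¹:ℝ)^n = (3⁻¹)^(padicValNat 3 n.factorial * 2) * (3⁻¹)^(Nat.digits 3 n).sum := by
      rw [← pow_add]; congr 1
    rw [this, mul_assoc, ← mul_pow]; norm_num
  rw [hs, mul_comm]
  gcongr
  exact digit_bound n

lemma rr_small (Θ : ℚ_[3]) (h : Tendsto (fun N => S N (R 0)) atTop (𝓝 Θ)) (n : ℕ) :
    ‖rr Θ n‖ ≤ 3*(n+1)^3 * (27⁻¹)^n := by
  refine (rr_norm Θ h n).trans ?_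
  calc _ ≤ (9*((n:ℝ)+1)^2 * (3⁻¹)^n) * (9⁻¹)^(n+1) * (3*(n+1)) := by gcongr; exact fact_norm n
    _ = 3*(n+1)^3 * ((3⁻¹)^n * (9⁻¹:ℝ)^n) := by rw [pow_succ]; ring
    _ = _ := by rw [← mul_pow]; norm_num
end Z3

namespace Z3
open Finset Filter Topology

lemma S_pow_lim (m : ℕ) : Tendsto (fun N => S N (fun t => (t:ℚ_[3])^m)) atTop (𝓝 ((bernoulli m : ℚ) : ℚ_[3])) := by
  have e : ∀ N, S N (fun t => (t:ℚ_[3])^m) = 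
      ∑ i ∈ range (m+1), (((bernoulli i : ℚ):ℚ_[3]) * ((m+1).choose i : ℕ) / (m+1)) * ((3:ℚ_[3])^N)^(m-i) := by
    intro N
    have h := congrArg (Rat.cast : ℚ → ℚ_[3]) (sum_range_pow (3^N) m)
    push_cast at h
    unfold S
    rw [h, sum_div]
    apply sum_congr rfl
    intro i hi
    rw [mem_range] at hi
    have h3 : (3:ℚ_[3])^N ≠ 0 := pow_ne_zero _ (by norm_num)
    rw [show m+1-i = (m-i)+1 by omega, pow_succ]
    field_simp
  simp_rw [e]
  have h1 : Tendsto (fun N : ℕ => ∑ i ∈ range (m+1), (((bernoulli i : ℚ):ℚ_[3]) * ((m+1).choose i : ℕ) / (m+1)) * ((3:ℚ_[3])^N)^(m-i))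
     atTop (𝓝 (∑ i ∈ range (m+1), (((bernoulli i : ℚ):ℚ_[3]) * ((m+1).choose i : ℕ) / (m+1)) * (0:ℚ_[3])^(m-i))) := by
    apply tendsto_finsetSum
    intro i _
    exact (tendsto3.pow _).const_mul _
  convert h1 using 2
  rw [sum_range_succ, sum_eq_zero]
  · have : ((m:ℚ_[3])+1) ≠ 0 := by exact_mod_cast Nat.succ_ne_zero m
    simp only [Nat.sub_self, pow_zero, Nat.choose_succ_self_right]
    push_cast
    field_simp
    ring
  · intro i hi
    rw [mem_range] at hi
    rw [zero_pow (by omega), mul_zero]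

lemma sum_three (f : ℕ → ℚ_[3]) (M : ℕ) : ∑ t ∈ range (3*M), f t = ∑ t ∈ range M, (f (3*t) + f (3*t+1) + f (3*t+2)) := by
  induction M with
  | zero => simp
  | succ M ih =>
    rw [show 3*(M+1) = 3*M+1+1+1 by ring, sum_range_succ, sum_range_succ, sum_range_succ, ih, sum_range_succ]
    ring

lemma Lip_u : Lip 1 (fun t => 3*(t:ℚ_[3])+1) := by
  refine ⟨fun s => (norm_u s).le, fun s m => ?_⟩
  have : (3*((s+m:ℕ):ℚ_[3])+1) - (3*(s:ℚ_[3])+1) = ((3:ℕ):ℚ_[3]) * m := by push_cast; ring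
  rw [this, norm_mul]
  gcongr
  exact norm_nat_le 3

lemma Lip_upow (k : ℕ) : Lip 1 (fun t => (3*(t:ℚ_[3])+1)^k) := by
  have := Lip.prod (L := 1) (by norm_num) (f := fun _ t => 3*(t:ℚ_[3])+1) (fun _ => Lip_u) k
  simpa using this

lemma VV (m : ℕ) (hm : Even m) (N : ℕ) : 
    ‖S N (fun t => (3*(t:ℚ_[3])+1)^m) - S N (fun t => (3*(t:ℚ_[3])+2)^m)‖ ≤ 3 * ‖(3:ℚ_[3])^N‖ := by
  have h3 : (3:ℚ_[3])^N ≠ 0 := pow_ne_zero _ (by norm_num)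
  have hk : ∀ t : ℕ, ∃ k : ℤ, ((3*(t:ℤ)+1) + (-3^(N+1)))^m = (3*(t:ℤ)+1)^m + m*(3*(t:ℤ)+1)^(m-1)*(-3^(N+1)) + k*(-3^(N+1))^2 := by
    intro t
    exact ⟨_, (Polynomial.powAddExpansion _ _ m).2⟩
  choose k hk using hk
  have hrefl : S N (fun t => (3*(t:ℚ_[3])+2)^m) = S N (fun t => ((3*(t:ℚ_[3])+1) + (-3^(N+1)))^m) := by
    unfold S
    congr 1
    rw [← sum_range_reflect]
    apply sum_congr rfl
    intro t ht
    rw [mem_range] at ht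
    have : ((3^N - 1 - t : ℕ):ℚ_[3]) = 3^N - 1 - t := by
      rw [Nat.sub_sub, Nat.cast_sub (by omega)]; push_cast; ring
    rw [this, ← hm.neg_pow]
    congr 1; ring
  have e : S N (fun t => (3*(t:ℚ_[3])+1)^m) - S N (fun t => (3*(t:ℚ_[3])+2)^m) = 
      3^(N+1) * ((m:ℚ_[3]) * S N (fun t => (3*(t:ℚ_[3])+1)^(m-1))) - 3^(N+2) * ∑ t ∈ range (3^N), (k t : ℚ_[3]) := by
    rw [hrefl, ← S_sub, ← S_mul, ← S_mul]
    have : 3^(N+2) * ∑ t ∈ range (3^N), (k t : ℚ_[3]) = S N (fun t => (3^(N+1))^2 * (k t:ℚ_[3])) := by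
      unfold S
      rw [← mul_sum]
      field_simp
      ring
    rw [this, ← S_sub]
    congr 1; funext t
    have := congrArg (Int.cast : ℤ → ℚ_[3]) (hk t)
    push_cast at this
    rw [this]; ring
  rw [e]
  have hs := S_bound _ 1 (((Lip_upow (m-1)).1 0).trans (by norm_num)) (by norm_num) (Lip_upow (m-1)).2 N
  have hm1 := norm_nat_le m
  have h1 : ‖(3:ℚ_[3])^(N+1)‖ ≤ ‖(3:ℚ_[3])^N‖ := by
    rw [pow_succ, norm_mul, norm3]
    exact mul_le_of_le_one_right (norm_nonneg _) (by norm_num)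
  have h2 : ‖(3:ℚ_[3])^(N+2)‖ ≤ ‖(3:ℚ_[3])^N‖ := by
    rw [pow_add, norm_mul, norm_pow _ 2, norm3]
    exact mul_le_of_le_one_right (norm_nonneg _) (by norm_num)
  apply norm_sub_le'
  · rw [norm_mul, norm_mul]
    calc _ ≤ ‖(3:ℚ_[3])^N‖ * (1 * (3*1)) := by gcongr
      _ = _ := by ring
  · rw [norm_mul]
    have : ‖∑ t ∈ range (3^N), (k t : ℚ_[3])‖ ≤ 1 := norm_sum_le' _ _ _ (by norm_num) (fun t _ => Padic.norm_int_le_one _)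
    calc _ ≤ ‖(3:ℚ_[3])^N‖ * 1 := by gcongr
      _ ≤ _ := by linarith [norm_nonneg ((3:ℚ_[3])^N)]

lemma V_lim (m : ℕ) (hm : Even m) : Tendsto (fun N => S N (fun t => (3*(t:ℚ_[3])+1)^m)) atTop 
    (𝓝 ((3 * (bernoulli m : ℚ) - 3^m * (bernoulli m : ℚ)) / 2)) := by
  have e : ∀ N, S N (fun t => (3*(t:ℚ_[3])+1)^m) = (3 * S (N+1) (fun t => (t:ℚ_[3])^m) - 3^m * S N (fun t => (t:ℚ_[3])^m)
     + (S N (fun t => (3*(t:ℚ_[3])+1)^m) - S N (fun t => (3*(t:ℚ_[3])+2)^m))) / 2 := by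
    intro N
    have h3 : (3:ℚ_[3])^N ≠ 0 := pow_ne_zero _ (by norm_num)
    have : 3 * S (N+1) (fun t => (t:ℚ_[3])^m) = 3^m * S N (fun t => (t:ℚ_[3])^m) + S N (fun t => (3*(t:ℚ_[3])+1)^m) + S N (fun t => (3*(t:ℚ_[3])+2)^m) := by
      rw [← S_mul, ← S_mul, ← S_add, ← S_add]
      unfold S
      rw [show 3^(N+1) = 3 * 3^N by ring, sum_three, pow_succ (3:ℚ_[3]) N, div_eq_div_iff (mul_ne_zero h3 (by norm_num)) h3]
      rw [mul_comm ((3:ℚ_[3])^N) 3, ← mul_assoc]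
      congr 1
      rw [sum_mul]
      apply sum_congr rfl
      intro t _
      push_cast
      rw [mul_pow]
      ring
    rw [this]; ring
  have hz : Tendsto (fun N => S N (fun t => (3*(t:ℚ_[3])+1)^m) - S N (fun t => (3*(t:ℚ_[3])+2)^m)) atTop (𝓝 0) := by
    apply squeeze_zero_norm (VV m hm)
    simpa using tendsto3.norm.const_mul 3
  have h1 := (S_pow_lim m).comp (tendsto_add_atTop_nat 1)
  have := (((h1.const_mul 3).sub ((S_pow_lim m).const_mul (3^m))).add hz).div_const 2
  rw [add_zero] at this
  exact this.congr (fun N => (e N).symm)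

lemma pow_lip_aux (a b : ℚ_[3]) (ha : ‖a‖ ≤ 1) (hb : ‖b‖ ≤ 1) (c : ℕ) : ‖a^c - b^c‖ ≤ ‖a - b‖ := by
  induction c with
  | zero => simp
  | succ c ih =>
    rw [show a^(c+1) - b^(c+1) = (a^c - b^c) * a + b^c * (a - b) by ring]
    apply norm_add_le'
    · rw [norm_mul]; exact (mul_le_of_le_one_right (norm_nonneg _) ha).trans ih
    · rw [norm_mul, norm_pow]; exact mul_le_of_le_one_left (norm_nonneg _) (pow_le_one₀ (norm_nonneg _) hb)

lemma pow_lip3 (a b : ℚ_[3]) (ha : ‖a‖ ≤ 1) (hb : ‖b‖ ≤ 1) (hab : ‖a - b‖ ≤ 3⁻¹) (v : ℕ) : 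
    ‖a^(3^v) - b^(3^v)‖ ≤ (3⁻¹)^v * ‖a - b‖ := by
  induction v with
  | zero => simp
  | succ v ih =>
    rw [pow_succ 3 v, pow_mul, pow_mul]
    have ha' : ‖a^(3^v)‖ ≤ 1 := by rw [norm_pow]; exact pow_le_one₀ (norm_nonneg _) ha
    have hb' : ‖b^(3^v)‖ ≤ 1 := by rw [norm_pow]; exact pow_le_one₀ (norm_nonneg _) hb
    have h3 : ‖a^(3^v) - b^(3^v)‖ ≤ 3⁻¹ := (pow_lip_aux a b ha hb _).trans hab
    generalize a^(3^v) = A at *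
    generalize b^(3^v) = B at *
    rw [show A^3 - B^3 = ((A-B)^2 + 3*(A*B)) * (A - B) by ring, norm_mul, pow_succ (3⁻¹:ℝ), mul_comm _ (3⁻¹:ℝ), mul_assoc]
    gcongr
    apply norm_add_le'
    · rw [norm_pow]
      have := norm_nonneg (A-B)
      nlinarith
    · rw [norm_mul, norm_mul, norm3]
      exact mul_le_of_le_one_right (by norm_num) (mul_le_one₀ ha' (norm_nonneg _) hb')

lemma pow_lip (a b : ℚ_[3]) (ha : ‖a‖ ≤ 1) (hb : ‖b‖ ≤ 1) (hab : ‖a - b‖ ≤ 3⁻¹) (K : ℕ) (hK : K ≠ 0) : 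
    ‖a^K - b^K‖ ≤ ‖(K:ℚ_[3])‖ * ‖a - b‖ := by
  obtain ⟨v, s, hs, he⟩ := Nat.exists_eq_pow_mul_and_not_dvd hK 3 (by norm_num)
  rw [he]; push_cast
  rw [norm_mul, norm_pow, norm3, norm_nat_one hs, mul_one, pow_mul, pow_mul]
  refine (pow_lip_aux _ _ ?_ ?_ s).trans (pow_lip3 a b ha hb hab v)
  · rw [norm_pow]; exact pow_le_one₀ (norm_nonneg _) ha
  · rw [norm_pow]; exact pow_le_one₀ (norm_nonneg _) hb

lemma u_lip (s m K : ℕ) (hK : K ≠ 0) : ‖(3*((s+m:ℕ):ℚ_[3])+1)^(2*K) - (3*(s:ℚ_[3])+1)^(2*K)‖ ≤ ‖(K:ℚ_[3])‖ * ‖(m:ℚ_[3])‖ := by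
  have e : (3*((s+m:ℕ):ℚ_[3])+1) - (3*(s:ℚ_[3])+1) = 3 * m := by push_cast; ring
  have hm := norm_nat_le m
  have h1 : ‖(3*((s+m:ℕ):ℚ_[3])+1) - (3*(s:ℚ_[3])+1)‖ ≤ 3⁻¹ := by
    rw [e, norm_mul, norm3]
    exact mul_le_of_le_one_right (by norm_num) hm
  refine (pow_lip _ _ (norm_u _).le (norm_u _).le h1 (2*K) (by omega)).trans ?_
  rw [e, norm_mul, norm3, Nat.cast_mul, norm_mul]
  have h2 := norm_nat_le 2
  have : ‖((2:ℕ):ℚ_[3])‖ * ‖(K:ℚ_[3])‖ ≤ ‖(K:ℚ_[3])‖ := mul_le_of_le_one_left (norm_nonneg _) h2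
  have h4 : 3⁻¹ * ‖(m:ℚ_[3])‖ ≤ ‖(m:ℚ_[3])‖ := mul_le_of_le_one_left (norm_nonneg _) (by norm_num)
  gcongr

lemma TV (k N : ℕ) : ‖S N (fun t => (3*(t:ℚ_[3])+1)^(2*k)) - S N (fun t => ((3*(t:ℚ_[3])+1)⁻¹)^2)‖ ≤ 3 * ‖(k:ℚ_[3])+1‖ := by
  rw [← S_sub]
  have hv : Lip 1 (fun t => ((3*(t:ℚ_[3])+1)⁻¹)^2) := by
    have h := Lip_inv (L := 1) le_rfl 0
    have := h.mul h
    simpa [pow_two] using this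
  have hf : (fun t : ℕ => (3*(t:ℚ_[3])+1)^(2*k) - ((3*(t:ℚ_[3])+1)⁻¹)^2) = 
      fun t : ℕ => ((3*(t:ℚ_[3])+1)^(2*(k+1)) - 1) * ((3*(t:ℚ_[3])+1)⁻¹)^2 := by
    funext t
    have := u_ne t
    generalize 3*(t:ℚ_[3])+1 = x at *
    field_simp
    ring
  rw [hf]
  have hk : ((k:ℚ_[3])+1) = ((k+1:ℕ):ℚ_[3]) := by push_cast; rfl
  rw [hk]
  apply S_bound _ _ (by simp) (norm_nonneg _)
  intro s m
  have h1 := u_lip s m (k+1) (by omega)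
  have h0 := u_lip 0 s (k+1) (by omega)
  have hs := norm_nat_le s
  have h0' : ‖(3*(s:ℚ_[3])+1)^(2*(k+1)) - 1‖ ≤ ‖((k+1:ℕ):ℚ_[3])‖ := by
    simp only [zero_add, Nat.cast_zero, mul_zero, one_pow] at h0
    exact h0.trans (mul_le_of_le_one_right (norm_nonneg _) hs)
  have hv1 := hv.1 (s+m)
  have hv2 := hv.2 s m
  rw [one_mul] at hv2
  simp only at hv1 hv2 ⊢
  generalize 3*((s+m:ℕ):ℚ_[3])+1 = x at *
  generalize 3*(s:ℚ_[3])+1 = y at *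
  rw [show (x^(2*(k+1)) - 1) * x⁻¹^2 - (y^(2*(k+1)) - 1) * y⁻¹^2 = (x^(2*(k+1)) - y^(2*(k+1))) * x⁻¹^2 + (y^(2*(k+1)) - 1) * (x⁻¹^2 - y⁻¹^2) by ring]
  apply norm_add_le'
  · rw [norm_mul]; exact (mul_le_of_le_one_right (norm_nonneg _) hv1).trans h1
  · rw [norm_mul]; gcongr

lemma T_lim (η : ℚ_[3])
    (hη : ∃ K : ℕ → ℕ, (∀ j, 0 < K j) ∧
      Filter.Tendsto (fun j => (K j : ℝ)) Filter.atTop Filter.atTop ∧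
      Filter.Tendsto (fun j => ‖(K j : ℚ_[3]) + 1‖) Filter.atTop (nhds 0) ∧
      Filter.Tendsto
        (fun j => ((-((1 - (3 : ℚ) ^ (2 * K j - 1)) * bernoulli (2 * K j) / (2 * K j)) : ℚ) : ℚ_[3]))
        Filter.atTop (nhds η)) :
    Tendsto (fun N => S N (fun t => ((3*(t:ℚ_[3])+1)⁻¹)^2)) atTop (𝓝 (3*η)) := by
  obtain ⟨K, hK, -, h1, h2⟩ := hη
  have hKl : Tendsto (fun j => (K j : ℚ_[3])) atTop (𝓝 (-1)) := by
    have := (tendsto_zero_iff_norm_tendsto_zero.2 h1).sub_const 1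
    simpa using this
  have hb : Tendsto (fun j => ((3 * ((bernoulli (2*K j) : ℚ):ℚ_[3]) - 3^(2*K j) * (bernoulli (2*K j) : ℚ)) / 2)) atTop (𝓝 (3*η)) := by
    have := (hKl.const_mul (-3)).mul h2
    rw [show -3 * -1 * η = 3 * η by ring] at this
    refine this.congr (fun j => ?_)
    have hj : (K j : ℚ_[3]) ≠ 0 := by exact_mod_cast (hK j).ne'
    have e : 3^(2*K j) = 3 * (3:ℚ_[3])^(2*K j-1) := by
      rw [← pow_succ']; congr 1; have := hK j; omega
    push_cast
    rw [e]
    field_simp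
  rw [Metric.tendsto_atTop] at hb h1 ⊢
  intro ε hε
  obtain ⟨j1, h1⟩ := h1 (ε/3) (by positivity)
  obtain ⟨j2, hb⟩ := hb ε hε
  set j := max j1 j2
  have h1 := h1 j (le_max_left _ _)
  have hb := hb j (le_max_right _ _)
  obtain ⟨N0, hN0⟩ := Metric.tendsto_atTop.1 (V_lim (2*K j) (even_two_mul _)) ε hε
  refine ⟨N0, fun N hN => ?_⟩
  have hN := hN0 N hN
  have hT := TV (K j) N
  simp only [dist_zero_right, norm_norm] at h1
  have hT' : ‖S N (fun t => (3*(t:ℚ_[3])+1)^(2*K j)) - S N (fun t => ((3*(t:ℚ_[3])+1)⁻¹)^2)‖ < ε := by linarith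
  rw [← dist_eq_norm, dist_comm] at hT'
  refine lt_of_le_of_lt (dist_triangle_max _ (S N (fun t => (3*(t:ℚ_[3])+1)^(2*K j))) _) (max_lt hT' ?_)
  exact lt_of_le_of_lt (dist_triangle_max _ _ _) (max_lt hN hb)

lemma Theta_lim (η : ℚ_[3]) (h : Tendsto (fun N => S N (fun t => ((3*(t:ℚ_[3])+1)⁻¹)^2)) atTop (𝓝 (3*η))) :
    Tendsto (fun N => S N (R 0)) atTop (𝓝 (27*η)) := by
  have e : ∀ N, S N (R 0) = 9 * S N (fun t => ((3*(t:ℚ_[3])+1)⁻¹)^2) := by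
    intro N
    rw [← S_mul]
    congr 1; funext t
    rw [R_eq]
    simp
  simp_rw [e]
  have := h.const_mul 9
  rwa [show 9 * (3*η) = 27*η by ring] at this
end Z3

namespace Z3
open Finset Filter Topology

noncomputable def MM (n : ℕ) : ℝ := ∑ d ∈ Ioc 0 n, ArithmeticFunction.vonMangoldt d / d
noncomputable def ps (n : ℕ) : ℝ := ∑ d ∈ Ioc 0 n, ArithmeticFunction.vonMangoldt d

lemma ps_eq (n : ℕ) : ps n = Chebyshev.psi n := by
  unfold ps Chebyshev.psi; rw [Nat.floor_natCast]

lemma MM_le (n : ℕ) (hn : 0 < n) : MM n ≤ Real.log n + (Real.log 4 + 4) := by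
  have h1 := ArithmeticFunction.sum_Ioc_mul_zeta_eq_sum ArithmeticFunction.vonMangoldt n
  rw [ArithmeticFunction.vonMangoldt_mul_zeta] at h1
  have h2 : ∑ k ∈ Ioc 0 n, ArithmeticFunction.log k ≤ n * Real.log n := by
    calc _ ≤ ∑ k ∈ Ioc 0 n, Real.log n := by
          apply sum_le_sum; intro k hk
          rw [mem_Ioc] at hk
          rw [ArithmeticFunction.log_apply]
          apply Real.log_le_log (by exact_mod_cast hk.1) (by exact_mod_cast hk.2)
      _ = _ := by simp
  have h3 : n * MM n - ps n ≤ ∑ k ∈ Ioc 0 n, ArithmeticFunction.vonMangoldt k * ((n / k : ℕ):ℝ) := by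
    unfold MM ps
    rw [mul_sum, ← sum_sub_distrib]
    apply sum_le_sum; intro k hk
    rw [mem_Ioc] at hk
    have hL := ArithmeticFunction.vonMangoldt_nonneg (n := k)
    have hk0 : (0:ℝ) < k := by exact_mod_cast hk.1
    have hf : (n:ℝ)/k - 1 ≤ ((n / k : ℕ):ℝ) := by
      have := Nat.lt_div_mul_add (a := n) hk.1
      have h' : (n:ℝ) < ((n/k:ℕ):ℝ) * k + k := by exact_mod_cast this
      rw [sub_le_iff_le_add, div_le_iff₀ hk0]
      linarith
    calc _ = ArithmeticFunction.vonMangoldt k * ((n:ℝ)/k - 1) := by ring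
      _ ≤ _ := by gcongr
  have h4 := Chebyshev.psi_le_const_mul_self (x := n) (by positivity)
  rw [← ps_eq] at h4
  have hn' : (0:ℝ) < n := by exact_mod_cast hn
  have : n * MM n ≤ n * (Real.log n + (Real.log 4 + 4)) := by linarith
  exact le_of_mul_le_mul_left this hn'

lemma good_n (δ : ℝ) (hδ : 0 < δ) (N0 : ℕ) : ∃ n ≥ N0, ps n ≤ (1+δ) * n := by
  by_contra hc
  push Not at hc
  have key : ∀ k, (1+δ) * Real.log ((N0+1+k:ℕ)+1) - (1+δ) * Real.log ((N0+1:ℕ)+1) + (MM (N0+1) - ps (N0+1) / (N0+1:ℕ)) 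
      ≤ MM (N0+1+k) - ps (N0+1+k) / (N0+1+k:ℕ) := by
    intro k
    induction k with
    | zero => simp
    | succ k ih =>
      have h1 := hc (N0+1+k) (by omega)
      rw [← add_assoc]
      set n := N0+1+k with hn
      have hM : MM (n+1) = MM n + ArithmeticFunction.vonMangoldt (n+1) / (n+1:ℕ) := by
        unfold MM; rw [sum_Ioc_succ_top (by omega)]
      have hP : ps (n+1) = ps n + ArithmeticFunction.vonMangoldt (n+1) := by
        unfold ps; rw [sum_Ioc_succ_top (by omega)]
      have hn0 : (0:ℝ) < n := by exact_mod_cast (by omega : 0 < n)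
      have hlog : Real.log ((n+1:ℕ)+1) ≤ Real.log (n+1) + 1/((n:ℝ)+1) := by
        have e : ((n+1:ℕ):ℝ)+1 = (n+1) * (1 + 1/((n:ℝ)+1)) := by push_cast; field_simp
        rw [e, Real.log_mul (by positivity) (by positivity)]
        have := Real.log_le_sub_one_of_pos (x := 1 + 1/((n:ℝ)+1)) (by positivity)
        linarith
      have hstep : MM (n+1) - ps (n+1) / (n+1:ℕ) = MM n - ps n / n + ps n / (n*(n+1)) := by
        rw [hM, hP]; push_cast; field_simp; ring
      have h2 : (1+δ) * (1/((n:ℝ)+1)) ≤ ps n / (n*(n+1)) := by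
        rw [le_div_iff₀ (by positivity)]
        calc _ = (1+δ) * n := by field_simp
          _ ≤ _ := h1.le
      have h3 : (1+δ) * Real.log ((n+1:ℕ)+1) ≤ (1+δ) * (Real.log (n+1) + 1/((n:ℝ)+1)) := by gcongr
      rw [hstep]
      rw [mul_add] at h3
      linarith
  set C := - (1+δ) * Real.log ((N0+1:ℕ)+1) + (MM (N0+1) - ps (N0+1) / (N0+1:ℕ)) with hC
  have h5 : ∀ k : ℕ, δ * Real.log (N0+1+k:ℕ) ≤ (Real.log 4 + 4) - C := by
    intro k
    have h1 := key k
    have h2 := MM_le (N0+1+k) (by omega)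
    have h3 : 0 ≤ ps (N0+1+k) / (N0+1+k:ℕ) := by
      apply div_nonneg _ (by positivity)
      rw [ps_eq]; exact Chebyshev.psi_nonneg _
    have h4 : Real.log (N0+1+k:ℕ) ≤ Real.log ((N0+1+k:ℕ)+1) := by
      apply Real.log_le_log
      · exact_mod_cast (by omega : 0 < N0+1+k)
      · linarith
    have h6 : (1+δ) * Real.log (N0+1+k:ℕ) ≤ (1+δ) * Real.log ((N0+1+k:ℕ)+1) := by gcongr
    rw [hC]
    linarith
  have ht : Tendsto (fun k : ℕ => δ * Real.log (N0+1+k:ℕ)) atTop atTop := by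
    apply Tendsto.const_mul_atTop hδ
    apply Real.tendsto_log_atTop.comp
    apply tendsto_natCast_atTop_atTop.comp
    exact tendsto_atTop_mono (fun k => by simp only [id]; omega) tendsto_id
  obtain ⟨k, hk⟩ := (ht.eventually_gt_atTop ((Real.log 4 + 4) - C)).exists
  exact absurd (h5 k) (not_le.2 hk)

lemma lcm_le {δ : ℝ} {n : ℕ} (h : ps n ≤ (1+δ) * n) : (Nat.lcmUpto n : ℝ) ≤ Real.exp ((1+δ)*n) := by
  rw [ps_eq, Chebyshev.psi_eq_log_lcmUpto] at h
  rwa [← Real.log_le_iff_le_exp]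
  exact_mod_cast Nat.lcmUpto_pos n
end Z3

namespace Z3
open Finset Filter Topology

lemma log3_gt : 1 + 1/20 < Real.log 3 := by
  rw [Real.lt_log_iff_exp_lt (by norm_num), Real.exp_add]
  have h1 := Real.exp_one_lt_d9
  have h2 : Real.exp (1/20) ≤ 20/19 := by
    have := Real.one_sub_le_exp_neg (1/20)
    rw [Real.exp_neg] at this
    have hp := Real.exp_pos (1/20)
    have h3 : (19/20 : ℝ) ≤ (Real.exp (1/20))⁻¹ := by linarith
    rw [le_inv_comm₀ (by norm_num) hp] at h3
    linarith
  have hp := Real.exp_pos (1/20)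
  nlinarith

lemma ev_log (C1 C2 c : ℝ) (hc : 0 < c) : ∃ N0 : ℕ, ∀ n : ℕ, N0 ≤ n → C1 + C2 * Real.log (n+2) ≤ c * n := by
  have h0 : Tendsto (fun n : ℕ => (n:ℝ)+2) atTop atTop :=
    tendsto_atTop_add_const_right _ _ tendsto_natCast_atTop_atTop
  have h1 := (Real.isLittleO_log_id_atTop.comp_tendsto h0).const_mul_left C2
  have h2 := h1.def (c := c/2) (by positivity)
  have h3 : ∀ᶠ n : ℕ in atTop, C1 + c ≤ c/2 * (n:ℝ) := 
    (tendsto_natCast_atTop_atTop.const_mul_atTop (by positivity : 0 < c/2)).eventually_ge_atTop _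
  obtain ⟨N0, h⟩ := eventually_atTop.1 (h2.and h3)
  refine ⟨N0, fun n hn => ?_⟩
  obtain ⟨ha, hb⟩ := h n hn
  simp only [Function.comp, id, Real.norm_eq_abs] at ha
  have hpos : (0:ℝ) ≤ (n:ℝ)+2 := by positivity
  rw [abs_of_nonneg hpos] at ha
  have := le_abs_self (C2 * Real.log (n+2))
  linarith

noncomputable def HH (δ : ℝ) (n : ℕ) : ℝ := 108*(n+2)*27^(n+1)*(Real.exp ((1+δ)*(n+1)))^3

lemma HH_pos (δ : ℝ) (n : ℕ) : 0 < HH δ n := by unfold HH; positivity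

lemma log27 : Real.log 27 = 3 * Real.log 3 := by
  rw [show (27:ℝ) = 3^3 by norm_num, Real.log_pow]; norm_num

lemma log_HH (δ : ℝ) (n : ℕ) : Real.log (HH δ n) = 
    Real.log 108 + Real.log (n+2) + (n+1) * (3 * Real.log 3) + 3 * ((1+δ)*(n+1)) := by
  unfold HH
  have : (0:ℝ) < n+2 := by positivity
  rw [Real.log_mul (by positivity) (by positivity), Real.log_mul (by positivity) (by positivity),
    Real.log_mul (by positivity) (by positivity), Real.log_pow, Real.log_pow, Real.log_exp, log27]
  push_cast; ring

lemma ints {δ : ℝ} {n : ℕ} (h : ps (n+1) ≤ (1+δ) * (n+1:ℕ)) (i : ℕ) (hi : i ≤ n+1) :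
    ∃ p q : ℤ, (p:ℚ) = 27^i * (Nat.lcmUpto (n+1) : ℚ)^3 * Ps i ∧ (q:ℚ) = 27^(i+1) * (Nat.lcmUpto (n+1):ℚ)^3 * Qs i
      ∧ |(p:ℝ)| ≤ HH δ n ∧ |(q:ℝ)| ≤ HH δ n ∧ (Qs i ≠ 0 → q ≠ 0 ∧ (n:ℤ) ≤ |q|) := by
  set d := Nat.lcmUpto (n+1) with hd
  have hdvd : ∀ j, 1 ≤ j → j ≤ n+1 → j ∣ d := by
    intro j h1 h2
    exact Finset.dvd_lcm (f := id) (by simp; omega)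
  have hd0 : 0 < d := Nat.lcmUpto_pos _
  have hdn : n+1 ≤ d := Nat.le_of_dvd hd0 (hdvd _ (by omega) le_rfl)
  have hdle := lcm_le h
  rw [← hd] at hdle
  push_cast at hdle
  obtain ⟨p, hp⟩ := mem_ZZ.1 (P_int d i (fun j h1 h2 => hdvd j h1 (by omega)))
  obtain ⟨z, hz⟩ := mem_ZZ.1 (Q_int i)
  have hq : ((27 * (d:ℤ)^3 * z : ℤ):ℚ) = 27^(i+1) * (d:ℚ)^3 * Qs i := by
    push_cast; rw [← hz]; ring
  have hbound : ∀ x : ℚ, |x| ≤ 4*((i:ℚ)+1) → |((27^(i+1) * (d:ℚ)^3 * x : ℚ) : ℝ)| ≤ HH δ n := by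
    intro x hx
    have hx' : |(x:ℝ)| ≤ 4*((i:ℝ)+1) := by exact_mod_cast hx
    push_cast
    rw [abs_mul, abs_of_nonneg (by positivity : (0:ℝ) ≤ 27^(i+1) * (d:ℝ)^3)]
    have hi' : (i:ℝ)+1 ≤ n + 2 := by exact_mod_cast (by omega : i+1 ≤ n+2)
    unfold HH
    have h27 : (27:ℝ)^i ≤ 27^(n+1) := pow_le_pow_right₀ (by norm_num) hi
    calc (27:ℝ)^(i+1) * (d:ℝ)^3 * |(x:ℝ)| = 27 * 27^i * (d:ℝ)^3 * |(x:ℝ)| := by ring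
      _ ≤ 27 * 27^(n+1) * (Real.exp ((1+δ)*(n+1)))^3 * (4 * ((n:ℝ)+2)) := by
          have := hx'.trans (mul_le_mul_of_nonneg_left hi' (by norm_num : (0:ℝ) ≤ 4))
          gcongr
      _ = _ := by ring
  refine ⟨p, 27 * (d:ℤ)^3 * z, hp.symm, hq, ?_, ?_, ?_⟩
  · have h1 := hbound _ (P_growth i)
    have e : ((27^(i+1) * (d:ℚ)^3 * Ps i : ℚ):ℝ) = 27 * p := by
      have : (27^(i+1) * (d:ℚ)^3 * Ps i : ℚ) = 27 * p := by rw [← hp]; ring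
      rw [this]; push_cast; ring
    rw [e, abs_mul] at h1
    have : |(27:ℝ)| = 27 := by norm_num
    rw [this] at h1
    linarith [abs_nonneg (p:ℝ)]
  · have h1 := hbound _ (Q_growth i)
    rw [← hq] at h1
    exact_mod_cast h1
  · intro hQ
    have hz0 : z ≠ 0 := by
      rintro rfl
      rw [Int.cast_zero] at hz
      exact hQ ((mul_eq_zero.1 hz).resolve_left (by positivity))
    have hdz : (0:ℤ) < d := by exact_mod_cast hd0
    have h27 : (0:ℤ) < 27 * (d:ℤ)^3 := by positivity
    refine ⟨mul_ne_zero h27.ne' hz0, ?_⟩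
    rw [abs_mul, abs_of_pos h27]
    have h1 : 1 ≤ |z| := Int.one_le_abs hz0
    have h2 : (n:ℤ) ≤ d := by exact_mod_cast (by omega : n ≤ d)
    have h3 : (d:ℤ) ≤ d^3 := le_self_pow₀ (by omega) (by norm_num)
    nlinarith

lemma rr_small' (Θ : ℚ_[3]) (h : Tendsto (fun N => S N (R 0)) atTop (𝓝 Θ)) (n i : ℕ) (hi : i = n ∨ i = n+1) :
    ‖rr Θ i‖ ≤ 3*(n+2)^3 * (27⁻¹)^n := by
  refine (rr_small Θ h i).trans ?_
  rcases hi with rfl | rfl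
  · gcongr; linarith
  · push_cast
    rw [show (n:ℝ)+1+1 = n+2 by ring]
    have : (27⁻¹:ℝ)^(n+1) ≤ 27⁻¹^n := pow_le_pow_of_le_one (by norm_num) (by norm_num) (by omega)
    gcongr

lemma casor_rr (Θ : ℚ_[3]) (n : ℕ) : 
    1 ≤ ‖(Qs n : ℚ_[3]) * rr Θ (n+1) - (Qs (n+1) : ℚ_[3]) * rr Θ n‖ := by
  have h := congrArg (Rat.cast : ℚ → ℚ_[3]) (casor n)
  push_cast at h
  have e : (Qs n : ℚ_[3]) * rr Θ (n+1) - (Qs (n+1) : ℚ_[3]) * rr Θ n = -(2/((n+1:ℕ):ℚ_[3])^3) := by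
    push_cast; rw [← h]; unfold rr; ring
  rw [e, norm_neg, norm_div, norm_pow]
  have h2 : ‖(2:ℚ_[3])‖ = 1 := by exact_mod_cast norm_nat_one (m := 2) (by norm_num)
  have h1 := norm_nat_le (n+1)
  have h0 : 0 < ‖((n+1:ℕ):ℚ_[3])‖ := by rw [norm_pos_iff]; exact_mod_cast Nat.succ_ne_zero n
  rw [h2, le_div_iff₀ (by positivity), one_mul]
  exact pow_le_one₀ h0.le h1

lemma one_le_int {z : ℤ} (h : z ≠ 0) : 1 ≤ |(z:ℝ)| * ‖(z:ℚ_[3])‖ := by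
  have h1 := one_le_nat_mul_norm (m := z.natAbs) (by omega)
  have h2 : ((z.natAbs:ℕ):ℝ) = |(z:ℝ)| := by rw [Nat.cast_natAbs]; push_cast; rfl
  have h3 : ‖((z.natAbs:ℕ):ℚ_[3])‖ = ‖(z:ℚ_[3])‖ := by
    exact norm_natAbs z
  rwa [h2, h3] at h1

lemma irr (η : ℚ_[3]) (h : Tendsto (fun N => S N (R 0)) atTop (𝓝 (27*η))) (a b : ℤ) (hb : b ≠ 0) :
    (b:ℚ_[3]) * η ≠ a := by
  intro hab
  set L := Real.log 3 with hL
  have hL3 := log3_gt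
  have hB : (1:ℝ) ≤ |(b:ℝ)| := by exact_mod_cast Int.one_le_abs hb
  set B : ℝ := |(a:ℝ)| + |(b:ℝ)| with hBdef
  have hB1 : 0 < B := by have := abs_nonneg (a:ℝ); linarith
  obtain ⟨N0, hN0⟩ := ev_log (Real.log B + Real.log 108 + Real.log 3 + 3*L + 3*(1+1/20) + 1) 4 (3*L - 3*(1+1/20)) (by linarith)
  obtain ⟨m, hm, hps⟩ := good_n (1/20) (by norm_num) (N0+1)
  obtain ⟨n, rfl⟩ : ∃ n, m = n+1 := ⟨m-1, by omega⟩
  have hn := hN0 n (by omega)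
  have hr : ∀ i, i = n ∨ i = n+1 → rr (27*η) i = 0 := by
    intro i hi
    obtain ⟨p, q, hp, hq, hpH, hqH, -⟩ := ints hps i (by omega)
    have hp' := congrArg (Rat.cast : ℚ → ℚ_[3]) hp
    have hq' := congrArg (Rat.cast : ℚ → ℚ_[3]) hq
    push_cast at hp' hq'
    set d := Nat.lcmUpto (n+1)
    have hd0 : (d:ℚ_[3]) ≠ 0 := by exact_mod_cast Nat.lcmUpto_ne_zero (n+1)
    have e : ((a * q - b * p : ℤ):ℚ_[3]) = b * (27^i * (d:ℚ_[3])^3 * rr (27*η) i) := by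
      push_cast; rw [← hab, hp', hq']; unfold rr; ring
    by_contra hne
    have hz : a * q - b * p ≠ 0 := by
      intro h0
      rw [h0, Int.cast_zero] at e
      have hb' : (b:ℚ_[3]) ≠ 0 := by exact_mod_cast hb
      exact mul_ne_zero hb' (mul_ne_zero (mul_ne_zero (pow_ne_zero _ (by norm_num)) (pow_ne_zero _ hd0)) hne) e.symm
    have h1 := one_le_int hz
    have hnorm : ‖((a * q - b * p : ℤ):ℚ_[3])‖ ≤ (27⁻¹)^n * (3*(n+2)^3 * (27⁻¹)^n) := by
      rw [e, norm_mul, norm_mul, norm_mul, norm_pow, norm_pow]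
      have h27 : ‖(27:ℚ_[3])‖ = 27⁻¹ := by
        rw [show (27:ℚ_[3]) = 3^3 by norm_num, norm_pow, norm3]; norm_num
      have h27' : (27⁻¹:ℝ)^i ≤ 27⁻¹^n := pow_le_pow_of_le_one (by norm_num) (by norm_num) (by omega)
      have hrr := rr_small' _ h n i hi
      have hbn := Padic.norm_int_le_one (p := 3) b
      have hdn := pow_le_one₀ (n := 3) (norm_nonneg _) (norm_nat_le d)
      rw [h27]
      calc _ ≤ 1 * ((27⁻¹)^n * 1 * (3*((n:ℝ)+2)^3 * (27⁻¹)^n)) := by gcongr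
        _ = _ := by ring
    have habs : |((a * q - b * p : ℤ):ℝ)| ≤ B * HH (1/20) n := by
      push_cast
      calc _ ≤ |(a:ℝ)*q| + |(b:ℝ)*p| := abs_sub _ _
        _ = |(a:ℝ)| * |(q:ℝ)| + |(b:ℝ)| * |(p:ℝ)| := by rw [abs_mul, abs_mul]
        _ ≤ |(a:ℝ)| * HH (1/20) n + |(b:ℝ)| * HH (1/20) n := by gcongr
        _ = _ := by rw [hBdef]; ring
    have hH := HH_pos (1/20) n
    have h2 : 1 ≤ (B * HH (1/20) n) * ((27⁻¹)^n * (3*(n+2)^3 * (27⁻¹)^n)) :=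
      h1.trans (mul_le_mul habs hnorm (norm_nonneg _) (by positivity))
    have h3 := Real.log_le_log (by norm_num) h2
    have hn2 : (0:ℝ) < n+2 := by positivity
    rw [Real.log_one, Real.log_mul (by positivity) (by positivity), Real.log_mul (by positivity) (by positivity),
      Real.log_mul (by positivity) (by positivity), Real.log_mul (by positivity) (by positivity), Real.log_mul (by positivity) (by positivity),
      Real.log_pow, Real.log_pow, Real.log_inv, log27, log_HH] at h3
    push_cast at h3
    rw [← hL] at *
    linarith
  have := casor_rr (27*η) n
  rw [hr n (Or.inl rfl), hr (n+1) (Or.inr rfl), mul_zero, mul_zero, sub_zero, norm_zero] at this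
  linarith

lemma main (η : ℚ_[3]) (h : Tendsto (fun N => S N (R 0)) atTop (𝓝 (27*η))) (ε : ℝ) (hε : 0 < ε) (N : ℕ) :
    ∃ p q : ℤ, q ≠ 0 ∧ (N:ℤ) ≤ |q| ∧ 0 < ‖η - (p : ℚ_[3]) / (q : ℚ_[3])‖ ∧
        ‖η - (p : ℚ_[3]) / (q : ℚ_[3])‖ ≤
          ((max |p| |q| : ℤ) : ℝ) ^ (-(6 * Real.log 3 / (3 * Real.log 3 + 3) - ε)) := by
  set L := Real.log 3 with hL
  have hL3 := log3_gt
  rw [← hL] at hL3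
  set e := min ε (1/2) with he
  have he0 : 0 < e := lt_min hε (by norm_num)
  have he1 : e ≤ 1/2 := min_le_right _ _
  have heε : e ≤ ε := min_le_left _ _
  set θ := 6 * L / (3 * L + 3) with hθ
  have hθ1 : 1 ≤ θ := by rw [hθ, le_div_iff₀ (by linarith)]; linarith
  have hθ2 : θ ≤ 2 := by rw [hθ, div_le_iff₀ (by linarith)]; linarith
  have hθm : θ * (3*L+3) = 6*L := by rw [hθ]; field_simp
  set τ := θ - e with hτ
  have hτ0 : 0 < τ := by linarith
  set δ := e/10 with hδ
  have hδ0 : 0 < δ := by positivity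
  obtain ⟨N0, hN0⟩ := ev_log (Real.log 243 + τ * (Real.log 108 + 3*L + 3*(1+δ))) (6+τ) e he0
  obtain ⟨m, hm, hps⟩ := good_n δ hδ0 (N0+N+1)
  obtain ⟨n, rfl⟩ : ∃ n, m = n+1 := ⟨m-1, by omega⟩
  have hn := hN0 n (by omega)
  have hcas := casor_rr (27*η) n
  have hX : (0:ℝ) < 3*(n+2)^3 * (27⁻¹)^n := by positivity
  obtain ⟨i, hi, hQi⟩ : ∃ i, (i = n ∨ i = n+1) ∧ 1 ≤ ‖(Qs i:ℚ_[3])‖ * (3*(n+2)^3 * (27⁻¹)^n) := by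
    by_contra hc
    push Not at hc
    have h1 := hc n (Or.inl rfl)
    have h2 := hc (n+1) (Or.inr rfl)
    have r1 := rr_small' _ h n n (Or.inl rfl)
    have r2 := rr_small' _ h n (n+1) (Or.inr rfl)
    have a1 : ‖(Qs n : ℚ_[3]) * rr (27*η) (n+1)‖ < 1 := by
      rw [norm_mul]; exact lt_of_le_of_lt (mul_le_mul_of_nonneg_left r2 (norm_nonneg _)) h1
    have a2 : ‖(Qs (n+1) : ℚ_[3]) * rr (27*η) n‖ < 1 := by
      rw [norm_mul]; exact lt_of_le_of_lt (mul_le_mul_of_nonneg_left r1 (norm_nonneg _)) h2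
    have := norm_sub_le' _ _ _ (le_max_left ‖(Qs n : ℚ_[3]) * rr (27*η) (n+1)‖ ‖(Qs (n+1) : ℚ_[3]) * rr (27*η) n‖) (le_max_right _ _)
    exact absurd (hcas.trans this) (not_le.2 (max_lt a1 a2))
  have hQn : 0 < ‖(Qs i:ℚ_[3])‖ := by
    by_contra hc
    have : ‖(Qs i:ℚ_[3])‖ = 0 := le_antisymm (not_lt.1 hc) (norm_nonneg _)
    rw [this, zero_mul] at hQi
    linarith
  have hQ3 : (Qs i:ℚ_[3]) ≠ 0 := norm_pos_iff.1 hQn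
  have hQ : Qs i ≠ 0 := by intro h0; rw [h0] at hQ3; simp at hQ3
  obtain ⟨p, q, hp, hq, hpH, hqH, hqq⟩ := ints hps i (by omega)
  obtain ⟨hq0, hqn⟩ := hqq hQ
  have hq3 : (q:ℚ_[3]) ≠ 0 := by exact_mod_cast hq0
  have hne : η - (p : ℚ_[3]) / (q : ℚ_[3]) ≠ 0 := by
    intro h0
    apply irr η h p q hq0
    rw [sub_eq_zero.1 h0]; field_simp
  refine ⟨p, q, hq0, le_trans (by exact_mod_cast (by omega : N ≤ n)) hqn, norm_pos_iff.2 hne, ?_⟩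
  have heq : η - (p : ℚ_[3]) / (q : ℚ_[3]) = rr (27*η) i / (27 * Qs i) := by
    have hp' := congrArg (Rat.cast : ℚ → ℚ_[3]) hp
    have hq' := congrArg (Rat.cast : ℚ → ℚ_[3]) hq
    push_cast at hp' hq'
    have hd0 : (Nat.lcmUpto (n+1):ℚ_[3]) ≠ 0 := by exact_mod_cast Nat.lcmUpto_ne_zero (n+1)
    rw [hp', hq', pow_succ]
    unfold rr
    field_simp
    ring
  have h27 : ‖(27:ℚ_[3])‖ = 27⁻¹ := by
    rw [show (27:ℚ_[3]) = 3^3 by norm_num, norm_pow, norm3]; norm_num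
  have hA : ‖η - (p : ℚ_[3]) / (q : ℚ_[3])‖ ≤ 27 * (3*(n+2)^3 * (27⁻¹)^n)^2 := by
    rw [heq, norm_div, norm_mul, h27]
    have hrr := rr_small' _ h n i hi
    rw [div_le_iff₀ (by positivity)]
    calc ‖rr (27*η) i‖ ≤ (3*(n+2)^3 * (27⁻¹)^n) * 1 := by rw [mul_one]; exact hrr
      _ ≤ (3*(n+2)^3 * (27⁻¹)^n) * (‖(Qs i:ℚ_[3])‖ * (3*(n+2)^3 * (27⁻¹)^n)) := by gcongr
      _ = _ := by ring
  have hH := HH_pos δ n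
  have hMH : ((max |p| |q| : ℤ) : ℝ) ≤ HH δ n := by
    push_cast; exact max_le hpH hqH
  have hM1 : (1:ℝ) ≤ ((max |p| |q| : ℤ) : ℝ) := by
    exact_mod_cast le_max_of_le_right (Int.one_le_abs hq0)
  calc _ ≤ _ := hA
    _ ≤ (HH δ n)^(-τ) := by
        rw [← Real.log_le_log_iff (by positivity) (by positivity), Real.log_rpow hH, log_HH]
        have hn2 : (0:ℝ) < n+2 := by positivity
        have e1 : Real.log (27 * (3*((n:ℝ)+2)^3 * (27⁻¹)^n)^2) = Real.log 243 + 6 * Real.log (n+2) - 6*L*n := by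
          rw [show 27 * (3*((n:ℝ)+2)^3 * (27⁻¹)^n)^2 = 243 * ((n:ℝ)+2)^6 * ((27⁻¹)^n)^2 by ring]
          rw [Real.log_mul (by positivity) (by positivity), Real.log_mul (by positivity) (by positivity), Real.log_pow, Real.log_pow, Real.log_pow, Real.log_inv, log27]
          push_cast; ring
        rw [e1, ← hL]
        have k1 : τ * (3*L+3+3*δ) ≤ 6*L - e := by
          have : τ * (3*L+3+3*δ) = 6*L - e*(3*L+3) + τ*(3*δ) := by rw [hτ, ← hθm]; ring
          rw [this]
          have : τ * (3*δ) ≤ 2*(3*δ) := by gcongr; linarith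
          nlinarith
        have k2 := mul_le_mul_of_nonneg_right k1 (Nat.cast_nonneg (α := ℝ) n)
        linarith
    _ ≤ ((max |p| |q| : ℤ) : ℝ)^(-τ) := 
        Real.rpow_le_rpow_of_nonpos (by linarith) hMH (by linarith)
    _ ≤ _ := Real.rpow_le_rpow_of_exponent_le hM1 (by linarith)

end Z3

theorem stmt_6 (η : ℚ_[3])
    (hη : ∃ K : ℕ → ℕ, (∀ j, 0 < K j) ∧
      Filter.Tendsto (fun j => (K j : ℝ)) Filter.atTop Filter.atTop ∧
      Filter.Tendsto (fun j => ‖(K j : ℚ_[3]) + 1‖) Filter.atTop (nhds 0) ∧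
      Filter.Tendsto
        (fun j => ((-((1 - (3 : ℚ) ^ (2 * K j - 1)) * bernoulli (2 * K j) / (2 * K j)) : ℚ) : ℚ_[3]))
        Filter.atTop (nhds η)) :
    ∀ ε : ℝ, 0 < ε → ∃ P Q : ℕ → ℤ, (∀ n, Q n ≠ 0) ∧
      Filter.Tendsto (fun n => |Q n|) Filter.atTop Filter.atTop ∧
      ∀ᶠ n in Filter.atTop,
        0 < ‖η - (P n : ℚ_[3]) / (Q n : ℚ_[3])‖ ∧
        ‖η - (P n : ℚ_[3]) / (Q n : ℚ_[3])‖ ≤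
          ((max |P n| |Q n| : ℤ) : ℝ) ^
            (-(6 * Real.log 3 / (3 * Real.log 3 + 3) - ε)) := by
  intro ε hε
  have h := Z3.Theta_lim η (Z3.T_lim η hη)
  choose P Q h1 h2 h3 h4 using Z3.main η h ε hε
  refine ⟨P, Q, h1, ?_, Filter.Eventually.of_forall fun n => ⟨h3 n, h4 n⟩⟩
  exact Filter.tendsto_atTop_mono h2 tendsto_natCast_atTop_atTop
end

section
/- Let Δ : ℍ → ℂ be given by Δ(τ) = e^{2πiτ}·∏_{n≥1}(1 − e^{2πinτ})^{24}, and set f(τ) = Δ(2τ)/Δ(τ). Then for every τ in the upper half-plane ℍ, f(−1/(2τ))·f(τ) = 2^{−12}. (Equivalently, the Fricke involution of X₀(2) sends 2^{12} f to 1/f.) -/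
lemma disc_S (z : UpperHalfPlane) (w : UpperHalfPlane) (hw : (w : ℂ) = -1 / (z : ℂ)) :
    ModularForm.discriminant w = (z : ℂ) ^ 12 * ModularForm.discriminant z := by
  have hz := z.ne_zero
  have h := congrFun ModularForm.discriminant_S_invariant z
  rw [ModularForm.SL_slash_apply, UpperHalfPlane.modular_S_smul,
    ModularGroup.denom_S] at h
  have e : UpperHalfPlane.mk (-(z : ℂ))⁻¹ z.im_inv_neg_coe_pos = w := by
    apply UpperHalfPlane.ext
    rw [hw]
    simp [neg_div]
  rw [e] at h
  clear e hw
  rw [← h]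
  generalize ModularForm.discriminant w = a
  have h12 : (z : ℂ) ^ 12 ≠ 0 := pow_ne_zero _ hz
  rw [zpow_neg, show (z : ℂ) ^ (12 : ℤ) = (z : ℂ) ^ 12 from zpow_ofNat _ 12]
  rw [mul_comm a, mul_inv_cancel_left₀ h12]

open Complex in
theorem stmt_12 (Δ : ℂ → ℂ)
    (hΔ : ∀ τ : ℂ, 0 < τ.im →
      Δ τ = Complex.exp (2 * (Real.pi : ℂ) * I * τ) *
        ∏' n : ℕ, (1 - Complex.exp (2 * (Real.pi : ℂ) * I * ((n : ℂ) + 1) * τ)) ^ 24) :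
    ∀ τ : ℂ, 0 < τ.im →
      (Δ (2 * (-1 / (2 * τ))) / Δ (-1 / (2 * τ))) * (Δ (2 * τ) / Δ τ) = 2 ^ (-12 : ℤ) := by
  have key : ∀ z : UpperHalfPlane, Δ z = ModularForm.discriminant z := by
    intro z
    rw [hΔ z z.2, ModularForm.discriminant_eq_q_prod]
    simp_rw [ModularForm.eta_q_eq_cexp]
    simp [Function.Periodic.qParam]
  have S : ∀ z : ℂ, 0 < z.im → Δ (-1 / z) = z ^ 12 * Δ z := by
    intro z hz
    have hw : 0 < (-1 / z).im := by
      have := UpperHalfPlane.im_inv_neg_coe_pos ⟨z, hz⟩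
      simpa [neg_div] using this
    have := disc_S ⟨z, hz⟩ ⟨-1 / z, hw⟩ rfl
    rw [← key, ← key] at this
    exact this
  have N : ∀ z : ℂ, 0 < z.im → Δ z ≠ 0 := by
    intro z hz
    have := ModularForm.discriminant_ne_zero ⟨z, hz⟩
    rw [← key] at this
    exact this
  intro τ hτ
  have h2 : 0 < (2 * τ).im := by simpa using hτ
  have h0 : τ ≠ 0 := by
    rintro rfl
    simp at hτ
  have e : 2 * (-1 / (2 * τ)) = -1 / τ := by field_simp
  rw [e, S τ hτ, S _ h2]
  have n1 := N τ hτ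
  have n2 := N _ h2
  generalize Δ (2 * τ) = a at n2 ⊢
  rw [zpow_neg]
  norm_cast
  field_simp
  norm_num
end

section
/- Let Δ : ℍ → ℂ be given by Δ(τ) = e^{2πiτ}·∏_{n≥1}(1 − e^{2πinτ})^{24}. At the elliptic point τ₀ = (1+i)/2 of X₀(2), the hauptmodul f(τ) = Δ(2τ)/Δ(τ) takes the value Δ(1+i)/Δ((1+i)/2) = −2^{−6} = −1/64. -/
theorem disc_S_aux (z w : UpperHalfPlane) (h : (w : ℂ) = -(z : ℂ)⁻¹) :
    ModularForm.discriminant w = (z : ℂ) ^ 12 * ModularForm.discriminant z := by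
  have h1 := congrFun ModularForm.discriminant_S_invariant z
  have hw : w = UpperHalfPlane.mk (-z : ℂ)⁻¹ z.im_inv_neg_coe_pos := by
    ext
    exact h.trans (neg_inv (a := (z : ℂ)))
  rw [ModularForm.SL_slash_apply, UpperHalfPlane.modular_S_smul, ← hw] at h1
  have hd : ModularForm.discriminant w * ((z : ℂ) ^ 12)⁻¹ = ModularForm.discriminant z := by
    have hden : UpperHalfPlane.denom (Matrix.SpecialLinearGroup.toGL
        ((Matrix.SpecialLinearGroup.map (Int.castRingHom ℝ)) ModularGroup.S)) (z : ℂ) = z := by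
      exact ModularGroup.denom_S z
    rw [hden] at h1
    rw [← zpow_natCast, ← zpow_neg]
    exact h1
  rw [← hd]
  have hz : (z : ℂ) ≠ 0 := UpperHalfPlane.ne_zero z
  field_simp

open Complex in
theorem stmt_13 (Δ : ℂ → ℂ)
    (hΔ : ∀ τ : ℂ, 0 < τ.im →
      Δ τ = Complex.exp (2 * (Real.pi : ℂ) * I * τ) *
        ∏' n : ℕ, (1 - Complex.exp (2 * (Real.pi : ℂ) * I * ((n : ℂ) + 1) * τ)) ^ 24) :
    Δ (1 + I) / Δ ((1 + I) / 2) = -(1 / 64) := by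
  have key : ∀ z : UpperHalfPlane, Δ z = ModularForm.discriminant z := by
    intro z
    rw [hΔ z z.im_pos, ModularForm.discriminant_eq_q_prod]
    simp only [ModularForm.eta_q_eq_cexp, Function.Periodic.qParam]
    simp
  have per : Δ (1 + I) = Δ (-1 + I) := by
    rw [hΔ (1 + I) (by simp), hΔ (-1 + I) (by simp)]
    have e : ∀ n : ℕ, cexp (2 * (Real.pi : ℂ) * I * (n : ℂ) * (1 + I)) =
        cexp (2 * (Real.pi : ℂ) * I * (n : ℂ) * (-1 + I)) := by
      intro n
      rw [Complex.exp_eq_exp_iff_exists_int]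
      exact ⟨2 * n, by push_cast; ring⟩
    have e1 := e 1
    have e2 := fun n : ℕ => e (n + 1)
    push_cast at e1 e2
    rw [mul_one] at e1
    simp only [e1, e2]
  let z : UpperHalfPlane := ⟨(1 + I) / 2, by simp⟩
  let w : UpperHalfPlane := ⟨-1 + I, by simp⟩
  have hz0 : ((1 + I) / 2 : ℂ) ≠ 0 := UpperHalfPlane.ne_zero z
  have h := disc_S_aux z w (by
    change (-1 + I : ℂ) = -((1 + I) / 2)⁻¹
    rw [neg_inv]
    apply eq_inv_of_mul_eq_one_left
    ring_nf
    norm_num)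
  rw [← key, ← key] at h
  change Δ (-1 + I) = ((1 + I) / 2) ^ 12 * Δ ((1 + I) / 2) at h
  have hne : Δ ((1 + I) / 2) ≠ 0 := by
    have := ModularForm.discriminant_ne_zero z
    rwa [← key] at this
  rw [per, h, mul_div_assoc, div_self hne, mul_one]
  have h2 : ((1 + I) / 2 : ℂ) ^ 2 = I / 2 := by
    ring_nf
    norm_num
  have h4 : ((1 + I) / 2 : ℂ) ^ 12 = (I ^ 2) ^ 3 / 64 := by
    rw [show (12 : ℕ) = 2 * 6 by norm_num, pow_mul, h2]
    ring
  rw [h4]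
  norm_num
end

section
/- Let Δ : ℍ → ℂ be given by Δ(τ) = e^{2πiτ}·∏_{n≥1}(1 − e^{2πinτ})^{24}. At the elliptic point τ₁ = 1/2 + i·√3/6 of X₀(3), one has Δ(3τ₁)/Δ(τ₁) = 3^{−6}. (Equivalently, the hauptmodul f = (Δ(3τ)/Δ(τ))^{1/2} of X₀(3) takes the value −3^{−3} there.) -/
open Complex in
theorem stmt_14 (Δ : ℂ → ℂ)
    (hΔ : ∀ τ : ℂ, 0 < τ.im →
      Δ τ = Complex.exp (2 * (Real.pi : ℂ) * I * τ) *
        ∏' n : ℕ, (1 - Complex.exp (2 * (Real.pi : ℂ) * I * ((n : ℂ) + 1) * τ)) ^ 24) :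
    Δ (3 * (1 / 2 + I * (Real.sqrt 3 : ℂ) / 6)) / Δ (1 / 2 + I * (Real.sqrt 3 : ℂ) / 6)
      = (3 : ℂ) ^ (-6 : ℤ) := by
  have hD : ∀ z : UpperHalfPlane, Δ z = ModularForm.discriminant z := by
    intro z
    rw [hΔ z z.im_pos, ModularForm.discriminant_eq_q_prod]
    simp only [ModularForm.eta_q_eq_cexp]
    simp [Function.Periodic.qParam]
  have hT : ∀ w : ℂ, 0 < w.im → Δ (w + 3) = Δ w := by
    intro w hw
    have key : ∀ m : ℕ, Complex.exp (2 * (Real.pi : ℂ) * I * (m : ℂ) * (w + 3))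
        = Complex.exp (2 * (Real.pi : ℂ) * I * (m : ℂ) * w) := by
      intro m
      rw [Complex.exp_eq_exp_iff_exists_int]
      exact ⟨3 * m, by push_cast; ring⟩
    rw [hΔ _ (by simpa using hw), hΔ w hw]
    have h1 := key 1
    have h2 : ∀ n : ℕ, _ := fun n => key (n + 1)
    push_cast at h1 h2
    rw [mul_one] at h1
    simp only [h1, h2]
  have hs : ((Real.sqrt 3 : ℝ) : ℂ) ^ 2 = 3 := by
    rw [← Complex.ofReal_pow, Real.sq_sqrt (by norm_num)]; norm_num
  have him : 0 < (1 / 2 + I * (Real.sqrt 3 : ℂ) / 6).im := by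
    have : (1 / 2 + I * (Real.sqrt 3 : ℂ) / 6) = ((1/2 : ℝ) : ℂ) + ((Real.sqrt 3 / 6 : ℝ) : ℂ) * I := by
      push_cast; ring
    rw [this]
    simp
  obtain ⟨s, hsdef⟩ : ∃ s : ℂ, s = (Real.sqrt 3 : ℂ) := ⟨_, rfl⟩
  rw [← hsdef] at hs him ⊢
  set t : ℂ := 1 / 2 + I * s / 6 with ht
  have ht2 : t ^ 2 = t - 1 / 3 := by
    rw [ht]; linear_combination (s ^ 2 / 36) * I_sq - hs / 36
  have ht12 : t ^ 12 = (3 : ℂ) ^ (-6 : ℤ) := by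
    have h3 : t ^ 3 = 2 / 3 * t - 1 / 3 := by linear_combination (t + 1) * ht2
    have h6 : t ^ 6 = -1 / 27 := by
      linear_combination (t ^ 3 + 2 / 3 * t - 1 / 3) * h3 + 4 / 9 * ht2
    have : t ^ 12 = (t ^ 6) ^ 2 := by ring
    rw [this, h6]; norm_num
  have ht0 : t ≠ 0 := fun h => by simp [h] at him
  have hinv : (-t)⁻¹ = 3 * t - 3 := by
    rw [inv_eq_iff_eq_inv]
    apply eq_inv_of_mul_eq_one_left
    linear_combination (-3) * ht2
  let z : UpperHalfPlane := ⟨t, him⟩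
  have hS := congrFun ModularForm.discriminant_S_invariant z
  rw [ModularForm.SL_slash_apply, UpperHalfPlane.modular_S_smul, ← hD, ← hD] at hS
  simp only [ModularGroup.denom_S] at hS
  have hz : (z : ℂ) = t := rfl
  have hS' : Δ (3 * t - 3) * t ^ (-12 : ℤ) = Δ t := by
    rw [← hinv]; exact hS
  have hne : Δ t ≠ 0 := by
    have := ModularForm.discriminant_ne_zero z
    rwa [← hD] at this
  have h3 : Δ (3 * t) = Δ (3 * t - 3) := by
    have := hT (3 * t - 3) (by simpa using him)
    rwa [sub_add_cancel] at this
  rw [h3, ← ht12, div_eq_iff hne, ← hS', zpow_neg]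
  have : t ^ (12 : ℤ) = t ^ 12 := by norm_cast
  rw [this]
  field_simp
end

section
/- Let E : ℕ → ℚ be the Euler (secant) numbers (E₀ = 1 and Σ_{j=0}^{k} C(2k,2j)·E_{2j} = 0 for k ≥ 1), and let η ∈ ℚ₂ be such that for some sequence (k_j) of positive integers with k_j → ∞ and ‖k_j + 1‖₂ → 0 the rationals E_{2k_j}/2 converge to η in ℚ₂ (i.e. η = L₂(2,χ), the 2-adic Catalan constant). Set θ = (8·log 2)/(4·log 2 + 2) = 1.1618804316… . Then for every ε > 0 there exist sequences of integers (p_n), (q_n) with q_n ≠ 0 for all n and |q_n| → ∞, such that for all sufficiently large n: 0 < ‖η − p_n/q_n‖₂ ≤ (max(|p_n|, |q_n|))^{−(θ − ε)}. In particular, η is not in the image of the canonical embedding ℚ → ℚ₂. -/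
section
open Polynomial

noncomputable def eulL (E : ℕ → ℚ) : ℚ[X] →ₗ[ℚ] ℚ :=
  Polynomial.lsum (fun n => if Even n then (E n) • LinearMap.id else 0)

lemma eulL_X_pow (E : ℕ → ℚ) (n : ℕ) : eulL E (X ^ n) = if Even n then E n else 0 := by
  rw [eulL, Polynomial.lsum_apply, ← monomial_one_right_eq_X_pow, sum_monomial_index]
  · split_ifs <;> simp
  · simp

lemma sum_even_only (f : ℕ → ℚ) (hf : ∀ k, f (2 * k + 1) = 0) (m : ℕ) :
    ∑ k ∈ Finset.range (2 * m + 1), f k = ∑ j ∈ Finset.range (m + 1), f (2 * j) := by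
  induction m with
  | zero => simp
  | succ m ih =>
    rw [show 2 * (m + 1) + 1 = 2 * m + 1 + 1 + 1 by ring, Finset.sum_range_succ,
      Finset.sum_range_succ, ih, hf, Finset.sum_range_succ _ (m + 1)]
    simp [mul_add]

lemma eulL_shift_X_pow (E : ℕ → ℚ) (hE0 : E 0 = 1)
    (hE : ∀ k : ℕ, 1 ≤ k →
      ∑ j ∈ Finset.range (k + 1), (Nat.choose (2 * k) (2 * j) : ℚ) * E (2 * j) = 0) (n : ℕ) :
    eulL E ((X + 1) ^ n) + eulL E ((X - 1) ^ n) = 2 * 0 ^ n := by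
  have h1 : ((X + 1 : ℚ[X]) ^ n) = ∑ k ∈ Finset.range (n + 1), (n.choose k : ℚ) • X ^ k := by
    rw [add_pow]; refine Finset.sum_congr rfl fun k _ => ?_
    rw [smul_eq_C_mul]; simp; ring
  have h2 : ((X - 1 : ℚ[X]) ^ n) =
      ∑ k ∈ Finset.range (n + 1), ((n.choose k : ℚ) * (-1) ^ (n - k)) • X ^ k := by
    rw [sub_eq_add_neg, add_pow]; refine Finset.sum_congr rfl fun k _ => ?_
    rw [smul_eq_C_mul]; simp; ring
  rw [h1, h2, map_sum, map_sum, ← Finset.sum_add_distrib]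
  simp only [map_smul, eulL_X_pow, smul_eq_mul]
  rcases Nat.even_or_odd' n with ⟨m, rfl | rfl⟩
  · rw [sum_even_only]
    · have : ∀ j ∈ Finset.range (m + 1), (((2 * m).choose (2 * j) : ℚ) *
          (if Even (2 * j) then E (2 * j) else 0) + ((2 * m).choose (2 * j) : ℚ) *
            (-1) ^ (2 * m - 2 * j) * (if Even (2 * j) then E (2 * j) else 0))
          = 2 * (((2 * m).choose (2 * j) : ℚ) * E (2 * j)) := by
        intro j hj
        have he : Even (2 * m - 2 * j) := by
          rw [← Nat.mul_sub]; exact even_two_mul _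
        rw [if_pos (even_two_mul j), he.neg_one_pow]; ring
      rw [Finset.sum_congr rfl this, ← Finset.mul_sum]
      rcases Nat.eq_zero_or_pos m with rfl | hm
      · simp [hE0]
      · rw [hE m hm]
        have : (2 * m) ≠ 0 := by omega
        simp [this]
    · intro k
      have : ¬ Even (2 * k + 1) := by simp
      simp [this]
  · rw [Finset.sum_eq_zero]
    · simp
    · intro k hk
      by_cases hke : Even k
      · have : Odd (2 * m + 1 - k) := by
          rw [Finset.mem_range] at hk
          exact Nat.Odd.sub_even (by omega) ⟨m, rfl⟩ hke
        rw [this.neg_one_pow]; ring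
      · simp [hke]

lemma eulL_shift (E : ℕ → ℚ) (hE0 : E 0 = 1)
    (hE : ∀ k : ℕ, 1 ≤ k →
      ∑ j ∈ Finset.range (k + 1), (Nat.choose (2 * k) (2 * j) : ℚ) * E (2 * j) = 0) (p : ℚ[X]) :
    eulL E (p.comp (X + 1)) + eulL E (p.comp (X - 1)) = 2 * p.eval 0 := by
  induction p using Polynomial.induction_on' with
  | add p q hp hq => simp only [add_comp, map_add, eval_add]; linarith
  | monomial n a =>
    rw [← smul_X_eq_monomial]
    simp only [smul_comp, X_pow_comp, map_smul, smul_eq_mul, eval_smul, eval_pow, eval_X]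
    have := eulL_shift_X_pow E hE0 hE n
    linear_combination a * this

/-- the functional on polynomials in `W`, with `W ^ m ↦ (2 m + 1) E (2 m)` -/
noncomputable def lamF (E : ℕ → ℚ) (p : ℚ[X]) : ℚ :=
  eulL E (derivative (X * p.comp (X ^ 2)))

lemma lamF_add (E : ℕ → ℚ) (p q : ℚ[X]) : lamF E (p + q) = lamF E p + lamF E q := by
  simp [lamF, mul_add]

lemma lamF_smul (E : ℕ → ℚ) (a : ℚ) (p : ℚ[X]) : lamF E (C a * p) = a * lamF E p := by
  rw [lamF, mul_comp, C_comp, show X * (C a * p.comp (X ^ 2)) = C a * (X * p.comp (X ^ 2)) by ring,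
    derivative_C_mul, ← smul_eq_C_mul, map_smul, smul_eq_mul, lamF]

lemma lamF_sum (E : ℕ → ℚ) {ι : Type*} (s : Finset ι) (f : ι → ℚ[X]) :
    lamF E (∑ i ∈ s, f i) = ∑ i ∈ s, lamF E (f i) := by
  classical
  induction s using Finset.induction_on with
  | empty => simp [lamF]
  | insert a s ha ih => rw [Finset.sum_insert ha, Finset.sum_insert ha, lamF_add, ih]

lemma lamF_X_pow (E : ℕ → ℚ) (m : ℕ) : lamF E (X ^ m) = (2 * m + 1) * E (2 * m) := by
  rw [lamF, X_pow_comp, ← pow_mul, ← pow_succ', derivative_X_pow, ← smul_eq_C_mul, map_smul]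
  simp [eulL_X_pow]

lemma prodG (k : ℕ) :
    (X * ∏ j ∈ Finset.range k, (X ^ 2 - C (4 * ((j : ℚ) + 1) ^ 2)) : ℚ[X]).comp (X + 1)
      = (X + C (2 * (k : ℚ) + 1)) * ∏ j ∈ Finset.range k, (X ^ 2 - C ((2 * (j : ℚ) + 1) ^ 2)) ∧
    (X * ∏ j ∈ Finset.range k, (X ^ 2 - C (4 * ((j : ℚ) + 1) ^ 2)) : ℚ[X]).comp (X - 1)
      = (X - C (2 * (k : ℚ) + 1)) * ∏ j ∈ Finset.range k, (X ^ 2 - C ((2 * (j : ℚ) + 1) ^ 2)) := by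
  induction k with
  | zero => simp
  | succ k ih =>
    obtain ⟨h1, h2⟩ := ih
    rw [Finset.prod_range_succ, ← mul_assoc, Finset.prod_range_succ,
      mul_comp (X * ∏ j ∈ Finset.range k, (X ^ 2 - C (4 * ((j : ℚ) + 1) ^ 2))) _ (X + 1),
      mul_comp (X * ∏ j ∈ Finset.range k, (X ^ 2 - C (4 * ((j : ℚ) + 1) ^ 2))) _ (X - 1), h1, h2]
    constructor
    · simp only [sub_comp, X_pow_comp, C_comp]
      simp only [map_mul, map_add, map_pow, map_natCast, map_one,
        map_ofNat, Nat.cast_succ]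
      ring
    · simp only [sub_comp, X_pow_comp, C_comp]
      simp only [map_mul, map_add, map_pow, map_natCast, map_one,
        map_ofNat, Nat.cast_succ]
      ring

lemma lamF_prod (E : ℕ → ℚ) (hE0 : E 0 = 1)
    (hE : ∀ k : ℕ, 1 ≤ k →
      ∑ j ∈ Finset.range (k + 1), (Nat.choose (2 * k) (2 * j) : ℚ) * E (2 * j) = 0) (k : ℕ) :
    lamF E (∏ j ∈ Finset.range k, (X - C ((2 * (j : ℚ) + 1) ^ 2))) = (-4) ^ k * (k.factorial : ℚ) ^ 2 := by
  set G : ℚ[X] := X * ∏ j ∈ Finset.range k, (X ^ 2 - C (4 * ((j : ℚ) + 1) ^ 2)) with hG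
  have h := eulL_shift E hE0 hE (derivative G)
  obtain ⟨h1, h2⟩ := prodG k
  rw [← hG] at h1 h2
  have d1 : (derivative G).comp (X + 1) = derivative (G.comp (X + 1)) := by
    rw [derivative_comp]; simp
  have d2 : (derivative G).comp (X - 1) = derivative (G.comp (X - 1)) := by
    rw [derivative_comp]; simp
  rw [d1, d2, h1, h2, ← map_add, ← map_add] at h
  have h3 : lamF E (∏ j ∈ Finset.range k, (X - C ((2 * (j : ℚ) + 1) ^ 2))) =
      eulL E (derivative (X * ∏ j ∈ Finset.range k, (X ^ 2 - C ((2 * (j : ℚ) + 1) ^ 2)))) := by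
    rw [lamF, prod_comp]; simp
  rw [show (X + C (2 * (k : ℚ) + 1)) * ∏ j ∈ Finset.range k, (X ^ 2 - C ((2 * (j : ℚ) + 1) ^ 2)) +
      (X - C (2 * (k : ℚ) + 1)) * ∏ j ∈ Finset.range k, (X ^ 2 - C ((2 * (j : ℚ) + 1) ^ 2)) =
      C 2 * (X * ∏ j ∈ Finset.range k, (X ^ 2 - C ((2 * (j : ℚ) + 1) ^ 2))) by
        rw [show (C 2 : ℚ[X]) = 2 from rfl]; ring, derivative_C_mul, ← smul_eq_C_mul, map_smul, ← h3] at h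
  have h4 : (derivative G).eval 0 = (-4) ^ k * (k.factorial : ℚ) ^ 2 := by
    rw [hG, derivative_mul]
    simp [eval_prod]
    clear * -
    induction k with
    | zero => simp
    | succ k ih =>
      rw [Finset.prod_range_succ, ih, Nat.factorial_succ]; push_cast; ring
  rw [h4, smul_eq_mul] at h
  linarith

/-- Newton basis, in the variable `U = (W - 1) / 4` -/
noncomputable def newt (k : ℕ) : ℚ[X] :=
  ∏ j ∈ Finset.range k, (C (1 / 4) * (X - 1) - C ((j : ℚ) * (j + 1)))

noncomputable def polU : ℚ[X] := C (1 / 4) * (X - 1)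

lemma newt_succ (k : ℕ) : newt (k + 1) = newt k * (polU - C ((k : ℚ) * (k + 1))) := by
  rw [newt, Finset.prod_range_succ]; rfl

lemma X_eq_polU : (X : ℚ[X]) = 1 + C 4 * polU := by
  rw [polU, ← mul_assoc, ← C_mul]; norm_num

lemma lamF_newt (E : ℕ → ℚ) (hE0 : E 0 = 1)
    (hE : ∀ k : ℕ, 1 ≤ k →
      ∑ j ∈ Finset.range (k + 1), (Nat.choose (2 * k) (2 * j) : ℚ) * E (2 * j) = 0) (k : ℕ) :
    lamF E (newt k) = (-1) ^ k * (k.factorial : ℚ) ^ 2 := by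
  have : newt k = C ((1 / 4) ^ k) * ∏ j ∈ Finset.range k, (X - C ((2 * (j : ℚ) + 1) ^ 2)) := by
    rw [newt, map_pow]
    conv_rhs => rw [← Finset.card_range k, ← Finset.prod_const, Finset.card_range,
      ← Finset.prod_mul_distrib]
    refine Finset.prod_congr rfl fun j _ => ?_
    rw [mul_sub, mul_sub (C (1 / 4) : ℚ[X]) X (C _), ← C_mul, sub_sub, mul_one, ← C_add]
    congr 2; ring
  rw [this, lamF_smul, lamF_prod E hE0 hE, ← mul_assoc, ← mul_pow]; norm_num

lemma lamF_int (E : ℕ → ℚ) (hE0 : E 0 = 1)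
    (hE : ∀ k : ℕ, 1 ≤ k →
      ∑ j ∈ Finset.range (k + 1), (Nat.choose (2 * k) (2 * j) : ℚ) * E (2 * j) = 0) (i : ℕ) :
    ∀ k, ∃ z : ℤ, lamF E (polU ^ i * newt k) = z := by
  induction i with
  | zero => intro k; refine ⟨(-1) ^ k * (k.factorial : ℤ) ^ 2, ?_⟩
            rw [pow_zero, one_mul, lamF_newt E hE0 hE]; push_cast; rfl
  | succ i ih =>
    intro k
    obtain ⟨z1, h1⟩ := ih (k + 1)
    obtain ⟨z2, h2⟩ := ih k
    refine ⟨z1 + k * (k + 1) * z2, ?_⟩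
    have : polU ^ (i + 1) * newt k = polU ^ i * newt (k + 1) +
        C ((k : ℚ) * (k + 1)) * (polU ^ i * newt k) := by
      rw [newt_succ]; ring
    rw [this, lamF_add, lamF_smul, h1, h2]; push_cast; ring
open Polynomial

noncomputable def oddP (k : ℕ) : ℚ := ∏ j ∈ Finset.range k, (2 * (j : ℚ) + 1) ^ 2

lemma oddP_pos (k : ℕ) : 0 < oddP k := Finset.prod_pos fun j _ => by positivity

lemma oddP_succ (k : ℕ) : oddP (k + 1) = oddP k * (2 * (k : ℚ) + 1) ^ 2 := by
  rw [oddP, Finset.prod_range_succ]; rfl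

lemma norm_odd (j : ℕ) : ‖(2 * (j : ℚ_[2]) + 1)‖ = 1 := by
  have := (Padic.norm_natCast_eq_one_iff (p := 2) (n := 2 * j + 1)).2 (by simp)
  push_cast at this; exact this

lemma norm_oddP (k : ℕ) : ‖((oddP k : ℚ) : ℚ_[2])‖ = 1 := by
  rw [oddP]; push_cast
  rw [norm_prod]
  exact Finset.prod_eq_one fun j _ => by rw [norm_pow, norm_odd, one_pow]

lemma norm_four : ‖(4 : ℚ_[2])‖ = 1 / 4 := by
  have h := Padic.norm_p (p := 2)
  rw [show (4 : ℚ_[2]) = ((2 : ℕ) : ℚ_[2]) * ((2 : ℕ) : ℚ_[2]) by norm_num, norm_mul, h]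
  norm_num

lemma norm_two : ‖(2 : ℚ_[2])‖ = 1 / 2 := by
  have h := Padic.norm_p (p := 2)
  push_cast at h; rw [h]; norm_num

lemma norm_nat_le_one (n : ℕ) : ‖(n : ℚ_[2])‖ ≤ 1 := by
  have := Padic.norm_int_le_one (p := 2) n
  simpa using this

lemma norm_int_ge (z : ℤ) (hz : z ≠ 0) : 1 / |(z : ℝ)| ≤ ‖(z : ℚ_[2])‖ := by
  have hz' : (z : ℚ_[2]) ≠ 0 := by exact_mod_cast hz
  rw [Padic.norm_eq_zpow_neg_valuation hz', Padic.valuation_intCast, zpow_neg, ← one_div]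
  refine one_div_le_one_div_of_le (by positivity) ?_
  have h1 : ((2 : ℕ) : ℤ) ^ padicValInt 2 z ∣ z := padicValInt_dvd z
  have h2 := Int.le_of_dvd (abs_pos.2 hz) ((dvd_abs _ _).2 h1)
  rw [zpow_natCast]
  exact_mod_cast h2

lemma norm_four_pow_le (i : ℕ) (hi : 1 ≤ i) : ‖(4 : ℚ_[2]) ^ i‖ ≤ ‖(i : ℚ_[2])‖ := by
  have h := norm_int_ge i (by exact_mod_cast Nat.one_le_iff_ne_zero.1 hi)
  push_cast at h
  refine le_trans ?_ h
  rw [norm_pow, norm_four, one_div_pow]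
  have hi0 : (0 : ℝ) < i := by exact_mod_cast hi
  rw [abs_of_pos hi0]
  refine one_div_le_one_div_of_le hi0 ?_
  exact_mod_cast (Nat.lt_pow_self (by norm_num : 1 < 4)).le

lemma norm_choose_four (m i : ℕ) (hi : 1 ≤ i) :
    ‖((m + 1).choose i : ℚ_[2]) * 4 ^ i‖ ≤ ‖(m : ℚ_[2]) + 1‖ := by
  obtain ⟨i, rfl⟩ : ∃ l, i = l + 1 := ⟨i - 1, by omega⟩
  have h := Nat.add_one_mul_choose_eq m i
  have h' : ((m : ℚ_[2]) + 1) * (m.choose i) = ((m + 1).choose (i + 1)) * ((i + 1 : ℕ) : ℚ_[2]) := by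
    exact_mod_cast h
  have h4 := norm_four_pow_le (i + 1) hi
  rw [norm_mul]
  calc _ ≤ ‖((m + 1).choose (i + 1) : ℚ_[2])‖ * ‖((i + 1 : ℕ) : ℚ_[2])‖ := by gcongr
    _ = ‖(m : ℚ_[2]) + 1‖ * ‖(m.choose i : ℚ_[2])‖ := by rw [← norm_mul, ← h', norm_mul]
    _ ≤ ‖(m : ℚ_[2]) + 1‖ * 1 := by gcongr; exact norm_nat_le_one _
    _ = _ := mul_one _

lemma X_pow_expand (n : ℕ) : (X : ℚ[X]) ^ n =
    ∑ i ∈ Finset.range (n + 1), C ((n.choose i : ℚ) * 4 ^ i) * polU ^ i := by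
  conv_lhs => rw [X_eq_polU, add_comm, add_pow]
  refine Finset.sum_congr rfl fun i _ => ?_
  rw [mul_pow, C_mul, C_pow]; simp; ring

lemma lamF_newt_X_pow (E : ℕ → ℚ) (k n : ℕ) : lamF E (newt k * X ^ n) =
    ∑ i ∈ Finset.range (n + 1), ((n.choose i : ℚ) * 4 ^ i) * lamF E (polU ^ i * newt k) := by
  rw [X_pow_expand, Finset.mul_sum, lamF_sum]
  refine Finset.sum_congr rfl fun i _ => ?_
  rw [← lamF_smul]; congr 1; ring


lemma norm_lamF_basis (E : ℕ → ℚ) (hE0 : E 0 = 1)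
    (hE : ∀ k : ℕ, 1 ≤ k →
      ∑ j ∈ Finset.range (k + 1), (Nat.choose (2 * k) (2 * j) : ℚ) * E (2 * j) = 0)
    (i k : ℕ) : ‖((lamF E (polU ^ i * newt k) : ℚ) : ℚ_[2])‖ ≤ 1 := by
  obtain ⟨z, hz⟩ := lamF_int E hE0 hE i k
  rw [hz]; simpa using Padic.norm_int_le_one (p := 2) z

lemma norm_lamF_le_one (E : ℕ → ℚ) (hE0 : E 0 = 1)
    (hE : ∀ k : ℕ, 1 ≤ k →
      ∑ j ∈ Finset.range (k + 1), (Nat.choose (2 * k) (2 * j) : ℚ) * E (2 * j) = 0)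
    (n k : ℕ) : ‖((lamF E (newt k * X ^ n) : ℚ) : ℚ_[2])‖ ≤ 1 := by
  rw [lamF_newt_X_pow]; push_cast
  refine IsUltrametricDist.norm_sum_le_of_forall_le_of_nonneg zero_le_one fun i _ => ?_
  rw [norm_mul, norm_mul, norm_pow, norm_four]
  have h1 := norm_nat_le_one (n.choose i)
  have h2 := norm_lamF_basis E hE0 hE i k
  have h3 : (1 / 4 : ℝ) ^ i ≤ 1 := pow_le_one₀ (by norm_num) (by norm_num)
  refine mul_le_one₀ (mul_le_one₀ h1 (by positivity) h3) (norm_nonneg _) h2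

lemma norm_lamF_sub (E : ℕ → ℚ) (hE0 : E 0 = 1)
    (hE : ∀ k : ℕ, 1 ≤ k →
      ∑ j ∈ Finset.range (k + 1), (Nat.choose (2 * k) (2 * j) : ℚ) * E (2 * j) = 0)
    (m k : ℕ) :
    ‖((lamF E (newt k * X ^ (m + 1)) : ℚ) : ℚ_[2]) - ((lamF E (newt k) : ℚ) : ℚ_[2])‖
      ≤ ‖(m : ℚ_[2]) + 1‖ := by
  rw [lamF_newt_X_pow, Finset.sum_range_succ']
  push_cast
  simp only [Nat.choose_zero_right, Nat.cast_one, pow_zero, one_mul, add_sub_cancel_right]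
  refine IsUltrametricDist.norm_sum_le_of_forall_le_of_nonneg (norm_nonneg _) fun i _ => ?_
  rw [norm_mul]
  have h1 := norm_choose_four m (i + 1) (by omega)
  have h2 := norm_lamF_basis E hE0 hE (i + 1) k
  calc _ ≤ ‖(m : ℚ_[2]) + 1‖ * 1 := by gcongr
    _ = _ := mul_one _

noncomputable def gq (k : ℕ) : ℚ := (-4) ^ k / oddP (k + 1)
noncomputable def cq (k : ℕ) : ℚ := (-4) ^ k / oddP k
noncomputable def wq (k : ℕ) : ℚ := 4 ^ k * (k.factorial : ℚ) ^ 2 / oddP (k + 1)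

lemma newton_ident (M : ℕ) :
    (1 : ℚ[X]) = X * ∑ k ∈ Finset.range M, C (gq k) * newt k + C (cq M) * newt M := by
  induction M with
  | zero => simp [cq, newt, oddP]
  | succ M ih =>
    rw [Finset.sum_range_succ, newt_succ]
    conv_lhs => rw [ih]
    have h1 : cq M = gq M * (2 * M + 1) ^ 2 := by
      rw [cq, gq, oddP_succ]; have := (oddP_pos M).ne'
      have : (2 * (M : ℚ) + 1) ≠ 0 := by positivity
      field_simp
    have h2 : cq (M + 1) = -4 * gq M := by
      rw [cq, gq]; ring
    have h3 : (X : ℚ[X]) = 1 + 4 * polU := X_eq_polU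
    rw [h1, h2]
    simp only [map_mul, map_add, map_pow, map_neg, map_natCast, map_one, map_ofNat]
    linear_combination (- C (gq M) * newt M) * h3


lemma norm_lamF_partial (E : ℕ → ℚ) (hE0 : E 0 = 1)
    (hE : ∀ k : ℕ, 1 ≤ k →
      ∑ j ∈ Finset.range (k + 1), (Nat.choose (2 * k) (2 * j) : ℚ) * E (2 * j) = 0)
    (m M : ℕ) :
    ‖(((2 * m + 1) * E (2 * m) : ℚ) : ℚ_[2]) - ∑ k ∈ Finset.range M, ((wq k : ℚ) : ℚ_[2])‖
      ≤ max ‖(m : ℚ_[2]) + 1‖ ((1 / 4) ^ M) := by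
  have h1 : lamF E (X ^ m) = ∑ k ∈ Finset.range M, gq k * lamF E (newt k * X ^ (m + 1)) +
      cq M * lamF E (newt M * X ^ m) := by
    have : (X : ℚ[X]) ^ m = ∑ k ∈ Finset.range M, C (gq k) * (newt k * X ^ (m + 1)) +
        C (cq M) * (newt M * X ^ m) := by
      have h0 : ∑ k ∈ Finset.range M, C (gq k) * (newt k * X ^ (m + 1)) =
          X ^ (m + 1) * ∑ k ∈ Finset.range M, C (gq k) * newt k := by
        rw [Finset.mul_sum]; refine Finset.sum_congr rfl fun k _ => by ring
      rw [h0]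
      linear_combination (X ^ m) * newton_ident M
    conv_lhs => rw [this, lamF_add, lamF_sum, lamF_smul]
    simp only [lamF_smul]
  have h2 : ∀ k, wq k = gq k * lamF E (newt k) := by
    intro k
    rw [lamF_newt E hE0 hE, wq, gq, neg_pow]
    have : ((-1 : ℚ) ^ k) * (-1) ^ k = 1 := by rw [← mul_pow]; norm_num
    linear_combination (-(4 ^ k * (k.factorial : ℚ) ^ 2 / oddP (k + 1))) * this
  rw [lamF_X_pow] at h1
  rw [h1]
  simp only [h2]
  push_cast
  rw [add_sub_right_comm, ← Finset.sum_sub_distrib]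
  refine (IsUltrametricDist.norm_add_le_max _ _).trans (max_le_max ?_ ?_)
  · refine IsUltrametricDist.norm_sum_le_of_forall_le_of_nonneg (norm_nonneg _) fun k _ => ?_
    rw [← mul_sub, norm_mul]
    have h3 : ‖((gq k : ℚ) : ℚ_[2])‖ ≤ 1 := by
      rw [gq]; push_cast; rw [norm_div, norm_oddP, norm_pow, norm_neg, norm_four, div_one]
      exact pow_le_one₀ (by norm_num) (by norm_num)
    calc _ ≤ 1 * ‖(m : ℚ_[2]) + 1‖ := by
          gcongr; exact norm_lamF_sub E hE0 hE m k
      _ = _ := one_mul _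
  · rw [norm_mul]
    have h3 : ‖((cq M : ℚ) : ℚ_[2])‖ = (1 / 4) ^ M := by
      rw [cq]; push_cast; rw [norm_div, norm_oddP, norm_pow, norm_neg, norm_four, div_one]
    rw [h3]
    calc _ ≤ (1 / 4 : ℝ) ^ M * 1 := by gcongr; exact norm_lamF_le_one E hE0 hE m M
      _ = _ := mul_one _

lemma norm_wq (k : ℕ) : ‖((wq k : ℚ) : ℚ_[2])‖ = (1 / 4) ^ k * ‖(k.factorial : ℚ_[2])‖ ^ 2 := by
  rw [wq]; push_cast
  rw [norm_div, norm_oddP, norm_mul, norm_pow, norm_pow, norm_four, div_one]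

lemma norm_wq_le (k : ℕ) : ‖((wq k : ℚ) : ℚ_[2])‖ ≤ (1 / 4) ^ k := by
  rw [norm_wq]
  have := norm_nat_le_one k.factorial
  have h : ‖(k.factorial : ℚ_[2])‖ ^ 2 ≤ 1 := pow_le_one₀ (norm_nonneg _) this
  calc _ ≤ (1 / 4 : ℝ) ^ k * 1 := by gcongr
    _ = _ := mul_one _

lemma summable_wq_mul (f : ℕ → ℕ) : Summable fun k => (f k : ℚ_[2]) * ((wq k : ℚ) : ℚ_[2]) := by
  refine Summable.of_norm_bounded (g := fun k => (1 / 4 : ℝ) ^ k)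
    (summable_geometric_of_lt_one (by norm_num) (by norm_num)) fun k => ?_
  rw [norm_mul]
  calc _ ≤ 1 * (1 / 4 : ℝ) ^ k := by
        gcongr; exacts [norm_nat_le_one _, norm_wq_le k]
    _ = _ := one_mul _

lemma summable_wq : Summable fun k => ((wq k : ℚ) : ℚ_[2]) := by
  simpa using summable_wq_mul (fun _ => 1)

noncomputable def catS : ℚ_[2] := ∑' k, ((wq k : ℚ) : ℚ_[2])

lemma norm_lamF_catS (E : ℕ → ℚ) (hE0 : E 0 = 1)
    (hE : ∀ k : ℕ, 1 ≤ k →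
      ∑ j ∈ Finset.range (k + 1), (Nat.choose (2 * k) (2 * j) : ℚ) * E (2 * j) = 0) (m : ℕ) :
    ‖(((2 * m + 1) * E (2 * m) : ℚ) : ℚ_[2]) - catS‖ ≤ ‖(m : ℚ_[2]) + 1‖ := by
  have h1 : Filter.Tendsto (fun M => ‖(((2 * m + 1) * E (2 * m) : ℚ) : ℚ_[2]) -
      ∑ k ∈ Finset.range M, ((wq k : ℚ) : ℚ_[2])‖) Filter.atTop
      (nhds ‖(((2 * m + 1) * E (2 * m) : ℚ) : ℚ_[2]) - catS‖) :=
    (tendsto_const_nhds.sub summable_wq.hasSum.tendsto_sum_nat).norm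
  have h2 : Filter.Tendsto (fun M : ℕ => max ‖(m : ℚ_[2]) + 1‖ ((1 / 4 : ℝ) ^ M)) Filter.atTop
      (nhds (max ‖(m : ℚ_[2]) + 1‖ 0)) :=
    tendsto_const_nhds.max (tendsto_pow_atTop_nhds_zero_of_lt_one (by norm_num) (by norm_num))
  have h3 := le_of_tendsto_of_tendsto' h1 h2 (norm_lamF_partial E hE0 hE m)
  rwa [max_eq_left (norm_nonneg _)] at h3

lemma catS_eq (E : ℕ → ℚ) (hE0 : E 0 = 1)
    (hE : ∀ k : ℕ, 1 ≤ k →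
      ∑ j ∈ Finset.range (k + 1), (Nat.choose (2 * k) (2 * j) : ℚ) * E (2 * j) = 0)
    (η : ℚ_[2])
    (hη : ∃ k : ℕ → ℕ, (∀ j, 0 < k j) ∧
      Filter.Tendsto (fun j => (k j : ℝ)) Filter.atTop Filter.atTop ∧
      Filter.Tendsto (fun j => ‖(k j : ℚ_[2]) + 1‖) Filter.atTop (nhds 0) ∧
      Filter.Tendsto (fun j => ((E (2 * k j) / 2 : ℚ) : ℚ_[2])) Filter.atTop (nhds η)) :
    η = - catS / 2 := by
  obtain ⟨k, -, -, h1, h2⟩ := hη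
  have h3 : Filter.Tendsto (fun j => (((2 * k j + 1) * E (2 * k j) : ℚ) : ℚ_[2])) Filter.atTop
      (nhds catS) := by
    rw [tendsto_iff_norm_sub_tendsto_zero]
    exact squeeze_zero (fun _ => norm_nonneg _) (fun j => norm_lamF_catS E hE0 hE (k j)) h1
  have h4 : Filter.Tendsto (fun j => (k j : ℚ_[2]) + 1) Filter.atTop (nhds 0) :=
    tendsto_zero_iff_norm_tendsto_zero.2 h1
  have h5 : Filter.Tendsto (fun j => (2 * ((k j : ℚ_[2]) + 1) - 1) *
      (2 * ((E (2 * k j) / 2 : ℚ) : ℚ_[2]))) Filter.atTop (nhds ((2 * 0 - 1) * (2 * η))) :=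
    ((h4.const_mul 2).sub_const 1).mul (h2.const_mul 2)
  have h6 : catS = (2 * 0 - 1) * (2 * η) := by
    refine tendsto_nhds_unique h3 (h5.congr fun j => ?_)
    push_cast; ring
  rw [h6]; ring

end


noncomputable def alq (k : ℕ) : ℚ := oddP k / (4 ^ k * (k.factorial : ℚ) ^ 2)
noncomputable def sqs (k : ℕ) : ℚ := ∑ j ∈ Finset.range k, wq j

lemma alq_pos (k : ℕ) : 0 < alq k := by
  have := oddP_pos k
  have := Nat.factorial_pos k
  unfold alq; positivity

lemma alq_succ (k : ℕ) : (2 * (k : ℚ) + 2) ^ 2 * alq (k + 1) = (2 * k + 1) ^ 2 * alq k := by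
  rw [alq, alq, oddP_succ, Nat.factorial_succ]; push_cast
  have : (k.factorial : ℚ) ≠ 0 := by exact_mod_cast (Nat.factorial_pos k).ne'
  have : (k : ℚ) + 1 ≠ 0 := by positivity
  field_simp; ring

lemma alq_mul_wq (k : ℕ) : (2 * (k : ℚ) + 1) ^ 2 * (alq k * wq k) = 1 := by
  rw [alq, wq, oddP_succ]
  have : (k.factorial : ℚ) ≠ 0 := by exact_mod_cast (Nat.factorial_pos k).ne'
  have : (2 * k : ℚ) + 1 ≠ 0 := by positivity
  have := (oddP_pos k).ne'
  field_simp

lemma wq_succ (m : ℕ) : (2 * (m : ℚ) + 3) ^ 2 * wq (m + 1) = 4 * (m + 1) ^ 2 * wq m := by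
  rw [wq, wq, oddP_succ (m + 1), Nat.factorial_succ]; push_cast
  have : (2 * m : ℚ) + 3 ≠ 0 := by positivity
  have : (2 * ((m : ℚ) + 1)) + 1 ≠ 0 := by positivity
  have := (oddP_pos (m + 1)).ne'
  field_simp; ring

lemma tele (k M : ℕ) :
    ∑ m ∈ Finset.range M, ((2 * (k : ℚ) + 2) ^ 2 * ((k + 1 + m).choose (k + 1) * wq m) -
      (2 * k + 1) ^ 2 * ((k + m).choose k * wq m)) =
      (2 * M + 1) ^ 2 * ((k + M).choose k * wq M) - 1 := by
  induction M with
  | zero => simp [wq, oddP]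
  | succ M ih =>
    rw [Finset.sum_range_succ, ih]
    have h1 : ((k + 1 + M).choose (k + 1) : ℚ) * (k + 1) = (k + M + 1) * (k + M).choose k := by
      have := Nat.add_one_mul_choose_eq (k + M) k
      rw [show k + 1 + M = k + M + 1 by ring]
      exact_mod_cast this.symm
    have h2 : ((k + (M + 1)).choose k : ℚ) * (M + 1) = (k + M + 1) * (k + M).choose k := by
      have := Nat.add_one_mul_choose_eq (k + M) M
      have e1 : (k + M).choose M = (k + M).choose k := by
        rw [← Nat.choose_symm_add]
      have e2 : (k + M + 1).choose (M + 1) = (k + (M + 1)).choose k := by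
        rw [show k + M + 1 = k + (M + 1) by ring, ← Nat.choose_symm_add]
      rw [e1, e2] at this
      exact_mod_cast this.symm
    have h3 := wq_succ M
    push_cast
    linear_combination (4 * (k + 1) * wq M) * h1 - ((k + (M + 1)).choose k : ℚ) * h3 -
      4 * (M + 1) * wq M * h2

noncomputable def tk (k : ℕ) : ℚ_[2] := ∑' m, ((k + m).choose k : ℚ_[2]) * ((wq m : ℚ) : ℚ_[2])

lemma tk_rec (k : ℕ) :
    (2 * (k : ℚ_[2]) + 2) ^ 2 * tk (k + 1) = (2 * k + 1) ^ 2 * tk k - 1 := by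
  have s1 := (summable_wq_mul (fun m => (k + 1 + m).choose (k + 1))).hasSum.mul_left
    ((2 * (k : ℚ_[2]) + 2) ^ 2)
  have s2 := (summable_wq_mul (fun m => (k + m).choose k)).hasSum.mul_left
    ((2 * (k : ℚ_[2]) + 1) ^ 2)
  have s3 := (s1.sub s2).tendsto_sum_nat
  have e : ∀ M, ∑ m ∈ Finset.range M, ((2 * (k : ℚ_[2]) + 2) ^ 2 *
      (((k + 1 + m).choose (k + 1) : ℕ) * ((wq m : ℚ) : ℚ_[2])) -
      (2 * (k : ℚ_[2]) + 1) ^ 2 * (((k + m).choose k : ℕ) * ((wq m : ℚ) : ℚ_[2]))) =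
      (2 * M + 1) ^ 2 * (((k + M).choose k : ℕ) * ((wq M : ℚ) : ℚ_[2])) - 1 := by
    intro M
    have := congrArg (fun q : ℚ => (q : ℚ_[2])) (tele k M)
    push_cast at this
    exact this
  have h0 : Filter.Tendsto (fun M : ℕ => (2 * (M : ℚ_[2]) + 1) ^ 2 *
      (((k + M).choose k : ℕ) * ((wq M : ℚ) : ℚ_[2]))) Filter.atTop (nhds 0) := by
    rw [tendsto_zero_iff_norm_tendsto_zero]
    refine squeeze_zero (fun _ => norm_nonneg _) (fun M => ?_)
      (tendsto_pow_atTop_nhds_zero_of_lt_one (r := (1 / 4 : ℝ)) (by norm_num) (by norm_num))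
    rw [norm_mul, norm_pow, norm_odd, norm_mul, one_pow, one_mul]
    calc _ ≤ 1 * (1 / 4 : ℝ) ^ M := by
          gcongr; exacts [norm_nat_le_one _, norm_wq_le M]
      _ = _ := one_mul _
  have h1 := h0.sub_const 1
  have h2 := tendsto_nhds_unique s3 (h1.congr fun M => (e M).symm)
  have h3 : (2 * (k : ℚ_[2]) + 2) ^ 2 * tk (k + 1) - (2 * k + 1) ^ 2 * tk k = 0 - 1 := h2
  linear_combination h3

lemma tk_eq (k : ℕ) : tk k = ((alq k : ℚ) : ℚ_[2]) * (catS - ((sqs k : ℚ) : ℚ_[2])) := by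
  induction k with
  | zero => simp [tk, alq, sqs, catS, oddP]
  | succ k ih =>
    have h := tk_rec k
    have hne : (2 * (k : ℚ_[2]) + 2) ^ 2 ≠ 0 := by
      have : ((2 * (k : ℕ) + 2 : ℕ) : ℚ_[2]) ≠ 0 := by
        rw [Nat.cast_ne_zero]; omega
      push_cast at this
      exact pow_ne_zero _ this
    apply mul_left_cancel₀ hne
    rw [h, ih]
    have h1 := congrArg (fun q : ℚ => (q : ℚ_[2])) (alq_succ k)
    have h2 := congrArg (fun q : ℚ => (q : ℚ_[2])) (alq_mul_wq k)
    have h3 : sqs (k + 1) = sqs k + wq k := by rw [sqs, Finset.sum_range_succ]; rfl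
    rw [h3]
    push_cast at h1 h2 ⊢
    linear_combination (-(catS - ((sqs k : ℚ) : ℚ_[2]) - ((wq k : ℚ) : ℚ_[2]))) * h1 + h2

lemma altsum (n : ℕ) : ∀ a m : ℕ, ∑ k ∈ Finset.range (n + 1),
    (-1 : ℤ) ^ k * (n.choose k) * ((a + k).choose m) =
      (-1) ^ n * (if n ≤ m then (a.choose (m - n) : ℤ) else 0) := by
  induction n with
  | zero => intro a m; simp
  | succ n ih =>
    intro a m
    have hrec : ∑ k ∈ Finset.range (n + 1 + 1), (-1 : ℤ) ^ k * ((n + 1).choose k) * ((a + k).choose m)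
      = ∑ k ∈ Finset.range (n + 1), (-1 : ℤ) ^ k * (n.choose k) * ((a + k).choose m) -
        ∑ k ∈ Finset.range (n + 1), (-1 : ℤ) ^ k * (n.choose k) * ((a + 1 + k).choose m) := by
      rw [Finset.sum_range_succ']
      have : ∑ k ∈ Finset.range (n + 1), (-1 : ℤ) ^ k * (n.choose k) * ((a + k).choose m) =
          ∑ k ∈ Finset.range (n + 1), (-1 : ℤ) ^ (k + 1) * (n.choose (k + 1)) *
            ((a + (k + 1)).choose m) + (-1 : ℤ) ^ 0 * (n.choose 0) * ((a + 0).choose m) := by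
        rw [← Finset.sum_range_succ' (fun k => (-1 : ℤ) ^ k * (n.choose k) * ((a + k).choose m)),
          Finset.sum_range_succ _ (n + 1)]
        simp
      rw [this, add_sub_right_comm, ← Finset.sum_sub_distrib]
      congr 1
      · refine Finset.sum_congr rfl fun k _ => ?_
        rw [Nat.choose_succ_succ, show a + (k + 1) = a + 1 + k by ring]; push_cast; ring
      · simp
    rw [hrec, ih, ih]
    rcases m with _ | m
    · rcases n with _ | n <;> simp
    · rcases Nat.lt_or_ge m n with h | h
      · by_cases h' : n = m + 1
        · subst h'; simp
        · rw [if_neg (by omega), if_neg (by omega), if_neg (by omega)]; simp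
      · rw [if_pos (by omega), if_pos (by omega), if_pos (by omega),
          show m + 1 - n = (m - n) + 1 by omega, show m + 1 - (n + 1) = m - n by omega,
          Nat.choose_succ_succ]
        push_cast; ring

lemma altsum' (n m : ℕ) : ∑ k ∈ Finset.range (n + 1),
    (-1 : ℤ) ^ k * (n.choose k) * ((k + m).choose k) = (-1) ^ n * (m.choose n) := by
  have h := altsum n m m
  have : ∀ k, (k + m).choose k = (m + k).choose m := by
    intro k; rw [add_comm, Nat.choose_symm_add]
  simp only [this]
  rw [h]
  split_ifs with h1
  · rw [Nat.choose_symm h1]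
  · rw [Nat.choose_eq_zero_of_lt (by omega)]; simp

noncomputable def cn (n : ℕ) : ℚ := ∑ k ∈ Finset.range (n + 1), (-1 : ℚ) ^ k * (n.choose k) * alq k
noncomputable def en (n : ℕ) : ℚ :=
  ∑ k ∈ Finset.range (n + 1), (-1 : ℚ) ^ k * (n.choose k) * (alq k * sqs k)

noncomputable def Rn (n : ℕ) : ℚ_[2] := ∑' m, (m.choose n : ℚ_[2]) * ((wq m : ℚ) : ℚ_[2])

lemma Rn_eq (n : ℕ) : (cn n : ℚ_[2]) * catS - (en n : ℚ_[2]) = (-1) ^ n * Rn n := by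
  have h1 : (cn n : ℚ_[2]) * catS - (en n : ℚ_[2]) =
      ∑ k ∈ Finset.range (n + 1), (-1) ^ k * (n.choose k) * tk k := by
    simp only [tk_eq]
    rw [cn, en]; push_cast
    rw [Finset.sum_mul, ← Finset.sum_sub_distrib]
    refine Finset.sum_congr rfl fun k _ => by ring
  rw [h1]
  have h2 : HasSum (fun m => ∑ k ∈ Finset.range (n + 1), (-1 : ℚ_[2]) ^ k * (n.choose k) *
      (((k + m).choose k : ℕ) * ((wq m : ℚ) : ℚ_[2])))
      (∑ k ∈ Finset.range (n + 1), (-1) ^ k * (n.choose k) * tk k) :=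
    hasSum_sum fun k _ => (summable_wq_mul (fun m => (k + m).choose k)).hasSum.mul_left _
  have h3 : HasSum (fun m => (-1) ^ n * ((m.choose n : ℚ_[2]) * ((wq m : ℚ) : ℚ_[2])))
    ((-1) ^ n * Rn n) := (summable_wq_mul (fun m => m.choose n)).hasSum.mul_left _
  refine h2.unique (h3.congr_fun ?_)
  intro m
  have := congrArg (fun z : ℤ => (z : ℚ_[2])) (altsum' n m)
  push_cast at this
  rw [← mul_assoc, ← this, Finset.sum_mul]
  refine Finset.sum_congr rfl fun k _ => by ring

lemma norm_fact_anti {n m : ℕ} (h : n ≤ m) : ‖(m.factorial : ℚ_[2])‖ ≤ ‖(n.factorial : ℚ_[2])‖ := by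
  obtain ⟨c, hc⟩ := Nat.factorial_dvd_factorial h
  rw [hc]; push_cast; rw [norm_mul]
  calc _ ≤ ‖(n.factorial : ℚ_[2])‖ * 1 := by gcongr; exact norm_nat_le_one c
    _ = _ := mul_one _

lemma norm_fact_pos (n : ℕ) : 0 < ‖(n.factorial : ℚ_[2])‖ := by
  rw [norm_pos_iff, Nat.cast_ne_zero]; exact (Nat.factorial_pos n).ne'

lemma norm_add_eq_left {x y : ℚ_[2]} (h : ‖y‖ < ‖x‖) : ‖x + y‖ = ‖x‖ := by
  rw [IsUltrametricDist.norm_add_eq_max_of_norm_ne_norm h.ne', max_eq_left h.le]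

lemma norm_Rn (n : ℕ) : ‖Rn n‖ = (1 / 4) ^ n * ‖(n.factorial : ℚ_[2])‖ ^ 2 := by
  have hs := summable_wq_mul (fun m => m.choose n)
  rw [Rn, ← hs.sum_add_tsum_nat_add (n + 1), Finset.sum_range_succ, Finset.sum_eq_zero, zero_add,
    Nat.choose_self, Nat.cast_one, one_mul, norm_add_eq_left, norm_wq]
  · have hp := norm_fact_pos n
    rw [norm_wq]
    refine lt_of_le_of_lt (b := (1 / 4 : ℝ) ^ (n + 1) * ‖(n.factorial : ℚ_[2])‖ ^ 2) ?_ ?_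
    · refine IsUltrametricDist.norm_tsum_le_of_forall_le fun i => ?_
      rw [norm_mul, norm_wq]
      have h1 := norm_nat_le_one ((i + (n + 1)).choose n)
      have h2 := norm_fact_anti (show n ≤ i + (n + 1) by omega)
      have h3 : (1 / 4 : ℝ) ^ (i + (n + 1)) ≤ (1 / 4) ^ (n + 1) :=
        pow_le_pow_of_le_one (by norm_num) (by norm_num) (by omega)
      calc _ ≤ 1 * ((1 / 4 : ℝ) ^ (n + 1) * ‖(n.factorial : ℚ_[2])‖ ^ 2) := by gcongr
        _ = _ := one_mul _
    · gcongr ?_ * _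
      exact pow_lt_pow_right_of_lt_one₀ (by norm_num) (by norm_num) (by omega)
  · intro m hm
    rw [Finset.mem_range] at hm
    rw [Nat.choose_eq_zero_of_lt hm]; simp

lemma norm_alq (k : ℕ) : ‖((alq k : ℚ) : ℚ_[2])‖ = 4 ^ k / ‖(k.factorial : ℚ_[2])‖ ^ 2 := by
  rw [alq]; push_cast
  rw [norm_div, norm_oddP, norm_mul, norm_pow, norm_pow, norm_four]
  have := (norm_fact_pos k).ne'
  field_simp
  rw [← mul_pow]; norm_num

lemma norm_cn (n : ℕ) : ‖((cn n : ℚ) : ℚ_[2])‖ = 4 ^ n / ‖(n.factorial : ℚ_[2])‖ ^ 2 := by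
  have hp := norm_fact_pos n
  have hl : ‖((-1) ^ n * (n.choose n : ℚ_[2]) * ((alq n : ℚ) : ℚ_[2]))‖ =
      4 ^ n / ‖(n.factorial : ℚ_[2])‖ ^ 2 := by
    rw [norm_mul, norm_mul, norm_pow, norm_neg, norm_alq]; simp
  rw [cn]; push_cast
  rw [Finset.sum_range_succ, add_comm, norm_add_eq_left, hl]
  rw [hl]
  refine lt_of_le_of_lt (b := (4 : ℝ) ^ n / ‖(n.factorial : ℚ_[2])‖ ^ 2 / 4) ?_ ?_
  · refine IsUltrametricDist.norm_sum_le_of_forall_le_of_nonneg (by positivity) fun k hk => ?_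
    rw [Finset.mem_range] at hk
    rw [norm_mul, norm_mul, norm_pow, norm_neg, norm_alq]
    have h1 := norm_nat_le_one (n.choose k)
    have h2 := norm_fact_anti hk.le
    have h3 : (4 : ℝ) ^ k ≤ 4 ^ n / 4 := by
      rw [le_div_iff₀ (by norm_num), ← pow_succ]
      exact pow_le_pow_right₀ (by norm_num) (by omega)
    rw [norm_one, one_pow, one_mul, div_right_comm]
    calc _ ≤ 1 * ((4 : ℝ) ^ n / 4 / ‖(n.factorial : ℚ_[2])‖ ^ 2) := by gcongr
      _ = _ := one_mul _
  · have : 0 < (4 : ℝ) ^ n / ‖(n.factorial : ℚ_[2])‖ ^ 2 := by positivity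
    linarith

lemma cn_ne_zero (n : ℕ) : cn n ≠ 0 := by
  intro h
  have h1 := norm_cn n
  have hp := norm_fact_pos n
  have : 0 < (4 : ℝ) ^ n / ‖(n.factorial : ℚ_[2])‖ ^ 2 := by positivity
  rw [← h1, h] at this
  simp at this

lemma norm_catS_sub (n : ℕ) : ‖catS - ((en n / cn n : ℚ) : ℚ_[2])‖ =
    (1 / 16) ^ n * ‖(n.factorial : ℚ_[2])‖ ^ 4 := by
  have hc : ((cn n : ℚ) : ℚ_[2]) ≠ 0 := by exact_mod_cast cn_ne_zero n
  have h : catS - ((en n / cn n : ℚ) : ℚ_[2]) = (-1) ^ n * Rn n / (cn n : ℚ_[2]) := by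
    rw [← Rn_eq]; push_cast; field_simp
  rw [h, norm_div, norm_mul, norm_pow, norm_neg, norm_Rn, norm_cn]
  have hp := (norm_fact_pos n).ne'
  rw [show (1 / 16 : ℝ) = 1 / 4 / 4 by norm_num, div_pow (1 / 4 : ℝ)]
  simp only [norm_one, one_pow, one_mul]
  field_simp

lemma norm_fact_le (n : ℕ) : ‖(n.factorial : ℚ_[2])‖ ≤ 2 * (n + 1) / 2 ^ n := by
  have hne : (n.factorial : ℚ_[2]) ≠ 0 := norm_pos_iff.1 (norm_fact_pos n)
  rw [Padic.norm_eq_zpow_neg_valuation hne, Padic.valuation_natCast, zpow_neg, zpow_natCast,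
    le_div_iff₀ (by positivity), inv_mul_le_iff₀ (by positivity)]
  have h := sub_one_mul_padicValNat_factorial (p := 2) n
  rw [show 2 - 1 = 1 from rfl, one_mul] at h
  have hd : (Nat.digits 2 n).sum ≤ Nat.log 2 n + 1 := by
    rcases Nat.eq_zero_or_pos n with rfl | hn
    · simp
    · have := List.sum_le_card_nsmul (Nat.digits 2 n) 1
        (fun x hx => Nat.lt_succ_iff.1 (Nat.digits_lt_base (by norm_num) hx))
      rw [Nat.length_digits 2 n (by norm_num) hn.ne'] at this
      simpa using this
  have h2 : 2 ^ n ≤ 2 ^ padicValNat 2 n.factorial * (2 * (n + 1)) := by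
    have h3 : 2 ^ Nat.log 2 n ≤ n + 1 := by
      rcases Nat.eq_zero_or_pos n with rfl | hn
      · simp
      · exact (Nat.pow_log_le_self 2 hn.ne').trans (by omega)
    calc 2 ^ n ≤ 2 ^ (padicValNat 2 n.factorial + (Nat.log 2 n + 1)) :=
          Nat.pow_le_pow_right (by norm_num) (by omega)
      _ = 2 ^ padicValNat 2 n.factorial * (2 * 2 ^ Nat.log 2 n) := by ring
      _ ≤ _ := by gcongr
  exact_mod_cast h2

lemma alq_eq (k : ℕ) : 16 ^ k * alq k = (Nat.centralBinom k : ℚ) ^ 2 := by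
  induction k with
  | zero => simp [alq, oddP]
  | succ k ih =>
    have h1 := alq_succ k
    have h2 : ((k : ℚ) + 1) * (Nat.centralBinom (k + 1) : ℚ) = 2 * (2 * k + 1) * Nat.centralBinom k := by
      exact_mod_cast Nat.succ_mul_centralBinom_succ k
    have hne : ((k : ℚ) + 1) ^ 2 ≠ 0 := by positivity
    apply mul_left_cancel₀ hne
    have h3 : (((k : ℚ) + 1) * (Nat.centralBinom (k + 1) : ℚ)) ^ 2 =
      (2 * (2 * k + 1) * Nat.centralBinom k) ^ 2 := by rw [h2]
    rw [pow_succ]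
    linear_combination (4 * 16 ^ k) * h1 + (4 * (2 * (k : ℚ) + 1) ^ 2) * ih - h3

lemma floor_ineq (j k n q : ℕ) (hjk : j < k) (hkn : k ≤ n) (hq : 0 < q) :
    2 * (k / q) + (2 * j + 1) / q ≤ 2 * k / q + 2 * (j / q) + (if q ≤ n then 1 else 0) := by
  split_ifs with h
  · have h1 : 2 * (k / q) ≤ 2 * k / q := by
      rw [Nat.le_div_iff_mul_le hq]
      nlinarith [Nat.div_mul_le_self k q]
    have h2 : (2 * j + 1) / q < 2 * (j / q) + 1 + 1 := by
      rw [Nat.div_lt_iff_lt_mul hq]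
      have := Nat.lt_div_mul_add (a := j) hq
      nlinarith
    omega
  · rw [Nat.div_eq_of_lt (show k < q by omega)]
    have : (2 * j + 1) / q ≤ 2 * k / q := Nat.div_le_div_right (by omega)
    omega

lemma fact_dvd (j k n : ℕ) (hjk : j < k) (hkn : k ≤ n) :
    k.factorial ^ 2 * (2 * j + 1).factorial ∣
      (2 * k).factorial * j.factorial ^ 2 * n.lcmUpto := by
  have f0 : ∀ m : ℕ, m.factorial ≠ 0 := Nat.factorial_ne_zero
  have d0 := Nat.lcmUpto_ne_zero n
  rw [← Nat.factorization_prime_le_iff_dvd (by simp [f0]) (by simp [f0, d0])]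
  intro p hp
  rw [Nat.factorization_mul (by simp [f0]) (f0 _), Nat.factorization_mul (by simp [f0]) d0,
    Nat.factorization_mul (f0 _) (by simp [f0]), Nat.factorization_pow, Nat.factorization_pow]
  simp only [Finsupp.add_apply, Finsupp.smul_apply, smul_eq_mul]
  have hlog : ∀ m, m ≤ 2 * n → Nat.log p m < Nat.log p (2 * n) + 1 := fun m hm =>
    Nat.lt_succ_of_le (Nat.log_mono_right hm)
  rw [Nat.factorization_factorial hp (hlog k (by omega)),
    Nat.factorization_factorial hp (hlog (2 * j + 1) (by omega)),
    Nat.factorization_factorial hp (hlog (2 * k) (by omega)),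
    Nat.factorization_factorial hp (hlog j (by omega)), Nat.factorization_lcmUpto n hp,
    Finset.mul_sum, Finset.mul_sum, ← Finset.sum_add_distrib, ← Finset.sum_add_distrib]
  have h1 : ∑ i ∈ Finset.Ico 1 (Nat.log p (2 * n) + 1), (if p ^ i ≤ n then 1 else 0) ≤
      Nat.log p n := by
    rw [← Finset.sum_filter, ← Finset.card_eq_sum_ones]
    calc _ ≤ (Finset.Ico 1 (Nat.log p n + 1)).card := by
          apply Finset.card_le_card
          intro i hi
          simp only [Finset.mem_filter, Finset.mem_Ico] at hi ⊢
          exact ⟨hi.1.1, Nat.lt_succ_of_le (Nat.le_log_of_pow_le hp.one_lt hi.2)⟩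
      _ = _ := by simp
  refine le_trans ?_ (Nat.add_le_add_left h1 _)
  rw [← Finset.sum_add_distrib]
  exact Finset.sum_le_sum fun i _ => floor_ineq j k n (p ^ i) hjk hkn (pow_pos hp.pos i)

lemma cb_dvd (j k n : ℕ) (hjk : j < k) (hkn : k ≤ n) :
    (2 * j + 1) * Nat.centralBinom j ∣ Nat.centralBinom k * n.lcmUpto := by
  have h := fact_dvd j k n hjk hkn
  have e : ∀ m : ℕ, (2 * m).factorial = Nat.centralBinom m * m.factorial ^ 2 := by
    intro m
    have := Nat.choose_mul_factorial_mul_factorial (show m ≤ 2 * m by omega)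
    rw [show 2 * m - m = m by omega] at this
    rw [Nat.centralBinom, ← this]; ring
  rw [Nat.factorial_succ, e, e] at h
  have hp : 0 < k.factorial ^ 2 * j.factorial ^ 2 := by
    have := Nat.factorial_pos k; have := Nat.factorial_pos j; positivity
  refine Nat.dvd_of_mul_dvd_mul_left hp ?_
  convert h using 1 <;> ring

lemma cn_int (n : ℕ) : ∃ z : ℤ, (z : ℚ) = 16 ^ n * cn n := by
  refine ⟨∑ k ∈ Finset.range (n + 1), (-1) ^ k * (n.choose k) * 16 ^ (n - k) *
    (Nat.centralBinom k) ^ 2, ?_⟩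
  rw [cn, Finset.mul_sum]; push_cast
  refine Finset.sum_congr rfl fun k hk => ?_
  rw [Finset.mem_range] at hk
  have : (16 : ℚ) ^ n = 16 ^ (n - k) * 16 ^ k := by rw [← pow_add]; congr 1; omega
  rw [← alq_eq, this]; ring

lemma wq_eq (j : ℕ) : (((2 * j + 1) * Nat.centralBinom j : ℕ) : ℚ) ^ 2 * wq j = 16 ^ j := by
  have h1 := alq_mul_wq j
  have h2 := alq_eq j
  push_cast
  rw [mul_pow, ← h2]
  linear_combination 16 ^ j * h1

lemma en_int (n : ℕ) : ∃ z : ℤ, (z : ℚ) = 16 ^ n * (n.lcmUpto : ℚ) ^ 2 * en n := by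
  have key : ∀ k ∈ Finset.range (n + 1), ∃ z : ℤ,
      (z : ℚ) = 16 ^ k * (n.lcmUpto : ℚ) ^ 2 * (alq k * sqs k) := by
    intro k hk
    rw [Finset.mem_range] at hk
    have key2 : ∀ j ∈ Finset.range k, ∃ z : ℤ,
        (z : ℚ) = 16 ^ k * (n.lcmUpto : ℚ) ^ 2 * (alq k * wq j) := by
      intro j hj
      rw [Finset.mem_range] at hj
      obtain ⟨c, hc⟩ := cb_dvd j k n hj (by omega)
      refine ⟨c ^ 2 * 16 ^ j, ?_⟩
      have hc' : (Nat.centralBinom k : ℚ) * n.lcmUpto = ((2 * j + 1) * Nat.centralBinom j : ℕ) * c := by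
        exact_mod_cast hc
      have h2 := alq_eq k
      have h3 := wq_eq j
      push_cast
      rw [← h3]
      have hc2 : ((Nat.centralBinom k : ℚ) * n.lcmUpto) ^ 2 =
        (((2 * j + 1) * Nat.centralBinom j : ℕ) * c) ^ 2 := by rw [hc']
      linear_combination (-wq j) * hc2 - (n.lcmUpto : ℚ) ^ 2 * wq j * h2
    choose! f hf using key2
    refine ⟨∑ j ∈ Finset.range k, f j, ?_⟩
    push_cast
    rw [Finset.sum_congr rfl hf, sqs, Finset.mul_sum, Finset.mul_sum]
  choose! f hf using key
  refine ⟨∑ k ∈ Finset.range (n + 1), (-1) ^ k * (n.choose k) * 16 ^ (n - k) * f k, ?_⟩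
  rw [en, Finset.mul_sum]; push_cast
  refine Finset.sum_congr rfl fun k hk => ?_
  rw [hf k hk]
  rw [Finset.mem_range] at hk
  have : (16 : ℚ) ^ n = 16 ^ (n - k) * 16 ^ k := by rw [← pow_add]; congr 1; omega
  rw [this]; ring

noncomputable def bt (T : ℕ → ℚ) (n : ℕ) : ℚ :=
  ∑ k ∈ Finset.range (n + 1), (-1 : ℚ) ^ k * (n.choose k) * T k

lemma bt_succ (T : ℕ → ℚ) (n : ℕ) :
    bt T (n + 1) - bt T n = - bt (fun k => T (k + 1)) n := by
  unfold bt
  rw [Finset.sum_range_succ' _ (n + 1)]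
  have : ∑ k ∈ Finset.range (n + 1), (-1 : ℚ) ^ k * (n.choose k) * T k =
      ∑ k ∈ Finset.range (n + 1), (-1 : ℚ) ^ (k + 1) * (n.choose (k + 1)) * T (k + 1) +
        (-1 : ℚ) ^ 0 * (n.choose 0) * T 0 := by
    rw [← Finset.sum_range_succ' (fun k => (-1 : ℚ) ^ k * (n.choose k) * T k),
      Finset.sum_range_succ _ (n + 1)]
    simp
  rw [this, add_sub_add_comm, ← Finset.sum_sub_distrib, ← Finset.sum_neg_distrib]
  simp only [pow_zero, Nat.choose_zero_right, sub_self, add_zero]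
  refine Finset.sum_congr rfl fun k _ => ?_
  rw [Nat.choose_succ_succ]; push_cast; ring

lemma bt_rec (T : ℕ → ℚ) (c : ℚ)
    (h : ∀ k : ℕ, (2 * (k : ℚ) + 2) ^ 2 * T (k + 1) = (2 * k + 1) ^ 2 * T k + c) (m : ℕ) :
    ((m : ℚ) + 2) ^ 2 * (bt T (m + 2) - bt T (m + 1)) =
      ((m : ℚ) + 1) ^ 2 * (bt T (m + 1) - bt T m) - bt T (m + 1) / 4 := by
  rw [bt_succ, bt_succ]
  have hk : ∀ k, k ≤ m + 1 → ((m + 1 : ℚ)) * (m.choose k) = (m + 1 - k) * ((m + 1).choose k) := by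
    intro k hk
    have := Nat.choose_mul_succ_eq m k
    have h2 : ((m.choose k * (m + 1) : ℕ) : ℚ) = (((m + 1).choose k * (m + 1 - k) : ℕ) : ℚ) := by
      rw [this]
    push_cast [Nat.cast_sub hk] at h2
    linarith
  have hk2 : ∀ k, k ≤ m + 1 → ((k + 1 : ℚ)) * ((m + 1).choose (k + 1)) =
      (m + 1 - k) * ((m + 1).choose k) := by
    intro k hk
    have := Nat.choose_succ_right_eq (m + 1) k
    have h2 : (((m + 1).choose (k + 1) * (k + 1) : ℕ) : ℚ) =
      (((m + 1).choose k * (m + 1 - k) : ℕ) : ℚ) := by rw [this]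
    push_cast [Nat.cast_sub hk] at h2
    linarith
  have e1 : ((m : ℚ) + 1) ^ 2 * bt (fun k => T (k + 1)) m =
      ∑ k ∈ Finset.range (m + 1 + 1), (-1 : ℚ) ^ k * ((m + 1).choose k) *
        ((m + 1) * (m + 1 - k) * T (k + 1)) := by
    rw [bt, Finset.mul_sum, Finset.sum_range_succ _ (m + 1)]
    have : ((m : ℚ) + 1 - ((m + 1 : ℕ) : ℚ)) = 0 := by push_cast; ring
    rw [this]
    simp only [mul_zero, zero_mul, add_zero]
    refine Finset.sum_congr rfl fun k hk' => ?_
    rw [Finset.mem_range] at hk'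
    linear_combination (((m : ℚ) + 1) * (-1) ^ k * T (k + 1)) * hk k hk'.le
  have e2 : ∑ k ∈ Finset.range (m + 1 + 1), (-1 : ℚ) ^ k * ((m + 1).choose k) *
        (k * (k + 1) * T k) = - ∑ k ∈ Finset.range (m + 1 + 1), (-1 : ℚ) ^ k * ((m + 1).choose k) *
        ((m + 1 - k) * (k + 2) * T (k + 1)) := by
    rw [Finset.sum_range_succ', Finset.sum_range_succ _ (m + 1)]
    have : ((m : ℚ) + 1 - ((m + 1 : ℕ) : ℚ)) = 0 := by push_cast; ring
    rw [this]
    simp only [mul_zero, zero_mul, add_zero, Nat.cast_zero]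
    rw [← Finset.sum_neg_distrib]
    refine Finset.sum_congr rfl fun k hk' => ?_
    rw [Finset.mem_range] at hk'
    push_cast
    rw [pow_succ]
    linear_combination (-((-1) ^ k * T (k + 1) * (k + 2))) * hk2 k hk'.le
  have e3 : ∑ k ∈ Finset.range (m + 1 + 1), (-1 : ℚ) ^ k * ((m + 1).choose k) = 0 := by
    have := Int.alternating_sum_range_choose_of_ne (n := m + 1) (by omega)
    exact_mod_cast this
  have e4 : bt T (m + 1) / 4 = ∑ k ∈ Finset.range (m + 1 + 1), (-1 : ℚ) ^ k * ((m + 1).choose k) *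
        ((k + 1) ^ 2 * T (k + 1)) - ∑ k ∈ Finset.range (m + 1 + 1), (-1 : ℚ) ^ k * ((m + 1).choose k) *
        (k * (k + 1) * T k) - c / 4 * ∑ k ∈ Finset.range (m + 1 + 1), (-1 : ℚ) ^ k * ((m + 1).choose k) := by
    rw [bt, Finset.sum_div, Finset.mul_sum, ← Finset.sum_sub_distrib, ← Finset.sum_sub_distrib]
    refine Finset.sum_congr rfl fun k _ => ?_
    linear_combination (-((-1 : ℚ) ^ k * ((m + 1).choose k)) / 4) * h k
  have e5 : ((m : ℚ) + 2) ^ 2 * bt (fun k => T (k + 1)) (m + 1) =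
    ((m : ℚ) + 1) ^ 2 * bt (fun k => T (k + 1)) m + bt T (m + 1) / 4 := by
    rw [e4, e1, e2, e3, bt, Finset.mul_sum, mul_zero, sub_zero, sub_neg_eq_add,
      ← Finset.sum_add_distrib, ← Finset.sum_add_distrib]
    refine Finset.sum_congr rfl fun k _ => ?_
    ring
  linear_combination -e5

lemma bt_bound (T : ℕ → ℚ) (c : ℚ)
    (h : ∀ k : ℕ, (2 * (k : ℚ) + 2) ^ 2 * T (k + 1) = (2 * k + 1) ^ 2 * T k + c) :
    ∃ K : ℚ, 0 < K ∧ ∀ n : ℕ, |bt T n| ≤ K * (n + 1) := by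
  set K : ℚ := |bt T 0| + |bt T 1 - bt T 0| + 1 with hK
  have hKp : 0 < K := by positivity
  have key : ∀ n : ℕ, |bt T n| ≤ K * (n + 1) ∧ |bt T (n + 1) - bt T n| ≤ K := by
    intro n
    induction n with
    | zero =>
      have h1 := abs_nonneg (bt T 0)
      have h2 := abs_nonneg (bt T 1 - bt T 0)
      constructor
      · push_cast; linarith
      · simp only [zero_add]; linarith
    | succ n ih =>
      obtain ⟨i1, i2⟩ := ih
      have i3 : |bt T (n + 1)| ≤ K * (n + 1 + 1) := by
        rw [abs_le] at *
        constructor <;> linarith [i1.1, i1.2, i2.1, i2.2]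
      refine ⟨by push_cast; exact i3, ?_⟩
      have hr := bt_rec T c h n
      have hn : (0 : ℚ) ≤ n := by positivity
      have hp : (0 : ℚ) < ((n : ℚ) + 2) ^ 2 := by positivity
      have h4 : ((n : ℚ) + 2) ^ 2 * |bt T (n + 2) - bt T (n + 1)| ≤ ((n : ℚ) + 2) ^ 2 * K := by
        calc _ = |((n : ℚ) + 2) ^ 2 * (bt T (n + 2) - bt T (n + 1))| := by
              rw [abs_mul, abs_of_pos hp]
          _ = |((n : ℚ) + 1) ^ 2 * (bt T (n + 1) - bt T n) - bt T (n + 1) / 4| := by rw [hr]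
          _ ≤ |((n : ℚ) + 1) ^ 2 * (bt T (n + 1) - bt T n)| + |bt T (n + 1) / 4| := abs_sub _ _
          _ = ((n : ℚ) + 1) ^ 2 * |bt T (n + 1) - bt T n| + |bt T (n + 1)| / 4 := by
              rw [abs_mul, abs_of_pos (show (0 : ℚ) < ((n : ℚ) + 1) ^ 2 by positivity), abs_div]
              norm_num
          _ ≤ ((n : ℚ) + 1) ^ 2 * K + K * (n + 1 + 1) / 4 := by gcongr
          _ ≤ _ := by nlinarith [mul_nonneg hn hKp.le]
      exact le_of_mul_le_mul_left h4 hp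
  exact ⟨K, hKp, fun n => (key n).1⟩

lemma cn_en_bound : ∃ K : ℚ, 0 < K ∧ ∀ n : ℕ, |cn n| ≤ K * (n + 1) ∧ |en n| ≤ K * (n + 1) := by
  obtain ⟨K1, h1, b1⟩ := bt_bound alq 0 (fun k => by rw [alq_succ, add_zero])
  obtain ⟨K2, h2, b2⟩ := bt_bound (fun k => alq k * sqs k) 1 (fun k => by
    have h1 := alq_succ k
    have h2 := alq_mul_wq k
    have h3 : sqs (k + 1) = sqs k + wq k := by rw [sqs, Finset.sum_range_succ]; rfl
    simp only [h3]
    linear_combination (sqs k + wq k) * h1 + h2)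
  refine ⟨K1 + K2, by positivity, fun n => ⟨(b1 n).trans ?_, (b2 n).trans ?_⟩⟩ <;> gcongr <;> linarith

/-- `log N! = ∑ ψ(N/k)`. -/
lemma log_fact_psi (N : ℕ) : Real.log (N.factorial : ℝ) =
    ∑ k ∈ Finset.Ioc 0 N, Chebyshev.psi ((N / k : ℕ) : ℝ) := by
  have h := ArithmeticFunction.sum_Ioc_mul_eq_sum_sum
    ((ArithmeticFunction.zeta : ArithmeticFunction ℝ)) ArithmeticFunction.vonMangoldt N
  rw [mul_comm, ArithmeticFunction.vonMangoldt_mul_zeta] at h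
  have h1 : Real.log (N.factorial : ℝ) = ∑ n ∈ Finset.Ioc 0 N, ArithmeticFunction.log n := by
    clear h
    induction N with
    | zero => simp
    | succ N ih =>
      rw [Finset.sum_Ioc_succ_top (by omega), ← ih, Nat.factorial_succ]
      push_cast
      rw [Real.log_mul (by positivity) (by exact_mod_cast (Nat.factorial_pos N).ne'),
        ArithmeticFunction.log_apply]
      push_cast; ring
  rw [h1, h]
  refine Finset.sum_congr rfl fun k hk => ?_
  rw [Finset.mem_Ioc] at hk
  rw [Chebyshev.psi, Nat.floor_natCast]
  simp [hk.1.ne']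

lemma freq_psi (δ : ℝ) (hδ : 0 < δ) :
    ∃ᶠ n : ℕ in Filter.atTop, Chebyshev.psi (n : ℝ) ≤ (1 + δ) * n := by
  rw [Filter.Frequently]
  intro hev
  obtain ⟨n0, hn0⟩ := Filter.eventually_atTop.1 hev
  set a := n0 + 1 with ha
  have hap : 0 < a := by omega
  -- for all m ≥ 1
  have key : ∀ M : ℕ, 1 ≤ M → (1 + δ) * (Real.log M - 1) ≤ Real.log a + Real.log M := by
    intro M hM
    have hMp : (0 : ℝ) < M := by exact_mod_cast hM
    have hapr : (0 : ℝ) < a := by exact_mod_cast hap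
    have h1 := log_fact_psi (a * M)
    have h2 : Real.log ((a * M).factorial : ℝ) ≤ a * M * (Real.log a + Real.log M) := by
      rw [← Real.log_mul hapr.ne' hMp.ne']
      have : ((a * M).factorial : ℝ) ≤ ((a : ℝ) * M) ^ (a * M) := by
        exact_mod_cast Nat.factorial_le_pow (a * M)
      calc _ ≤ Real.log (((a : ℝ) * M) ^ (a * M)) :=
            Real.log_le_log (by exact_mod_cast Nat.factorial_pos _) this
        _ = _ := by rw [Real.log_pow]; push_cast; ring
    have h3 : ∑ k ∈ Finset.Ioc 0 M, (1 + δ) * ((a : ℝ) * M / k - 1) ≤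
        ∑ k ∈ Finset.Ioc 0 (a * M), Chebyshev.psi ((a * M / k : ℕ) : ℝ) := by
      calc _ ≤ ∑ k ∈ Finset.Ioc 0 M, Chebyshev.psi ((a * M / k : ℕ) : ℝ) := by
            refine Finset.sum_le_sum fun k hk => ?_
            rw [Finset.mem_Ioc] at hk
            have hge : n0 ≤ a * M / k := by
              rw [Nat.le_div_iff_mul_le hk.1]
              exact Nat.mul_le_mul (by omega) hk.2
            have := hn0 _ hge
            rw [not_le] at this
            refine le_trans ?_ this.le
            gcongr
            have := Nat.lt_div_mul_add (a := a * M) hk.1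
            have hkr : (0 : ℝ) < k := by exact_mod_cast hk.1
            rw [sub_le_iff_le_add, div_le_iff₀ hkr]
            have h5 : ((a * M : ℕ) : ℝ) ≤ ((a * M / k * k + k : ℕ) : ℝ) := by exact_mod_cast this.le
            push_cast at h5 ⊢
            linarith
        _ ≤ _ := by
            refine Finset.sum_le_sum_of_subset_of_nonneg ?_ fun _ _ _ => Chebyshev.psi_nonneg _
            exact Finset.Ioc_subset_Ioc_right (Nat.le_mul_of_pos_left M hap)
    have h4 : (1 + δ) * (a * M * Real.log M - a * M) ≤
        ∑ k ∈ Finset.Ioc 0 M, (1 + δ) * ((a : ℝ) * M / k - 1) := by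
      rw [← Finset.mul_sum, Finset.sum_sub_distrib]
      have h6 : Real.log M ≤ ∑ k ∈ Finset.Ioc 0 M, (1 : ℝ) / k := by
        have := log_add_one_le_harmonic M
        have h8 : Real.log M ≤ Real.log ((M + 1 : ℕ) : ℝ) :=
          Real.log_le_log hMp (by push_cast; linarith)
        refine h8.trans (this.trans_eq ?_)
        rw [harmonic_eq_sum_Icc]
        push_cast
        refine Finset.sum_congr (by ext; simp; omega) fun k _ => by rw [one_div]
      have h7 : ∑ k ∈ Finset.Ioc 0 M, (a : ℝ) * M / k = a * M * ∑ k ∈ Finset.Ioc 0 M, (1 : ℝ) / k := by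
        rw [Finset.mul_sum]; refine Finset.sum_congr rfl fun k _ => by ring
      rw [h7]
      simp only [Finset.sum_const, Nat.card_Ioc, Nat.sub_zero, nsmul_eq_mul, mul_one]
      have h9 : (M : ℝ) ≤ a * M := by
        have : (1 : ℝ) ≤ a := by exact_mod_cast hap
        nlinarith
      gcongr
    have h5 : ((a : ℝ) * M) * ((1 + δ) * (Real.log M - 1)) ≤ (a * M) * (Real.log a + Real.log M) := by
      linarith [h1 ▸ h2]
    exact le_of_mul_le_mul_left h5 (by positivity)
  have ht : Filter.Tendsto (fun M : ℕ => δ * Real.log (M : ℝ)) Filter.atTop Filter.atTop :=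
    (Real.tendsto_log_atTop.comp tendsto_natCast_atTop_atTop).const_mul_atTop hδ
  obtain ⟨M, hM1, hM2⟩ := ((ht.eventually_gt_atTop (Real.log a + 1 + δ)).and
    (Filter.eventually_ge_atTop 1)).exists
  have := key M hM2
  linarith

lemma ev_log (μ c C : ℝ) (hμ : 0 < μ) (hc : 0 < c) :
    ∀ᶠ n : ℕ in Filter.atTop, C + c * Real.log ((n : ℝ) + 1) ≤ μ * n := by
  have h1 := Real.isLittleO_log_id_atTop.def (show 0 < μ / (2 * c) by positivity)
  have ht : Filter.Tendsto (fun n : ℕ => (n : ℝ) + 1) Filter.atTop Filter.atTop :=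
    Filter.tendsto_atTop_add_const_right _ _ tendsto_natCast_atTop_atTop
  have h2 := ht.eventually h1
  have h3 : ∀ᶠ n : ℕ in Filter.atTop, 2 * (C + μ / 2) / μ ≤ (n : ℝ) :=
    tendsto_natCast_atTop_atTop.eventually_ge_atTop _
  filter_upwards [h2, h3] with n a b
  simp only [id] at a
  rw [Real.norm_eq_abs, Real.norm_eq_abs, abs_of_pos (show (0 : ℝ) < n + 1 by positivity)] at a
  have a' := (le_abs_self _).trans a
  rw [div_le_iff₀ hμ] at b
  have : c * Real.log ((n : ℝ) + 1) ≤ c * (μ / (2 * c) * (n + 1)) := by gcongr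
  have e : c * (μ / (2 * c) * ((n : ℝ) + 1)) = μ / 2 * (n + 1) := by field_simp
  linarith

lemma main_seq (E : ℕ → ℚ) (hE0 : E 0 = 1)
    (hE : ∀ k : ℕ, 1 ≤ k →
      ∑ j ∈ Finset.range (k + 1), (Nat.choose (2 * k) (2 * j) : ℚ) * E (2 * j) = 0)
    (η : ℚ_[2])
    (hη : ∃ k : ℕ → ℕ, (∀ j, 0 < k j) ∧
      Filter.Tendsto (fun j => (k j : ℝ)) Filter.atTop Filter.atTop ∧
      Filter.Tendsto (fun j => ‖(k j : ℚ_[2]) + 1‖) Filter.atTop (nhds 0) ∧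
      Filter.Tendsto (fun j => ((E (2 * k j) / 2 : ℚ) : ℚ_[2])) Filter.atTop (nhds η))
    (κ : ℝ) (hκ0 : 0 ≤ κ) (hκ : κ * (4 * Real.log 2 + 2) < 8 * Real.log 2) :
    ∃ P Q : ℕ → ℤ, (∀ n, Q n ≠ 0) ∧
      Filter.Tendsto (fun n => |Q n|) Filter.atTop Filter.atTop ∧
      ∀ᶠ n in Filter.atTop,
        0 < ‖η - (P n : ℚ_[2]) / (Q n : ℚ_[2])‖ ∧
        ‖η - (P n : ℚ_[2]) / (Q n : ℚ_[2])‖ ≤ ((max |P n| |Q n| : ℤ) : ℝ) ^ (-κ) := by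
  have hS := catS_eq E hE0 hE η hη
  choose cz hcz using cn_int
  choose ez hez using en_int
  obtain ⟨K, hK, hb⟩ := cn_en_bound
  obtain ⟨δ, hδ, hδ2⟩ : ∃ δ : ℝ, 0 < δ ∧ κ * (4 * Real.log 2 + 2 + 2 * δ) < 8 * Real.log 2 := by
    refine ⟨(8 * Real.log 2 - κ * (4 * Real.log 2 + 2)) / (4 * (κ + 1)), ?_, ?_⟩
    · apply div_pos <;> linarith
    · set g := 8 * Real.log 2 - κ * (4 * Real.log 2 + 2) with hg
      have hgp : 0 < g := by linarith
      have : κ * (2 * (g / (4 * (κ + 1)))) < g := by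
        rw [show κ * (2 * (g / (4 * (κ + 1)))) = (κ * 2 * g) / (4 * (κ + 1)) by ring,
          div_lt_iff₀ (by positivity)]
        nlinarith
      linarith
  obtain ⟨φ, hφ, hφ2⟩ := Filter.extraction_of_frequently_atTop (freq_psi δ hδ)
  have hd : ∀ n : ℕ, 0 < n.lcmUpto := Nat.lcmUpto_pos
  have hcz0 : ∀ n, cz n ≠ 0 := by
    intro n h
    have := hcz n
    rw [h] at this
    have h3 : (16 : ℚ) ^ n * cn n ≠ 0 := mul_ne_zero (by positivity) (cn_ne_zero n)
    exact h3 (by rw [← this]; simp)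
  set P : ℕ → ℤ := fun n => - ez n with hP
  set Q : ℕ → ℤ := fun n => 2 * (n.lcmUpto : ℤ) ^ 2 * cz n with hQ
  have hQ0 : ∀ n, Q n ≠ 0 := fun n =>
    mul_ne_zero (mul_ne_zero two_ne_zero (pow_ne_zero _ (by exact_mod_cast (hd n).ne'))) (hcz0 n)
  have hQn : ∀ n : ℕ, (n : ℤ) ≤ |Q n| := by
    intro n
    have h1 : n ≤ n.lcmUpto := by
      rcases Nat.eq_zero_or_pos n with rfl | hn
      · simp
      · exact Nat.le_of_dvd (hd n) (by simpa using Chebyshev.choose_dvd_lcmUpto (n := n) (k := 1) hn)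
    have h2 : (1 : ℤ) ≤ |cz n| := Int.one_le_abs (hcz0 n)
    have h3 : (n : ℤ) ≤ (n.lcmUpto : ℤ) := by exact_mod_cast h1
    have h4 : (1 : ℤ) ≤ (n.lcmUpto : ℤ) := by exact_mod_cast (hd n)
    simp only [hQ]
    rw [abs_mul, abs_of_pos (by positivity)]
    nlinarith
  have hnorm : ∀ n, ‖η - (P n : ℚ_[2]) / (Q n : ℚ_[2])‖ =
      2 * ((1 / 16) ^ n * ‖(n.factorial : ℚ_[2])‖ ^ 4) := by
    intro n
    rw [← norm_catS_sub]
    have e1 : (P n : ℚ_[2]) / (Q n : ℚ_[2]) = ((-(en n / cn n) / 2 : ℚ) : ℚ_[2]) := by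
      have : ((P n : ℚ) / (Q n : ℚ)) = -(en n / cn n) / 2 := by
        simp only [hP, hQ]
        push_cast
        rw [hcz, hez]
        have := cn_ne_zero n
        have h2 : (n.lcmUpto : ℚ) ≠ 0 := by exact_mod_cast (hd n).ne'
        field_simp
      rw [← this]; push_cast; rfl
    rw [e1, hS]
    have : -catS / 2 - ((-(en n / cn n) / 2 : ℚ) : ℚ_[2]) =
        - (catS - ((en n / cn n : ℚ) : ℚ_[2])) / 2 := by push_cast; ring
    rw [this, norm_div, norm_neg, norm_two]
    ring
  have hlcm : ∀ n : ℕ, (n.lcmUpto : ℝ) = Real.exp (Chebyshev.psi n) := by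
    intro n
    rw [Chebyshev.psi_eq_log_lcmUpto, Real.exp_log (by exact_mod_cast hd n)]
  have hH : ∀ n : ℕ, ((max |P n| |Q n| : ℤ) : ℝ) ≤
      2 * K * (n + 1) * (16 ^ n * (n.lcmUpto : ℝ) ^ 2) := by
    intro n
    obtain ⟨b1, b2⟩ := hb n
    have hD : (0 : ℚ) < 16 ^ n * (n.lcmUpto : ℚ) ^ 2 := by
      have : (0 : ℚ) < n.lcmUpto := by exact_mod_cast hd n
      positivity
    have hKn : 0 < K * ((n : ℚ) + 1) := by positivity
    have hp : ((|P n| : ℤ) : ℚ) ≤ 2 * K * (n + 1) * (16 ^ n * (n.lcmUpto : ℚ) ^ 2) := by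
      simp only [hP]
      rw [abs_neg, Int.cast_abs, hez, abs_mul, abs_of_pos hD]
      calc _ ≤ 16 ^ n * (n.lcmUpto : ℚ) ^ 2 * (2 * (K * (n + 1))) := by gcongr; linarith
        _ = _ := by ring
    have hq : ((|Q n| : ℤ) : ℚ) ≤ 2 * K * (n + 1) * (16 ^ n * (n.lcmUpto : ℚ) ^ 2) := by
      simp only [hQ]
      rw [Int.cast_abs]; push_cast
      rw [hcz, show 2 * (n.lcmUpto : ℚ) ^ 2 * (16 ^ n * cn n) =
        2 * (16 ^ n * (n.lcmUpto : ℚ) ^ 2) * cn n by ring, abs_mul, abs_of_pos (by positivity)]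
      calc _ ≤ 2 * (16 ^ n * (n.lcmUpto : ℚ) ^ 2) * (K * (n + 1)) := by gcongr
        _ = _ := by ring
    have hm : ((max |P n| |Q n| : ℤ) : ℚ) ≤ 2 * K * (n + 1) * (16 ^ n * (n.lcmUpto : ℚ) ^ 2) := by
      rw [Int.cast_max]; exact max_le hp hq
    exact_mod_cast hm
  have hKr : (0 : ℝ) < K := by exact_mod_cast hK
  refine ⟨P ∘ φ, Q ∘ φ, fun n => hQ0 _, ?_, ?_⟩
  · have : Filter.Tendsto (fun n : ℕ => |Q n|) Filter.atTop Filter.atTop :=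
      Filter.tendsto_atTop_mono hQn tendsto_natCast_atTop_atTop
    exact this.comp hφ.tendsto_atTop
  · have hev := hφ.tendsto_atTop.eventually (ev_log (8 * Real.log 2 - κ * (4 * Real.log 2 + 2 + 2 * δ))
      (4 + κ) (5 * Real.log 2 + κ * Real.log (2 * K)) (by linarith) (by linarith))
    filter_upwards [hev] with i hi
    have hpsi := hφ2 i
    simp only [Function.comp]
    set n := φ i with hn
    rw [hnorm]
    have hfp := norm_fact_pos n
    refine ⟨by positivity, ?_⟩
    set L := 4 * Real.log 2 + 2 + 2 * δ with hL
    have h1 : ((max |P n| |Q n| : ℤ) : ℝ) ≤ 2 * K * (n + 1) * Real.exp (L * n) := by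
      refine (hH n).trans ?_
      gcongr
      rw [hlcm, ← Real.exp_nat_mul, show (16 : ℝ) ^ n = Real.exp (4 * Real.log 2 * n) by
        rw [mul_comm, Real.exp_nat_mul, show 4 * Real.log 2 = (4 : ℕ) * Real.log 2 by norm_num,
          Real.exp_nat_mul, Real.exp_log (by norm_num)]; norm_num, ← Real.exp_add]
      apply Real.exp_le_exp.2
      push_cast
      nlinarith
    have h2 : (0 : ℝ) < ((max |P n| |Q n| : ℤ) : ℝ) := by
      have : 0 < max |P n| |Q n| := lt_max_of_lt_right (abs_pos.2 (hQ0 n))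
      exact_mod_cast this
    refine le_trans ?_ (Real.rpow_le_rpow_of_nonpos h2 h1 (by linarith))
    have hn1 : (0 : ℝ) < (n : ℝ) + 1 := by positivity
    have h3 : 2 * ((1 / 16 : ℝ) ^ n * ‖(n.factorial : ℚ_[2])‖ ^ 4) ≤
        2 * ((1 / 16 : ℝ) ^ n * (2 * (n + 1) / 2 ^ n) ^ 4) := by
      gcongr; exact norm_fact_le n
    refine h3.trans ?_
    rw [show (1 / 16 : ℝ) = (2 ^ 4)⁻¹ by norm_num]
    rw [← Real.log_le_log_iff (by positivity) (by positivity), Real.log_rpow (by positivity),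
      Real.log_mul (by positivity) (by positivity), Real.log_mul (by positivity) (by positivity),
      Real.log_pow, Real.log_pow, Real.log_div (by positivity) (by positivity), Real.log_pow,
      Real.log_mul (by positivity) (by positivity),
      Real.log_mul (by positivity) (by positivity), Real.log_exp,
      Real.log_inv, Real.log_pow,
      Real.log_mul (by positivity) (by positivity)]
    push_cast
    linarith

theorem stmt_17 (E : ℕ → ℚ) (hE0 : E 0 = 1)
    (hE : ∀ k : ℕ, 1 ≤ k →
      ∑ j ∈ Finset.range (k + 1), (Nat.choose (2 * k) (2 * j) : ℚ) * E (2 * j) = 0)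
    (η : ℚ_[2])
    (hη : ∃ k : ℕ → ℕ, (∀ j, 0 < k j) ∧
      Filter.Tendsto (fun j => (k j : ℝ)) Filter.atTop Filter.atTop ∧
      Filter.Tendsto (fun j => ‖(k j : ℚ_[2]) + 1‖) Filter.atTop (nhds 0) ∧
      Filter.Tendsto (fun j => ((E (2 * k j) / 2 : ℚ) : ℚ_[2])) Filter.atTop (nhds η)) :
    (∀ ε : ℝ, 0 < ε → ∃ P Q : ℕ → ℤ, (∀ n, Q n ≠ 0) ∧
      Filter.Tendsto (fun n => |Q n|) Filter.atTop Filter.atTop ∧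
      ∀ᶠ n in Filter.atTop,
        0 < ‖η - (P n : ℚ_[2]) / (Q n : ℚ_[2])‖ ∧
        ‖η - (P n : ℚ_[2]) / (Q n : ℚ_[2])‖ ≤
          ((max |P n| |Q n| : ℤ) : ℝ) ^
            (-(8 * Real.log 2 / (4 * Real.log 2 + 2) - ε))) ∧
    ∀ r : ℚ, η ≠ (r : ℚ_[2]) := by
  have hl2 : (0.69 : ℝ) < Real.log 2 := by linarith [Real.log_two_gt_d9]
  have hD : 0 < 4 * Real.log 2 + 2 := by linarith
  have hH1 : ∀ p q : ℤ, q ≠ 0 → (1 : ℝ) ≤ ((max |p| |q| : ℤ) : ℝ) := by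
    intro p q hq
    have : (1 : ℤ) ≤ max |p| |q| := le_max_of_le_right (Int.one_le_abs hq)
    exact_mod_cast this
  constructor
  · intro ε hε
    obtain ⟨P, Q, h1, h2, h3⟩ := main_seq E hE0 hE η hη
      (max (8 * Real.log 2 / (4 * Real.log 2 + 2) - ε) 0) (le_max_right _ _) (by
        rw [max_mul_of_nonneg _ _ hD.le, max_lt_iff]
        refine ⟨?_, by linarith⟩
        rw [sub_mul, div_mul_cancel₀ _ hD.ne']
        nlinarith)
    refine ⟨P, Q, h1, h2, ?_⟩
    filter_upwards [h3] with n hn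
    refine ⟨hn.1, hn.2.trans ?_⟩
    exact Real.rpow_le_rpow_of_exponent_le (hH1 _ _ (h1 n)) (neg_le_neg (le_max_left _ _))
  · intro r hr
    set κ : ℝ := (1 + 8 * Real.log 2 / (4 * Real.log 2 + 2)) / 2 with hκ
    have hθ : 1 < 8 * Real.log 2 / (4 * Real.log 2 + 2) := by rw [lt_div_iff₀ hD]; linarith
    have hκ1 : 1 < κ := by linarith
    obtain ⟨P, Q, h1, h2, h3⟩ := main_seq E hE0 hE η hη κ (by linarith) (by
      have : κ < 8 * Real.log 2 / (4 * Real.log 2 + 2) := by linarith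
      rwa [lt_div_iff₀ hD] at this)
    have ht : Filter.Tendsto (fun n => ((max |P n| |Q n| : ℤ) : ℝ)) Filter.atTop Filter.atTop :=
      tendsto_intCast_atTop_atTop.comp
        (Filter.tendsto_atTop_mono (fun n => le_max_right |P n| |Q n|) h2)
    have ht2 := (tendsto_rpow_atTop (show 0 < κ - 1 by linarith)).comp ht
    obtain ⟨n, ⟨hn1, hn2⟩, hn3⟩ := (h3.and (ht2.eventually_gt_atTop
      ((|r.num| + r.den : ℤ) : ℝ))).exists
    simp only [Function.comp] at hn3
    set H := ((max |P n| |Q n| : ℤ) : ℝ) with hHd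
    have hHp : 0 < H := lt_of_lt_of_le one_pos (hH1 _ _ (h1 n))
    set z : ℤ := r.num * Q n - r.den * P n with hz
    have hQp : (Q n : ℚ_[2]) ≠ 0 := by exact_mod_cast h1 n
    have hdp : ((r.den : ℤ) : ℚ_[2]) ≠ 0 := by exact_mod_cast r.den_nz
    have e : (η - (P n : ℚ_[2]) / (Q n : ℚ_[2])) * (((r.den * Q n : ℤ)) : ℚ_[2]) = (z : ℚ_[2]) := by
      have hrr : (r : ℚ_[2]) = (r.num : ℚ_[2]) / ((r.den : ℕ) : ℚ_[2]) := by
        conv_lhs => rw [← Rat.num_div_den r]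
        push_cast; rfl
      rw [hr, hz, hrr]
      push_cast at hdp ⊢
      field_simp
    have hzn : ‖(z : ℚ_[2])‖ ≤ ‖η - (P n : ℚ_[2]) / (Q n : ℚ_[2])‖ := by
      rw [← e, norm_mul]
      exact mul_le_of_le_one_right (norm_nonneg _) (Padic.norm_int_le_one _)
    have hz0 : z ≠ 0 := by
      intro h0
      rw [h0, Int.cast_zero, mul_eq_zero] at e
      rcases e with e | e
      · rw [e, norm_zero] at hn1; exact lt_irrefl _ hn1
      · push_cast at e hdp
        exact (mul_ne_zero hdp hQp) e
    have hge := norm_int_ge z hz0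
    have hzp : (0 : ℝ) < |(z : ℝ)| := by
      rw [abs_pos]; exact_mod_cast hz0
    have hzle : |(z : ℝ)| ≤ ((|r.num| + r.den : ℤ) : ℝ) * H := by
      have : |z| ≤ (|r.num| + r.den) * max |P n| |Q n| := by
        rw [hz]
        refine (abs_sub _ _).trans ?_
        rw [abs_mul, abs_mul, add_mul]
        have h5 := le_max_left |P n| |Q n|
        have h6 := le_max_right |P n| |Q n|
        rw [Nat.abs_cast]
        gcongr
      rw [hHd]
      exact_mod_cast this
    have hfin : 1 / |(z : ℝ)| ≤ H ^ (-κ) := hge.trans (hzn.trans hn2)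
    rw [Real.rpow_neg hHp.le, ← one_div, one_div_le_one_div hzp (Real.rpow_pos_of_pos hHp _)] at hfin
    have h7 : H ^ κ = H ^ (κ - 1) * H := by
      rw [Real.rpow_sub_one hHp.ne']; field_simp
    rw [h7] at hfin
    have := le_of_mul_le_mul_right (hfin.trans hzle) hHp
    linarith
end
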